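/- arXiv:2103.15648 — 3 statements merged into one kernel-verified Lean document; each statement's English description precedes it below -/
import Mathlib

section
/- For every real number A > 0, the quantity S(x) := Σ_{p prime, 3 ≤ p < x} log p · #{m ∈ ℕ : m < √(x+2), m² ∣ p + 2, m > (log p)^A} · #{n ∈ ℕ : n < √(x−2), n² ∣ p − 2, n > (log p)^A} tends to infinity as x → ∞. -/
open scoped Classical

open LSeries DirichletCharacter ArithmeticFunction.vonMangoldt
open scoped ArithmeticFunction.vonMangoldt LSeries.notation

lemma sum_range_add_natCast_zmod {q : ℕ} [NeZero q] {M : Type*} [AddCommMonoid M]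
    (g : ZMod q → M) (c : ℕ) : ∑ r ∈ Finset.range q, g ((c + r : ℕ) : ZMod q) = ∑ a, g a := by
  rw [← Equiv.sum_comp (Equiv.addLeft (c : ZMod q)) g]
  refine Finset.sum_bij' (fun r _ ↦ (r : ZMod q)) (fun a _ ↦ a.val) (by simp)
    (fun a _ ↦ by simpa using a.val_lt) (fun r hr ↦ ?_) (fun a _ ↦ by simp) (by simp)
  exact ZMod.val_cast_of_lt (Finset.mem_range.mp hr)

lemma norm_sum_char_mul_le {q : ℕ} [NeZero q] {χ : DirichletCharacter ℂ q} (hχ : χ ≠ 1)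
    {f : ℕ → ℝ} {N : ℕ} (hf₀ : ∀ n, 0 ≤ f n) (hf : AntitoneOn f (Set.Ici N)) (M : ℕ) :
    ‖∑ n ∈ Finset.range (N + q * M), χ n * (f n : ℂ)‖ ≤
      ∑ n ∈ Finset.range N, f n + q * (f N - f (N + q * M)) := by
  have hnorm (n : ℕ) {x : ℝ} (hx : 0 ≤ x) : ‖χ n * (x : ℂ)‖ ≤ x := by
    rw [norm_mul, Complex.norm_real, Real.norm_of_nonneg hx]
    exact mul_le_of_le_one_left hx (χ.norm_le_one _)
  induction M with
  | zero => simpa using (norm_sum_le _ _).trans (Finset.sum_le_sum fun n _ ↦ hnorm n (hf₀ n))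
  | succ M ih =>
    set c := N + q * M with hc
    have hc' : N + q * (M + 1) = c + q := by rw [hc]; ring
    rw [hc', Finset.sum_range_add]
    have hblock : ∑ r ∈ Finset.range q, χ ((c + r : ℕ) : ZMod q) * (f (c + r) : ℂ) =
        -∑ r ∈ Finset.range q, χ ((c + r : ℕ) : ZMod q) * ((f c - f (c + r) : ℝ) : ℂ) := by
      push_cast
      simp only [mul_sub, Finset.sum_sub_distrib, ← Finset.sum_mul]
      have := sum_range_add_natCast_zmod (fun a ↦ χ a) c
      rw [MulChar.sum_eq_zero_of_ne_one hχ] at this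
      push_cast at this
      rw [this]
      ring
    have hle : ‖∑ r ∈ Finset.range q, χ ((c + r : ℕ) : ZMod q) * (f (c + r) : ℂ)‖ ≤
        q * (f c - f (c + q)) := by
      rw [hblock, norm_neg]
      refine (norm_sum_le_of_le
        (f := fun r ↦ χ ((c + r : ℕ) : ZMod q) * ((f c - f (c + r) : ℝ) : ℂ))
        _ fun r hr ↦ ?_ : _ ≤ ∑ r ∈ Finset.range q, (f c - f (c + q))).trans_eq (by simp [mul_sub])
      have hr' := (Finset.mem_range.mp hr).le
      have h1 : f (c + r) ≤ f c := hf (by simp [hc]) (by simp [hc]; omega) (by omega)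
      have h2 : f (c + q) ≤ f (c + r) := hf (by simp [hc]; omega) (by simp [hc]; omega) (by omega)
      exact (hnorm (c + r) (sub_nonneg.mpr h1)).trans (by linarith)
    refine (norm_add_le _ _).trans ((add_le_add ih hle).trans_eq ?_)
    ring

lemma logMul_iterate_apply (f : ℕ → ℂ) (k n : ℕ) :
    logMul^[k] f n = (Real.log n ^ k : ℝ) * f n := by
  induction k generalizing f with
  | zero => simp
  | succ k ih =>
    rw [Function.iterate_succ_apply, ih, logMul, pow_succ, ← Complex.natCast_log]
    push_cast
    ring

lemma antitoneOn_log_pow_mul_rpow (k : ℕ) {σ : ℝ} (hσ : 1 < σ) :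
    AntitoneOn (fun x : ℝ ↦ Real.log x ^ k * x ^ (-σ)) (Set.Ici (Real.exp (k + 1))) := by
  have hk : (0 : ℝ) < ((k : ℝ) + 1)⁻¹ := by positivity
  intro x hx y hy hxy
  have hexp : 1 ≤ Real.exp (k + 1) := Real.one_le_exp (by positivity)
  have hx1 : (1 : ℝ) ≤ x := hexp.trans hx
  have hx0 : 0 < x := by linarith
  have hy1 : (1 : ℝ) ≤ y := hexp.trans hy
  have hanti := Real.log_div_self_rpow_antitoneOn hk (by simpa using hx) (by simpa using hy) hxy
  have hdecomp {z : ℝ} (hz : 1 ≤ z) : Real.log z ^ k * z ^ (-σ) =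
      (Real.log z / z ^ ((k : ℝ) + 1)⁻¹) ^ k * z ^ (-(σ - k / (k + 1))) := by
    have hz0 : 0 < z := by linarith
    rw [div_pow, ← Real.rpow_natCast (z ^ _), ← Real.rpow_mul hz0.le, div_eq_mul_inv,
      ← Real.rpow_neg hz0.le, mul_assoc, ← Real.rpow_add hz0]
    congr 2
    field_simp
    ring
  have hσk : 0 ≤ σ - k / (k + 1) := by
    have : (k : ℝ) / (k + 1) ≤ 1 := by rw [div_le_one (by positivity)]; linarith
    linarith
  simp only
  rw [hdecomp hx1, hdecomp hy1]
  refine mul_le_mul (pow_le_pow_left₀ (div_nonneg (Real.log_nonneg hy1) (by positivity)) hanti k)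
    (Real.rpow_le_rpow_of_nonpos hx0 hxy (by linarith)) (by positivity)
    (pow_nonneg (div_nonneg (Real.log_nonneg hx1) (by positivity)) k)

lemma sum_range_log_pow_mul_rpow_le (k : ℕ) {σ : ℝ} (hσ : 1 < σ) {N : ℕ} (hN : 1 ≤ N) :
    ∑ n ∈ Finset.range N, Real.log n ^ k * (n : ℝ) ^ (-σ) ≤
      Real.log N ^ k * (1 + Real.log N) := by
  have hharm : ∑ n ∈ Finset.range N, ((n : ℝ))⁻¹ ≤ 1 + Real.log N := by
    refine le_trans ?_ (harmonic_le_one_add_log N)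
    obtain ⟨N, rfl⟩ := Nat.exists_eq_add_of_le' hN
    rw [Finset.sum_range_succ', harmonic]
    push_cast
    simp only [inv_zero, add_zero]
    exact Finset.sum_le_sum_of_subset_of_nonneg (Finset.range_mono (by omega))
      fun _ _ _ ↦ by positivity
  refine le_trans ?_ (mul_le_mul_of_nonneg_left hharm
    (pow_nonneg (Real.log_nonneg (by exact_mod_cast hN)) k))
  rw [Finset.mul_sum]
  refine Finset.sum_le_sum fun n hn ↦ ?_
  rcases n.eq_zero_or_pos with rfl | hn0
  · simp [Real.zero_rpow (show -σ ≠ 0 by linarith)]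
  have hn1 : (1 : ℝ) ≤ n := by exact_mod_cast hn0
  have hnN : (n : ℝ) ≤ N := by exact_mod_cast (Finset.mem_range.mp hn).le
  gcongr
  rw [← Real.rpow_neg_one]
  exact Real.rpow_le_rpow_of_exponent_le hn1 (by linarith)

/-- The derivatives at real `σ > 1` of the `L`-series of a nontrivial Dirichlet character are
polynomially bounded in the logarithm of the modulus. -/
lemma exists_norm_iteratedDeriv_LSeries_le (k : ℕ) : ∃ C : ℝ, 0 < C ∧
    ∀ (q : ℕ) [NeZero q] (χ : DirichletCharacter ℂ q), χ ≠ 1 → ∀ σ : ℝ, 1 < σ →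
      ‖iteratedDeriv k (L ↗χ) σ‖ ≤ C * (1 + Real.log q) ^ (k + 1) := by
  set B : ℕ := 3 ^ (k + 1) with hB
  have hB1 : 1 ≤ B := Nat.one_le_pow _ _ (by norm_num)
  refine ⟨2 * (1 + Real.log B) ^ (k + 1), ?_, fun q _ χ hχ σ hσ ↦ ?_⟩
  · have : 0 ≤ Real.log B := Real.log_natCast_nonneg _
    positivity
  have habs : abscissaOfAbsConv ↗χ < (σ : ℂ).re := by
    rw [absicssaOfAbsConv_eq_one (NeZero.ne q)]; exact_mod_cast hσ
  rw [LSeries_iteratedDeriv k habs, norm_mul, norm_pow, norm_neg, norm_one, one_pow, one_mul]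
  set f : ℕ → ℝ := fun n ↦ Real.log n ^ k * (n : ℝ) ^ (-σ) with hf
  have hterm (n : ℕ) : term (logMul^[k] ↗χ) σ n = χ n * (f n : ℂ) := by
    rcases n.eq_zero_or_pos with rfl | hn
    · simp [hf, Real.zero_rpow (show -σ ≠ 0 by linarith)]
    · rw [term_of_ne_zero hn.ne', logMul_iterate_apply, hf]
      simp only
      rw [div_eq_mul_inv, ← Complex.cpow_neg, Complex.ofReal_mul,
        Complex.ofReal_cpow (by positivity)]
      push_cast
      ring
  have hsum : HasSum (fun n : ℕ ↦ χ n * (f n : ℂ)) (L (logMul^[k] ↗χ) σ) := by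
    have h : LSeriesSummable (logMul^[k] ↗χ) σ := by
      refine LSeriesSummable_of_abscissaOfAbsConv_lt_re ?_
      rwa [absicssaOfAbsConv_logPowMul]
    exact (funext hterm : term (logMul^[k] ↗χ) σ = _) ▸ h.hasSum
  set N := q * B with hN
  have hq1 : 1 ≤ q := NeZero.one_le
  have hN1 : 1 ≤ N := Nat.mul_pos hq1 hB1
  have hf₀ (n : ℕ) : 0 ≤ f n := by
    have := Real.log_natCast_nonneg n
    positivity
  have hanti : AntitoneOn f (Set.Ici N) := by
    have hexp : Real.exp (k + 1) ≤ N := by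
      have h3 : Real.exp (k + 1) ≤ (3 : ℝ) ^ (k + 1) := by
        rw [show ((k : ℝ) + 1) = ((k + 1 : ℕ) : ℝ) * 1 by push_cast; ring, Real.exp_nat_mul]
        exact pow_le_pow_left₀ (Real.exp_pos _).le Real.exp_one_lt_three.le _
      refine h3.trans ?_
      have : B ≤ N := Nat.le_mul_of_pos_left _ hq1
      calc (3 : ℝ) ^ (k + 1) = (B : ℝ) := by rw [hB]; push_cast; rfl
        _ ≤ N := by exact_mod_cast this
    intro m hm n hn hmn
    refine antitoneOn_log_pow_mul_rpow k hσ (hexp.trans ?_) (hexp.trans ?_) ?_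
    · exact_mod_cast hm
    · exact_mod_cast hn
    · exact_mod_cast hmn
  have hlogN : 0 ≤ Real.log N := Real.log_natCast_nonneg _
  have hbound (M : ℕ) : ‖∑ n ∈ Finset.range (N + q * M), χ n * (f n : ℂ)‖ ≤
      Real.log N ^ k * (1 + Real.log N) + Real.log N ^ k := by
    refine (norm_sum_char_mul_le hχ hf₀ hanti M).trans
      (add_le_add (sum_range_log_pow_mul_rpow_le k hσ hN1) ?_)
    have hN0 : (0 : ℝ) < N := by exact_mod_cast hN1
    calc q * (f N - f (N + q * M)) ≤ N * f N := by
          have := hf₀ (N + q * M)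
          have hqN : (q : ℝ) ≤ N := by exact_mod_cast Nat.le_mul_of_pos_right q hB1
          refine mul_le_mul hqN (by linarith) ?_ hN0.le
          exact sub_nonneg.mpr (hanti (by simp) (by simp) (by simp))
      _ = Real.log N ^ k * (N : ℝ) ^ (1 - σ) := by
          rw [hf]; simp only
          rw [sub_eq_add_neg, Real.rpow_add hN0, Real.rpow_one]; ring
      _ ≤ _ := mul_le_of_le_one_right (by positivity)
          (Real.rpow_le_one_of_one_le_of_nonpos (by exact_mod_cast hN1) (by linarith))
  have hlim : Filter.Tendsto (fun M ↦ N + q * M) Filter.atTop Filter.atTop :=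
    Filter.tendsto_atTop_mono (fun M ↦ (Nat.le_mul_of_pos_left M hq1).trans (Nat.le_add_left _ _))
      Filter.tendsto_id
  have hle := le_of_tendsto' (hsum.tendsto_sum_nat.comp hlim).norm hbound
  refine hle.trans ?_
  have hlog : Real.log N = Real.log q + Real.log B := by
    rw [hN, Nat.cast_mul, Real.log_mul (by exact_mod_cast NeZero.ne q) (by positivity)]
  have hlq : 0 ≤ Real.log q := Real.log_natCast_nonneg _
  have hlB : 0 ≤ Real.log B := Real.log_natCast_nonneg _
  calc Real.log N ^ k * (1 + Real.log N) + Real.log N ^ k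
      ≤ (1 + Real.log N) ^ k * (1 + Real.log N) + (1 + Real.log N) ^ k * (1 + Real.log N) := by
        gcongr
        · linarith
        · calc Real.log N ^ k ≤ (1 + Real.log N) ^ k := by gcongr; linarith
            _ ≤ _ := le_mul_of_one_le_right (by positivity) (by linarith)
    _ = 2 * (1 + Real.log N) ^ (k + 1) := by ring
    _ ≤ 2 * ((1 + Real.log B) * (1 + Real.log q)) ^ (k + 1) := by
        gcongr
        rw [hlog]; nlinarith
    _ = _ := by rw [mul_pow]; ring

lemma exists_norm_LSeries_one_le (q : ℕ) [NeZero q] : ∃ C : ℝ, 0 < C ∧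
    ∀ σ ∈ Set.Ioc (1 : ℝ) 2, ‖L ↗(1 : DirichletCharacter ℂ q) σ‖ * (σ - 1) ≤ C := by
  have hcont : ContinuousOn (fun σ : ℝ ↦ LFunctionTrivChar₁ q σ) (Set.Icc 1 2) :=
    ((differentiable_LFunctionTrivChar₁ q).continuous.comp Complex.continuous_ofReal).continuousOn
  obtain ⟨C, hC⟩ := isCompact_Icc.exists_bound_of_continuousOn hcont
  refine ⟨max C 1, by positivity, fun σ hσ ↦ le_max_of_le_left ?_⟩
  have hne : (σ : ℂ) ≠ 1 := by exact_mod_cast hσ.1.ne'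
  have h := hC σ ⟨hσ.1.le, hσ.2⟩
  rw [LFunctionTrivChar₁, Function.update_of_ne hne, LFunctionTrivChar,
    LFunction_eq_LSeries _ (by simpa using hσ.1), norm_mul] at h
  have h1 : ‖(σ : ℂ) - 1‖ = σ - 1 := by
    rw [← Complex.ofReal_one, ← Complex.ofReal_sub, Complex.norm_real,
      Real.norm_of_nonneg (by linarith [hσ.1])]
  rw [h1] at h
  linarith

lemma changeLevel_pow_natCast {q K : ℕ} (hK : K ≠ 0) (χ : DirichletCharacter ℂ q) (n : ℕ) :
    changeLevel (dvd_pow_self q hK) χ n = χ n := by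
  by_cases h : IsUnit ((n : ℕ) : ZMod (q ^ K))
  · obtain ⟨u, hu⟩ := h
    rw [← hu, changeLevel_eq_cast_of_dvd _ (dvd_pow_self q hK), hu,
      ZMod.cast_natCast (dvd_pow_self q hK) n]
  · rw [MulChar.map_nonunit _ h, MulChar.map_nonunit]
    rw [ZMod.isUnit_iff_coprime] at h ⊢
    exact fun h' ↦ h (h'.pow_right K)

lemma one_pow_natCast {q K : ℕ} (hK : K ≠ 0) (n : ℕ) :
    (1 : DirichletCharacter ℂ (q ^ K)) n = (1 : DirichletCharacter ℂ q) n := by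
  rw [← changeLevel_pow_natCast hK (1 : DirichletCharacter ℂ q), changeLevel_one]

lemma exists_le_norm_LSeries_of_sq_ne_one (q : ℕ) [NeZero q] : ∃ c : ℝ, 0 < c ∧
    ∀ K : ℕ, K ≠ 0 → ∀ χ : DirichletCharacter ℂ (q ^ K), χ ^ 2 ≠ 1 → ∀ σ ∈ Set.Ioc (1 : ℝ) 2,
      c ≤ ‖L ↗χ σ‖ * (1 + Real.log ↑(q ^ K)) ^ 7 := by
  obtain ⟨C₀, hC₀, h₀⟩ := exists_norm_iteratedDeriv_LSeries_le 0
  obtain ⟨C₁, hC₁, h₁⟩ := exists_norm_iteratedDeriv_LSeries_le 1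
  obtain ⟨T, hT, hT'⟩ := exists_norm_LSeries_one_le q
  -- `c₀` is a lower bound in the 3-4-1 inequality, `c` the resulting optimal displacement.
  set c₀ : ℝ := 1 / (T ^ 3 * C₀) with hc₀
  have hc₀pos : 0 < c₀ := by positivity
  set c : ℝ := min 1 (c₀ / (16 * C₁ ^ 4)) with hc
  have hcpos : 0 < c := by positivity
  refine ⟨C₁ * c, by positivity, fun K hK χ hχ σ hσ ↦ ?_⟩
  have hχ1 : χ ≠ 1 := by rintro rfl; simp at hχ
  set ℓ : ℝ := 1 + Real.log ↑(q ^ K) with hℓ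
  have hℓ1 : 1 ≤ ℓ := by have := Real.log_natCast_nonneg (q ^ K); linarith
  have hℓ0 : 0 < ℓ := by linarith
  have hL341 (σ : ℝ) (hσ : σ ∈ Set.Ioc (1 : ℝ) 2) :
      c₀ * (σ - 1) ^ 3 ≤ ‖L ↗χ σ‖ ^ 4 * ℓ := by
    have hx : 0 < σ - 1 := by linarith [hσ.1]
    have h := norm_LSeries_product_ge_one χ hx 0
    simp only [Complex.ofReal_zero, mul_zero, add_zero, Complex.ofReal_sub, Complex.ofReal_one,
      add_sub_cancel] at h
    have hone : L ↗(1 : DirichletCharacter ℂ (q ^ K)) σ = L ↗(1 : DirichletCharacter ℂ q) σ :=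
      LSeries_congr (fun {n} _ ↦ one_pow_natCast hK n) _
    rw [hone, norm_mul, norm_mul, norm_pow, norm_pow] at h
    have hsq := h₀ (q ^ K) (χ ^ 2) hχ σ hσ.1
    rw [iteratedDeriv_zero, zero_add, pow_one] at hsq
    have hT3 : (‖L ↗(1 : DirichletCharacter ℂ q) σ‖ * (σ - 1)) ^ 3 ≤ T ^ 3 :=
      pow_le_pow_left₀ (by positivity) (hT' σ hσ) 3
    rw [hc₀, div_mul_eq_mul_div, one_mul, div_le_iff₀ (by positivity)]
    calc (σ - 1) ^ 3 ≤ (σ - 1) ^ 3 * (‖L ↗(1 : DirichletCharacter ℂ q) σ‖ ^ 3 * ‖L ↗χ σ‖ ^ 4 *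
          ‖L ↗(χ ^ 2) σ‖) := le_mul_of_one_le_right (by positivity) h
      _ = (‖L ↗(1 : DirichletCharacter ℂ q) σ‖ * (σ - 1)) ^ 3 * ‖L ↗χ σ‖ ^ 4 *
          ‖L ↗(χ ^ 2) σ‖ := by ring
      _ ≤ T ^ 3 * ‖L ↗χ σ‖ ^ 4 * (C₀ * ℓ) := by gcongr
      _ = _ := by ring
  have hη : 0 < c / ℓ ^ 9 := by positivity
  have hη1 : c / ℓ ^ 9 ≤ 1 := by
    rw [div_le_one (by positivity)]
    exact (min_le_left _ _).trans (one_le_pow₀ hℓ1)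
  have hfar (τ : ℝ) (hτ : τ ∈ Set.Ioc (1 : ℝ) 2) (hτη : 1 + c / ℓ ^ 9 ≤ τ) :
      2 * C₁ * c ≤ ‖L ↗χ τ‖ * ℓ ^ 7 := by
    refine le_of_pow_le_pow_left₀ (n := 4) (by norm_num) (by positivity) ?_
    have h3 : (c / ℓ ^ 9) ^ 3 ≤ (τ - 1) ^ 3 := pow_le_pow_left₀ hη.le (by linarith) 3
    have hcc : 16 * C₁ ^ 4 * c ≤ c₀ := by
      have : c ≤ c₀ / (16 * C₁ ^ 4) := min_le_right _ _
      rw [le_div_iff₀ (by positivity)] at this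
      linarith
    calc (2 * C₁ * c) ^ 4 = (16 * C₁ ^ 4 * c) * c ^ 3 := by ring
      _ ≤ c₀ * c ^ 3 := by gcongr
      _ = c₀ * (c / ℓ ^ 9) ^ 3 * ℓ ^ 27 := by field_simp
      _ ≤ c₀ * (τ - 1) ^ 3 * ℓ ^ 27 := by gcongr
      _ ≤ ‖L ↗χ τ‖ ^ 4 * ℓ * ℓ ^ 27 := 
          mul_le_mul_of_nonneg_right (hL341 τ hτ) (by positivity)
      _ = _ := by ring
  rcases le_or_gt (1 + c / ℓ ^ 9) σ with h | h
  · have := hfar σ hσ h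
    have : 0 < C₁ * c := by positivity
    linarith
  · set τ : ℝ := 1 + c / ℓ ^ 9 with hτ
    have hτ' := hfar τ ⟨by linarith, by linarith⟩ le_rfl
    have hdiff (x : ℝ) (hx : x ∈ Set.Ioi (1 : ℝ)) : HasDerivAt (fun x : ℝ ↦ L ↗χ x)
        (deriv (L ↗χ) x) x := by
      have habs : abscissaOfAbsConv ↗χ < (x : ℂ).re := by
        rw [absicssaOfAbsConv_eq_one (NeZero.ne _)]; exact_mod_cast hx
      exact (LSeries_hasDerivAt habs).differentiableAt.hasDerivAt.comp_ofReal
    have hmv := (convex_Ioi (1 : ℝ)).norm_image_sub_le_of_norm_hasDerivWithin_le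
      (f := fun x : ℝ ↦ L ↗χ x) (C := C₁ * ℓ ^ 2)
      (fun x hx ↦ (hdiff x hx).hasDerivWithinAt)
      (fun x hx ↦ iteratedDeriv_one (f := L ↗χ) ▸ h₁ (q ^ K) χ hχ1 x hx) hσ.1
      (show τ ∈ Set.Ioi (1 : ℝ) by simp [hτ, hη])
    rw [Real.norm_of_nonneg (by linarith)] at hmv
    have hle : C₁ * ℓ ^ 2 * (τ - σ) ≤ C₁ * ℓ ^ 2 * (c / ℓ ^ 9) := by
      gcongr; linarith [hσ.1]
    have heq : C₁ * ℓ ^ 2 * (c / ℓ ^ 9) * ℓ ^ 7 = C₁ * c := by field_simp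
    have htri : ‖L ↗χ τ‖ ≤ ‖L ↗χ σ‖ + C₁ * ℓ ^ 2 * (c / ℓ ^ 9) := by
      have := norm_le_norm_add_norm_sub' (L ↗χ τ) (L ↗χ σ)
      linarith
    have := mul_le_mul_of_nonneg_right htri (pow_nonneg hℓ0.le 7)
    rw [add_mul, heq] at this
    linarith

/-- For odd `q`, a quadratic Dirichlet character modulo `q ^ K` comes from a character
modulo `q`. -/
lemma exists_changeLevel_eq_of_sq_eq_one {q : ℕ} [NeZero q] (hq : Odd q) {K : ℕ} (hK : K ≠ 0)
    {χ : DirichletCharacter ℂ (q ^ K)} (hχ : χ ^ 2 = 1) :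
    ∃ ψ : DirichletCharacter ℂ q, χ = changeLevel (dvd_pow_self q hK) ψ := by
  suffices h : χ.FactorsThrough q from h.2
  rw [factorsThrough_iff_ker_unitsMap (dvd_pow_self q hK)]
  intro u hu
  obtain ⟨j, rfl⟩ := Nat.exists_eq_succ_of_ne_zero hK
  have hpow : u ^ (q ^ j) = 1 := by
    rw [MonoidHom.mem_ker, Units.ext_iff, ZMod.unitsMap_def, Units.coe_map] at hu
    have hu' : (((u : ZMod (q ^ (j + 1))).val : ℤ) : ZMod q) = 1 := by
      rw [Int.cast_natCast, ZMod.natCast_val]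
      simpa using hu
    have hdvd : (q : ℤ) ∣ ((u : ZMod (q ^ (j + 1))).val : ℤ) - 1 := by
      rw [← ZMod.intCast_zmod_eq_zero_iff_dvd]
      push_cast at hu' ⊢
      rw [hu', sub_self]
    have h := dvd_sub_pow_of_dvd_sub hdvd j
    rw [one_pow] at h
    have h' : ((((u : ZMod (q ^ (j + 1))).val : ℤ) ^ q ^ j - 1 : ℤ) : ZMod (q ^ (j + 1))) = 0 := by
      rw [ZMod.intCast_zmod_eq_zero_iff_dvd]
      exact_mod_cast h
    rw [Units.ext_iff]
    push_cast at h' ⊢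
    rw [ZMod.natCast_zmod_val, sub_eq_zero] at h'
    exact h'
  rw [MonoidHom.mem_ker]
  have h2 : (MulChar.toUnitHom χ u) ^ 2 = 1 := by
    rw [Units.ext_iff]
    have := congrArg (fun ψ : DirichletCharacter ℂ (q ^ (j + 1)) ↦ ψ u) hχ
    simpa [MulChar.pow_apply' χ two_ne_zero] using this
  have hodd : (MulChar.toUnitHom χ u) ^ (q ^ j) = 1 := by rw [← map_pow, hpow, map_one]
  obtain ⟨m, hm⟩ := hq.pow (n := j)
  rwa [hm, pow_succ, pow_mul, h2, one_pow, one_mul] at hodd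

lemma exists_le_norm_LSeries_of_sq_eq_one {q : ℕ} [NeZero q] (hq : Odd q) : ∃ c : ℝ, 0 < c ∧
    ∀ K : ℕ, K ≠ 0 → ∀ χ : DirichletCharacter ℂ (q ^ K), χ ≠ 1 → χ ^ 2 = 1 →
      ∀ σ ∈ Set.Ioc (1 : ℝ) 2, c ≤ ‖L ↗χ σ‖ := by
  have hψ (ψ : DirichletCharacter ℂ q) : ∃ c : ℝ, 0 < c ∧
      (ψ ≠ 1 → ∀ σ ∈ Set.Icc (1 : ℝ) 2, c ≤ ‖LFunction ψ σ‖) := by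
    by_cases h1 : ψ = 1
    · exact ⟨1, one_pos, fun h ↦ (h h1).elim⟩
    have hcont : ContinuousOn (fun σ : ℝ ↦ ‖LFunction ψ σ‖) (Set.Icc 1 2) :=
      ((differentiable_LFunction h1).continuous.comp
        Complex.continuous_ofReal).norm.continuousOn
    obtain ⟨x, hx, hmin⟩ := isCompact_Icc.exists_isMinOn
      (Set.nonempty_Icc.mpr (one_le_two : (1 : ℝ) ≤ 2)) hcont
    refine ⟨‖LFunction ψ x‖, norm_pos_iff.mpr ?_, fun _ σ hσ ↦ hmin hσ⟩
    exact LFunction_ne_zero_of_one_le_re ψ (.inl h1) (by simpa using hx.1)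
  choose c hcpos hc using hψ
  obtain ⟨ψ₀, -, hψ₀⟩ := Finset.exists_min_image
    (Finset.univ : Finset (DirichletCharacter ℂ q)) c ⟨1, Finset.mem_univ _⟩
  refine ⟨c ψ₀, hcpos ψ₀, fun K hK χ hχ hχ2 σ hσ ↦ ?_⟩
  obtain ⟨ψ, rfl⟩ := exists_changeLevel_eq_of_sq_eq_one hq hK hχ2
  have hψ1 : ψ ≠ 1 := by rintro rfl; exact hχ (changeLevel_one _)
  have hL : L ↗(changeLevel (dvd_pow_self q hK) ψ) σ = LFunction ψ σ := by
    rw [LFunction_eq_LSeries _ (by simpa using hσ.1)]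
    exact LSeries_congr (fun {n} _ ↦ changeLevel_pow_natCast hK ψ n) _
  rw [hL]
  exact (hψ₀ ψ (Finset.mem_univ _)).trans (hc ψ hψ1 σ ⟨hσ.1.le, hσ.2⟩)

/-- For odd `q`, the `L`-series of the nontrivial characters modulo powers of `q` are bounded
below on `(1, 2]` by a power of the logarithm of the modulus. -/
lemma exists_le_norm_LSeries {q : ℕ} [NeZero q] (hq : Odd q) : ∃ c : ℝ, 0 < c ∧
    ∀ K : ℕ, K ≠ 0 → ∀ χ : DirichletCharacter ℂ (q ^ K), χ ≠ 1 → ∀ σ ∈ Set.Ioc (1 : ℝ) 2,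
      c ≤ ‖L ↗χ σ‖ * (1 + Real.log ↑(q ^ K)) ^ 7 := by
  obtain ⟨c, hc, h⟩ := exists_le_norm_LSeries_of_sq_ne_one q
  obtain ⟨c', hc', h'⟩ := exists_le_norm_LSeries_of_sq_eq_one hq
  refine ⟨min c c', lt_min hc hc', fun K hK χ hχ σ hσ ↦ ?_⟩
  by_cases hχ2 : χ ^ 2 = 1
  · refine (min_le_right _ _).trans ((h' K hK χ hχ hχ2 σ hσ).trans ?_)
    refine le_mul_of_one_le_right (norm_nonneg _) (one_le_pow₀ ?_)
    have := Real.log_natCast_nonneg (q ^ K)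
    linarith
  · exact (min_le_left _ _).trans (h K hK χ hχ2 σ hσ)

lemma abscissaOfAbsConv_twist_vonMangoldt_le {q : ℕ} (χ : DirichletCharacter ℂ q) :
    abscissaOfAbsConv (↗χ * ↗Λ) ≤ 1 :=
  abscissaOfAbsConv_le_of_forall_lt_LSeriesSummable fun y hy ↦
    LSeriesSummable_twist_vonMangoldt χ (by simpa using hy)

lemma contDiffAt_LSeries {f : ℕ → ℂ} {s : ℂ} (h : abscissaOfAbsConv f < s.re) (n : WithTop ℕ∞) :
    ContDiffAt ℂ n (L f) s :=
  (LSeries_analyticOnNhd f s h).contDiffAt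

/-- For odd `q`, the derivatives of the logarithmic derivatives of the `L`-series of the nontrivial
characters modulo powers of `q` are polynomially bounded in the logarithm of the modulus. -/
lemma exists_norm_iteratedDeriv_twist_vonMangoldt_le {q : ℕ} [NeZero q] (hq : Odd q) (k : ℕ) :
    ∃ (C : ℝ) (e : ℕ), 0 < C ∧ ∀ i < k, ∀ K : ℕ, K ≠ 0 → ∀ χ : DirichletCharacter ℂ (q ^ K),
      χ ≠ 1 → ∀ σ ∈ Set.Ioc (1 : ℝ) 2,
        ‖iteratedDeriv i (L (↗χ * ↗Λ)) σ‖ ≤ C * (1 + Real.log ↑(q ^ K)) ^ e := by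
  obtain ⟨c, hc, hlow⟩ := exists_le_norm_LSeries hq
  choose D hDpos hD using exists_norm_iteratedDeriv_LSeries_le
  induction k with
  | zero => exact ⟨1, 0, one_pos, fun i hi ↦ (Nat.not_lt_zero i hi).elim⟩
  | succ k ih =>
    obtain ⟨C, e, hC, h⟩ := ih
    set S : ℝ := D (k + 1) + ∑ i ∈ Finset.range k, (k.choose i : ℝ) * C * D (k - i) with hS
    have hSpos : 0 < S := add_pos_of_pos_of_nonneg (hDpos _)
      (Finset.sum_nonneg fun i _ ↦ by have := hDpos (k - i); positivity)
    refine ⟨C + S / c, e + k + 9, by positivity, fun i hi K hK χ hχ σ hσ ↦ ?_⟩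
    set ℓ : ℝ := 1 + Real.log ↑(q ^ K) with hℓ
    have hℓ1 : 1 ≤ ℓ := by have := Real.log_natCast_nonneg (q ^ K); linarith
    rcases (Nat.lt_succ_iff.mp hi).lt_or_eq with hi | rfl
    · refine (h i hi K hK χ hχ σ hσ).trans ?_
      have : 0 ≤ S / c := by positivity
      gcongr
      · linarith
      · omega
    · have hχabs : abscissaOfAbsConv ↗χ < (σ : ℂ).re := by
        rw [absicssaOfAbsConv_eq_one (NeZero.ne _)]; exact_mod_cast hσ.1
      have hΛabs : abscissaOfAbsConv (↗χ * ↗Λ) < (σ : ℂ).re :=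
        (abscissaOfAbsConv_twist_vonMangoldt_le χ).trans_lt (by exact_mod_cast hσ.1)
      have hmul : (L (↗χ * ↗Λ)) * (L ↗χ) =ᶠ[nhds (σ : ℂ)] -deriv (L ↗χ) := by
        have hopen : {s : ℂ | 1 < s.re} ∈ nhds (σ : ℂ) :=
          (isOpen_lt continuous_const Complex.continuous_re).mem_nhds (by simpa using hσ.1)
        filter_upwards [hopen] with s hs
        rw [Pi.mul_apply, LSeries_twist_vonMangoldt_eq χ hs,
          div_mul_cancel₀ _ (LSeries_ne_zero_of_one_lt_re χ hs), Pi.neg_apply]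
      have hleib := hmul.iteratedDeriv_eq i
      rw [iteratedDeriv_mul (contDiffAt_LSeries hΛabs _) (contDiffAt_LSeries hχabs _),
        Finset.sum_range_succ, iteratedDeriv_neg, ← iteratedDeriv_succ', Nat.choose_self,
        Nat.sub_self, iteratedDeriv_zero, Nat.cast_one, one_mul] at hleib
      have hnorm : ‖iteratedDeriv i (L (↗χ * ↗Λ)) σ‖ * ‖L ↗χ σ‖ ≤ S * ℓ ^ (e + i + 2) := by
        rw [← norm_mul, eq_sub_of_add_eq' hleib, hS, add_mul, Finset.sum_mul]
        refine (norm_sub_le _ _).trans (add_le_add ?_ (norm_sum_le_of_le _ fun j hj ↦ ?_))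
        · rw [norm_neg]
          refine (hD (i + 1) (q ^ K) χ hχ σ hσ.1).trans ?_
          have := hDpos (i + 1)
          exact mul_le_mul_of_nonneg_left (pow_le_pow_right₀ hℓ1 (by omega)) this.le
        · have hj' := Finset.mem_range.mp hj
          have h1 := h j hj' K hK χ hχ σ hσ
          have h2 := hD (i - j) (q ^ K) χ hχ σ hσ.1
          have := hDpos (i - j)
          rw [norm_mul, norm_mul, Complex.norm_natCast]
          calc (i.choose j : ℝ) * ‖iteratedDeriv j (L (↗χ * ↗Λ)) σ‖ *
                ‖iteratedDeriv (i - j) (L ↗χ) σ‖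
              ≤ (i.choose j : ℝ) * (C * ℓ ^ e) * (D (i - j) * ℓ ^ (i - j + 1)) := by gcongr
            _ = (i.choose j : ℝ) * C * D (i - j) * ℓ ^ (e + (i - j + 1)) := by ring
            _ ≤ _ := mul_le_mul_of_nonneg_left (pow_le_pow_right₀ hℓ1 (by omega)) (by positivity)
      have hfin : ‖iteratedDeriv i (L (↗χ * ↗Λ)) σ‖ * c ≤ S * ℓ ^ (e + i + 9) :=
        calc _ ≤ ‖iteratedDeriv i (L (↗χ * ↗Λ)) σ‖ * (‖L ↗χ σ‖ * ℓ ^ 7) := by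
              gcongr; exact hlow K hK χ hχ σ hσ
          _ = ‖iteratedDeriv i (L (↗χ * ↗Λ)) σ‖ * ‖L ↗χ σ‖ * ℓ ^ 7 := by ring
          _ ≤ S * ℓ ^ (e + i + 2) * ℓ ^ 7 := by gcongr
          _ = _ := by ring
      rw [← le_div_iff₀ hc] at hfin
      refine hfin.trans ?_
      rw [add_mul C, div_mul_eq_mul_div]
      have : 0 ≤ C * ℓ ^ (e + i + 9) := by positivity
      linarith

/-- The derivatives of the logarithmic derivative of the trivial character's `L`-series differ from
those of `1 / (s - 1)` by a bounded amount on `(1, 2]`. -/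
lemma exists_norm_iteratedDeriv_one_vonMangoldt_sub_le (q : ℕ) [NeZero q] (k : ℕ) : ∃ C : ℝ,
    0 < C ∧ ∀ σ ∈ Set.Ioc (1 : ℝ) 2,
      ‖(-1) ^ k * iteratedDeriv k (L (↗(1 : DirichletCharacter ℂ q) * ↗Λ)) σ -
        ((k.factorial / (σ - 1) ^ (k + 1) : ℝ) : ℂ)‖ ≤ C := by
  set T := LFunctionTrivChar₁ q with hT
  set h : ℂ → ℂ := fun s ↦ -(deriv T s / T s) with hh
  have hTdiff : Differentiable ℂ T := differentiable_LFunctionTrivChar₁ q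
  have hTne {σ : ℝ} (hσ : 1 ≤ σ) : T σ ≠ 0 := by
    rcases hσ.eq_or_lt with rfl | hσ
    · exact Complex.ofReal_one ▸ LFunctionTrivChar₁_apply_one_ne_zero q
    · have hne : (σ : ℂ) ≠ 1 := by exact_mod_cast hσ.ne'
      rw [hT, LFunctionTrivChar₁, Function.update_of_ne hne]
      exact mul_ne_zero (sub_ne_zero.mpr hne)
        (LFunction_ne_zero_of_one_le_re _ (.inr hne) (by simpa using hσ.le))
  have hhan : AnalyticOnNhd ℂ h {s | T s ≠ 0} := fun s hs ↦
    (((hTdiff.analyticAt s).deriv).div (hTdiff.analyticAt s) hs).neg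
  have hcont : ContinuousOn (fun σ : ℝ ↦ iteratedDeriv k h σ) (Set.Icc 1 2) := by
    have h1 : ContinuousOn (iteratedDeriv k h) {s | T s ≠ 0} := by
      rw [iteratedDeriv_eq_iterate]
      exact (hhan.iterated_deriv k).continuousOn
    exact h1.comp Complex.continuous_ofReal.continuousOn fun σ hσ ↦ hTne hσ.1
  obtain ⟨C, hC⟩ := isCompact_Icc.exists_bound_of_continuousOn hcont
  refine ⟨max C 1, by positivity, fun σ hσ ↦ le_max_of_le_left ?_⟩
  have hne : (σ : ℂ) ≠ 1 := by exact_mod_cast hσ.1.ne'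
  have heq : L (↗(1 : DirichletCharacter ℂ q) * ↗Λ) =ᶠ[nhds (σ : ℂ)]
      h + fun s ↦ (s - 1)⁻¹ := by
    have hopen : {s : ℂ | 1 < s.re} ∈ nhds (σ : ℂ) :=
      (isOpen_lt continuous_const Complex.continuous_re).mem_nhds (by simpa using hσ.1)
    filter_upwards [hopen] with s hs
    have hs1 : s ≠ 1 := by rintro rfl; simp at hs
    have hLne : LFunction (1 : DirichletCharacter ℂ q) s ≠ 0 :=
      LFunction_ne_zero_of_one_le_re _ (.inr hs1) (le_of_lt hs)
    rw [LSeries_twist_vonMangoldt_eq _ hs, ← deriv_LFunction_eq_deriv_LSeries _ hs,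
      ← LFunction_eq_LSeries _ hs, Pi.add_apply, hh, hT]
    simp only
    rw [deriv_LFunctionTrivChar₁_apply_of_ne_one _ hs1, LFunctionTrivChar₁,
      Function.update_of_ne hs1, LFunctionTrivChar]
    have := sub_ne_zero.mpr hs1
    field_simp
    ring
  have hinv : iteratedDeriv k (fun s : ℂ ↦ (s - 1)⁻¹) σ =
      (-1) ^ k * ((k.factorial / (σ - 1) ^ (k + 1) : ℝ) : ℂ) := by
    rw [iteratedDeriv_comp_sub_const k (fun s : ℂ ↦ s⁻¹) 1]
    simp only
    rw [iteratedDeriv_eq_iterate]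
    have := iter_deriv_inv k ((σ : ℂ) - 1)
    rw [show (fun s : ℂ ↦ s⁻¹) = Inv.inv from rfl, this, mul_assoc]
    congr 1
    push_cast
    rw [div_eq_mul_inv, show (-1 - (k : ℤ)) = -((k + 1 : ℕ) : ℤ) by push_cast; ring,
      zpow_neg, zpow_natCast]
  have hanσ : AnalyticAt ℂ h σ := hhan σ (hTne hσ.1.le)
  have hinvdiff : ContDiffAt ℂ k (fun s : ℂ ↦ (s - 1)⁻¹) σ :=
    ContDiffAt.inv (contDiffAt_id.sub contDiffAt_const) (sub_ne_zero.mpr hne)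
  rw [heq.iteratedDeriv_eq k, iteratedDeriv_add hanσ.contDiffAt hinvdiff, hinv, mul_add,
    ← mul_assoc, ← pow_add, Even.neg_one_pow ⟨k, rfl⟩, one_mul, add_sub_cancel_right, norm_mul,
    norm_pow, norm_neg, norm_one, one_pow, one_mul]
  exact hC σ ⟨hσ.1.le, hσ.2⟩

lemma hasSum_mul_log_pow_mul_rpow {g : ℕ → ℝ} (hg : abscissaOfAbsConv ↗g ≤ 1) (k : ℕ) {σ : ℝ}
    (hσ : 1 < σ) : HasSum (fun n : ℕ ↦ ((g n * Real.log n ^ k * (n : ℝ) ^ (-σ) : ℝ) : ℂ))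
      ((-1) ^ k * iteratedDeriv k (L ↗g) σ) := by
  have habs : abscissaOfAbsConv ↗g < (σ : ℂ).re := hg.trans_lt (by exact_mod_cast hσ)
  have hterm (n : ℕ) : term (logMul^[k] ↗g) σ n =
      ((g n * Real.log n ^ k * (n : ℝ) ^ (-σ) : ℝ) : ℂ) := by
    rcases n.eq_zero_or_pos with rfl | hn
    · simp [Real.zero_rpow (show -σ ≠ 0 by linarith)]
    · rw [term_of_ne_zero hn.ne', logMul_iterate_apply, div_eq_mul_inv, ← Complex.cpow_neg,
        Complex.ofReal_mul, Complex.ofReal_cpow (by positivity)]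
      push_cast
      ring
  have hsum : LSeriesSummable (logMul^[k] ↗g) σ := by
    refine LSeriesSummable_of_abscissaOfAbsConv_lt_re ?_
    rwa [absicssaOfAbsConv_logPowMul]
  rw [LSeries_iteratedDeriv k habs, ← mul_assoc, ← pow_add, Even.neg_one_pow ⟨k, rfl⟩, one_mul]
  exact (funext hterm : term (logMul^[k] ↗g) σ = _) ▸ hsum.hasSum

lemma summable_mul_log_pow_mul_rpow {g : ℕ → ℝ} (hg : abscissaOfAbsConv ↗g ≤ 1) (k : ℕ) {σ : ℝ}
    (hσ : 1 < σ) : Summable (fun n : ℕ ↦ g n * Real.log n ^ k * (n : ℝ) ^ (-σ)) :=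
  Complex.summable_ofReal.mp (hasSum_mul_log_pow_mul_rpow hg k hσ).summable

lemma ofReal_tsum_mul_log_pow_mul_rpow {g : ℕ → ℝ} (hg : abscissaOfAbsConv ↗g ≤ 1) (k : ℕ)
    {σ : ℝ} (hσ : 1 < σ) :
    ((∑' n : ℕ, g n * Real.log n ^ k * (n : ℝ) ^ (-σ) : ℝ) : ℂ) =
      (-1) ^ k * iteratedDeriv k (L ↗g) σ := by
  rw [Complex.ofReal_tsum, (hasSum_mul_log_pow_mul_rpow hg k hσ).tsum_eq]

lemma one_mod_one_mul_vonMangoldt : (↗(1 : DirichletCharacter ℂ 1) * ↗Λ) = ↗Λ := by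
  ext n
  rw [Pi.mul_apply, MulChar.one_apply (isUnit_of_subsingleton _), one_mul]

lemma abscissaOfAbsConv_vonMangoldt_le : abscissaOfAbsConv ↗Λ ≤ 1 :=
  one_mod_one_mul_vonMangoldt ▸ abscissaOfAbsConv_twist_vonMangoldt_le (1 : DirichletCharacter ℂ 1)

lemma exists_tsum_vonMangoldt_le (k : ℕ) : ∃ C : ℝ, 0 < C ∧ ∀ σ ∈ Set.Ioc (1 : ℝ) 2,
    ∑' n : ℕ, Λ n * Real.log n ^ k * (n : ℝ) ^ (-σ) ≤ C / (σ - 1) ^ (k + 1) := by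
  obtain ⟨C, hC, h⟩ := exists_norm_iteratedDeriv_one_vonMangoldt_sub_le 1 k
  refine ⟨k.factorial + C, by positivity, fun σ hσ ↦ ?_⟩
  have hσ' : 0 < σ - 1 := by linarith [hσ.1]
  have := h σ hσ
  rw [one_mod_one_mul_vonMangoldt,
    ← ofReal_tsum_mul_log_pow_mul_rpow abscissaOfAbsConv_vonMangoldt_le k hσ.1,
    ← Complex.ofReal_sub, Complex.norm_real] at this
  have h1 : C ≤ C / (σ - 1) ^ (k + 1) :=
    le_div_self hC.le (by positivity) (pow_le_one₀ hσ'.le (by linarith [hσ.2]))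
  rw [add_div]
  linarith [le_of_abs_le this]

lemma tsum_residueClass_eq {q : ℕ} [NeZero q] {a : ZMod q} (ha : IsUnit a) (k : ℕ) {σ : ℝ}
    (hσ : 1 < σ) :
    ((q.totient * ∑' n : ℕ, residueClass a n * Real.log n ^ k * (n : ℝ) ^ (-σ) : ℝ) : ℂ) =
      ∑ χ : DirichletCharacter ℂ q, χ a⁻¹ * ((-1) ^ k * iteratedDeriv k (L (↗χ * ↗Λ)) σ) := by
  rw [Complex.ofReal_mul,
    ofReal_tsum_mul_log_pow_mul_rpow (abscissaOfAbsConv_residueClass_le_one a) k hσ]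
  have hcd (χ : DirichletCharacter ℂ q) : ContDiffAt ℂ k (L (↗χ * ↗Λ)) σ :=
    contDiffAt_LSeries ((abscissaOfAbsConv_twist_vonMangoldt_le χ).trans_lt
      (by exact_mod_cast hσ)) _
  have heq : (fun s ↦ (q.totient : ℂ) * L ↗(residueClass a) s) =ᶠ[nhds (σ : ℂ)]
      fun s ↦ ∑ χ : DirichletCharacter ℂ q, χ a⁻¹ * L (↗χ * ↗Λ) s := by
    have hopen : {s : ℂ | 1 < s.re} ∈ nhds (σ : ℂ) :=
      (isOpen_lt continuous_const Complex.continuous_re).mem_nhds (by simpa using hσ)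
    filter_upwards [hopen] with s hs
    have hφ : (q.totient : ℂ) ≠ 0 := mod_cast (Nat.totient_pos.mpr q.pos_of_neZero).ne'
    rw [LSeries_residueClass_eq ha hs, ← mul_assoc, mul_neg, mul_inv_cancel₀ hφ, neg_one_mul,
      ← Finset.sum_neg_distrib]
    refine Finset.sum_congr rfl fun χ _ ↦ ?_
    rw [LSeries_twist_vonMangoldt_eq χ hs, deriv_LFunction_eq_deriv_LSeries _ hs,
      LFunction_eq_LSeries _ hs]
    ring
  have hder := heq.iteratedDeriv_eq k
  rw [iteratedDeriv_const_mul_field, iteratedDeriv_fun_sum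
    (fun χ _ ↦ contDiffAt_const.mul (hcd χ))] at hder
  rw [mul_left_comm, Complex.ofReal_natCast, hder, Finset.mul_sum]
  refine Finset.sum_congr rfl fun χ _ ↦ ?_
  rw [iteratedDeriv_const_mul_field]
  ring

lemma exists_le_tsum_residueClass {q : ℕ} [NeZero q] (hq : Odd q) (k : ℕ) :
    ∃ (C : ℝ) (e : ℕ), 0 < C ∧ ∀ K : ℕ, K ≠ 0 → ∀ a : ZMod (q ^ K), IsUnit a →
      ∀ σ ∈ Set.Ioc (1 : ℝ) 2, 1 / (↑(q ^ K) * (σ - 1) ^ (k + 1)) - C * (1 + Real.log ↑(q ^ K)) ^ e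
        ≤ ∑' n : ℕ, residueClass a n * Real.log n ^ k * (n : ℝ) ^ (-σ) := by
  obtain ⟨C, e, hC, h⟩ := exists_norm_iteratedDeriv_twist_vonMangoldt_le hq (k + 1)
  obtain ⟨C₁, hC₁, h₁⟩ := exists_norm_iteratedDeriv_one_vonMangoldt_sub_le q k
  refine ⟨C + C₁, e, by positivity, fun K hK a ha σ hσ ↦ ?_⟩
  set ℓ : ℝ := 1 + Real.log ↑(q ^ K) with hℓ
  have hℓ1 : 1 ≤ ℓ := by have := Real.log_natCast_nonneg (q ^ K); linarith
  have hσ' : 0 < σ - 1 := by linarith [hσ.1]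
  set R : ℝ := ∑' n : ℕ, residueClass a n * Real.log n ^ k * (n : ℝ) ^ (-σ) with hR
  have hφ : 1 ≤ ((q ^ K).totient : ℝ) := mod_cast Nat.totient_pos.mpr (q ^ K).pos_of_neZero
  have hone : (↗(1 : DirichletCharacter ℂ (q ^ K)) * ↗Λ) =
      (↗(1 : DirichletCharacter ℂ q) * ↗Λ) := by
    ext n
    rw [Pi.mul_apply, Pi.mul_apply, one_pow_natCast hK]
  have ha' : IsUnit a⁻¹ := isUnit_of_dvd_one ⟨a, (ZMod.inv_mul_of_unit a ha).symm⟩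
  have hnorm : ‖(((q ^ K).totient * R - k.factorial / (σ - 1) ^ (k + 1) : ℝ) : ℂ)‖ ≤
      C₁ + (q ^ K).totient * (C * ℓ ^ e) := by
    rw [Complex.ofReal_sub, tsum_residueClass_eq ha k hσ.1, Fintype.sum_eq_add_sum_compl 1,
      MulChar.one_apply ha', one_mul, hone, add_sub_right_comm]
    refine (norm_add_le _ _).trans (add_le_add (h₁ σ hσ) ?_)
    refine (norm_sum_le_of_le (n := fun _ ↦ C * ℓ ^ e) _ fun χ hχ ↦ ?_).trans ?_
    · have hχ1 : χ ≠ 1 := by simpa using hχ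
      rw [norm_mul, norm_mul, norm_pow, norm_neg, norm_one, one_pow, one_mul]
      exact (mul_le_of_le_one_left (norm_nonneg _) (χ.norm_le_one _)).trans
        (h k (Nat.lt_succ_self k) K hK χ hχ1 σ hσ)
    · rw [Finset.sum_const, nsmul_eq_mul]
      gcongr
      rw [← DirichletCharacter.card_eq_totient_of_hasEnoughRootsOfUnity ℂ (q ^ K),
        Nat.card_eq_fintype_card]
      exact Finset.card_le_univ _
  rw [Complex.norm_real, Real.norm_eq_abs] at hnorm
  have hlow := neg_le_of_abs_le hnorm
  have hfac : (1 : ℝ) ≤ k.factorial := mod_cast k.factorial_pos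
  have hmain : 1 / (σ - 1) ^ (k + 1) ≤ k.factorial / (σ - 1) ^ (k + 1) := by gcongr
  have hℓe : 1 ≤ ℓ ^ e := one_le_pow₀ hℓ1
  have hC₁' : C₁ ≤ (q ^ K).totient * (C₁ * ℓ ^ e) := by
    have : C₁ ≤ C₁ * ℓ ^ e := le_mul_of_one_le_right hC₁.le hℓe
    exact this.trans (le_mul_of_one_le_left (by positivity) hφ)
  have hR' : 1 / (σ - 1) ^ (k + 1) ≤ (q ^ K).totient * (R + (C + C₁) * ℓ ^ e) := by linarith
  have hpos : 0 ≤ R + (C + C₁) * ℓ ^ e := by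
    by_contra! hneg
    have : (q ^ K).totient * (R + (C + C₁) * ℓ ^ e) ≤ 0 :=
      mul_nonpos_of_nonneg_of_nonpos (by linarith) hneg.le
    have : 0 < 1 / (σ - 1) ^ (k + 1) := by positivity
    linarith
  have hQ0 : (0 : ℝ) < ↑(q ^ K) := mod_cast (q ^ K).pos_of_neZero
  have hfin : 1 / (σ - 1) ^ (k + 1) ≤ ↑(q ^ K) * (R + (C + C₁) * ℓ ^ e) :=
    hR'.trans (mul_le_mul_of_nonneg_right (mod_cast Nat.totient_le (q ^ K)) hpos)
  rw [sub_le_iff_le_add, mul_comm ((q ^ K : ℕ) : ℝ), ← div_div, div_le_iff₀ hQ0]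
  linarith

/-- A prime power which is not a prime is the product of a square and a cube. -/
lemma exists_sq_mul_cube_eq_of_isPrimePow {n : ℕ} (hn : IsPrimePow n) (hp : ¬ n.Prime) :
    ∃ ab : ℕ × ℕ, ab.1 ^ 2 * ab.2 ^ 3 = n := by
  obtain ⟨p, k, hpp, hk, rfl⟩ := (isPrimePow_nat_iff n).mp hn
  rcases k.even_or_odd with ⟨j, rfl⟩ | ⟨j, rfl⟩
  · exact ⟨(p ^ j, 1), by ring⟩
  · rcases j with _ | j
    · simp [hpp] at hp
    · exact ⟨(p ^ j, p), by ring⟩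

lemma summable_rpow_sq_mul_cube : Summable fun n : {n : ℕ | ∃ ab : ℕ × ℕ, ab.1 ^ 2 * ab.2 ^ 3 = n} ↦
    ((n : ℕ) : ℝ) ^ (-(3 / 4) : ℝ) := by
  choose φ hφ using fun n : {n : ℕ | ∃ ab : ℕ × ℕ, ab.1 ^ 2 * ab.2 ^ 3 = n} ↦ n.2
  have hpair : Summable fun ab : ℕ × ℕ ↦
      (ab.1 : ℝ) ^ (-(3 / 2) : ℝ) * (ab.2 : ℝ) ^ (-(9 / 4) : ℝ) :=
    (Real.summable_nat_rpow.mpr (by norm_num)).mul_of_nonneg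
      (Real.summable_nat_rpow.mpr (by norm_num)) (fun _ ↦ by positivity) (fun _ ↦ by positivity)
  have hinj : Function.Injective φ := fun n m h ↦ Subtype.ext <| by
    rw [← hφ n, ← hφ m, h]
  refine (hpair.comp_injective hinj).congr fun n ↦ ?_
  conv_rhs => rw [← hφ n]
  rw [Function.comp_apply, Nat.cast_mul, Nat.cast_pow, Nat.cast_pow,
    Real.mul_rpow (by positivity) (by positivity), ← Real.rpow_natCast, ← Real.rpow_natCast,
    ← Real.rpow_mul (by positivity), ← Real.rpow_mul (by positivity)]
  norm_num

lemma summable_vonMangoldt_mul_log_pow_nonprime (k : ℕ) :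
    Summable fun n : ℕ ↦ if n.Prime then 0 else Λ n * Real.log n ^ k / n := by
  have hind := (summable_subtype_iff_indicator (f := fun n : ℕ ↦ (n : ℝ) ^ (-(3 / 4) : ℝ))).mp
    summable_rpow_sq_mul_cube
  refine (hind.mul_left ((4 * (k + 1) : ℝ) ^ (k + 1))).of_nonneg_of_le (fun n ↦ ?_) fun n ↦ ?_
  · split_ifs
    · rfl
    · have := ArithmeticFunction.vonMangoldt_nonneg (n := n)
      positivity [Real.log_natCast_nonneg n]
  · by_cases hn : ¬ n.Prime ∧ IsPrimePow n
    · have hmem : n ∈ {n : ℕ | ∃ ab : ℕ × ℕ, ab.1 ^ 2 * ab.2 ^ 3 = n} :=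
        exists_sq_mul_cube_eq_of_isPrimePow hn.2 hn.1
      have hn0 : (0 : ℝ) < n := mod_cast hn.2.pos
      rw [if_neg hn.1, Set.indicator_of_mem hmem, div_le_iff₀ hn0, mul_assoc,
        ← Real.rpow_add_one hn0.ne']
      have hlog := Real.log_natCast_nonneg n
      have h1 : Real.log n ≤ 4 * (k + 1) * (n : ℝ) ^ (1 / (4 * (k + 1)) : ℝ) := by
        have := Real.log_le_rpow_div hn0.le (show (0 : ℝ) < 1 / (4 * (k + 1)) by positivity)
        rwa [div_div_eq_mul_div, div_one, mul_comm] at this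
      calc Λ n * Real.log n ^ k ≤ Real.log n * Real.log n ^ k := by
            gcongr
            exact ArithmeticFunction.vonMangoldt_le_log
        _ = Real.log n ^ (k + 1) := by ring
        _ ≤ (4 * (k + 1) * (n : ℝ) ^ (1 / (4 * (k + 1)) : ℝ)) ^ (k + 1) := by gcongr
        _ = _ := by
          rw [mul_pow, ← Real.rpow_natCast (_ ^ (_ : ℝ)), ← Real.rpow_mul hn0.le]
          congr 2
          push_cast
          field_simp
          norm_num
    · have : (if n.Prime then 0 else Λ n * Real.log n ^ k / n) = 0 := by
        split_ifs with h
        · rfl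
        · rw [ArithmeticFunction.vonMangoldt_eq_zero_iff.mpr fun h' ↦ hn ⟨h, h'⟩, zero_mul,
            zero_div]
      rw [this]
      exact mul_nonneg (by positivity) (Set.indicator_nonneg (fun _ _ ↦ by positivity) _)

/-- If every prime in the residue class `a` satisfies `X ^ 2 < log p`, then the weighted sum of the
von Mangoldt function over this class at `σ = 1 + 1 / X` is bounded. -/
lemma exists_tsum_residueClass_le (k : ℕ) :
    ∃ B : ℝ, ∀ (N : ℕ) (a : ZMod N) (X : ℝ), 1 ≤ X →
      (∀ p : ℕ, p.Prime → (p : ZMod N) = a → X ^ 2 < Real.log p) →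
        ∑' n : ℕ, residueClass a n * Real.log n ^ k * (n : ℝ) ^ (-(1 + 1 / X)) ≤ B := by
  obtain ⟨C, hC, h⟩ := exists_tsum_vonMangoldt_le (2 * k + 1)
  refine ⟨(∑' n : ℕ, if n.Prime then 0 else Λ n * Real.log n ^ k / n) + C, fun N a X hX hp ↦ ?_⟩
  have hX0 : 0 < X := by linarith
  have hσ : 1 < 1 + 1 / X := by simp [hX0]
  have hσ2 : 1 + 1 / X ≤ 2 := by
    have := (div_le_one hX0).mpr hX
    linarith
  have hs := (summable_mul_log_pow_mul_rpow abscissaOfAbsConv_vonMangoldt_le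
    (2 * k + 1) hσ).mul_left ((X ^ (2 * k + 2))⁻¹)
  have hs' := summable_vonMangoldt_mul_log_pow_nonprime k
  calc _ ≤ ∑' n : ℕ, ((if n.Prime then 0 else Λ n * Real.log n ^ k / n) +
        (X ^ (2 * k + 2))⁻¹ * (Λ n * Real.log n ^ (2 * k + 1) * (n : ℝ) ^ (-(1 + 1 / X)))) := by
        refine (summable_mul_log_pow_mul_rpow (abscissaOfAbsConv_residueClass_le_one a) k
          hσ).tsum_le_tsum (fun n ↦ ?_) (hs'.add hs)
        have hΛ := ArithmeticFunction.vonMangoldt_nonneg (n := n)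
        have hlog := Real.log_natCast_nonneg n
        split_ifs with hn
        · rw [zero_add]
          by_cases hna : (n : ZMod N) = a
          · have hY := hp n hn hna
            calc residueClass a n * Real.log n ^ k * (n : ℝ) ^ (-(1 + 1 / X))
                ≤ Λ n * Real.log n ^ k * (n : ℝ) ^ (-(1 + 1 / X)) := by
                  gcongr
                  exact residueClass_le a n
              _ = (X ^ (2 * k + 2))⁻¹ * (Λ n * ((X ^ 2) ^ (k + 1) * Real.log n ^ k) *
                    (n : ℝ) ^ (-(1 + 1 / X))) := by
                  field_simp
                  ring
              _ ≤ (X ^ (2 * k + 2))⁻¹ * (Λ n * (Real.log n ^ (k + 1) * Real.log n ^ k) *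
                    (n : ℝ) ^ (-(1 + 1 / X))) := by gcongr
              _ = _ := by ring
          · have : residueClass a n = 0 :=
              Set.indicator_of_notMem (s := {n : ℕ | (n : ZMod N) = a}) hna _
            rw [this, zero_mul, zero_mul]
            positivity
        · refine le_add_of_le_of_nonneg ?_ (by positivity)
          rcases n.eq_zero_or_pos with rfl | hn0
          · simp
          · have hn1 : (1 : ℝ) ≤ n := mod_cast hn0
            rw [div_eq_mul_inv _ (n : ℝ), ← Real.rpow_neg_one (n : ℝ)]
            exact mul_le_mul (mul_le_mul_of_nonneg_right (residueClass_le a n) (by positivity))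
              (Real.rpow_le_rpow_of_exponent_le hn1 (by linarith)) (by positivity) (by positivity)
    _ ≤ _ := by
        rw [hs'.tsum_add hs, tsum_mul_left]
        gcongr
        have := h (1 + 1 / X) ⟨hσ, hσ2⟩
        rw [inv_mul_le_iff₀ (by positivity)]
        refine this.trans_eq ?_
        rw [add_sub_cancel_left, one_div, inv_pow, div_inv_eq_mul, mul_comm]

lemma eventually_add_mul_log_pow_lt (B : ℝ) {C : ℝ} (hC : 0 < C) (e : ℕ) :
    ∀ᶠ x : ℝ in Filter.atTop, B + C * (1 + Real.log x) ^ e < x := by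
  have hE := Real.exp_pos 1
  have ht : Filter.Tendsto (fun x : ℝ ↦ Real.exp 1 * x) Filter.atTop Filter.atTop :=
    Filter.tendsto_id.const_mul_atTop hE
  have ho := ((Real.isLittleO_pow_log_id_atTop (n := e)).comp_tendsto ht).bound
    (show 0 < 1 / (2 * C * Real.exp 1) by positivity)
  filter_upwards [ho, Filter.eventually_gt_atTop (2 * B), Filter.eventually_gt_atTop 0]
    with x hx hB hx0
  simp only [Function.comp_apply, id_eq, Real.log_mul hE.ne' hx0.ne', Real.log_exp] at hx
  have h1 := (le_abs_self _).trans hx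
  rw [Real.norm_of_nonneg (by positivity)] at h1
  have h2 : C * (1 + Real.log x) ^ e ≤ x / 2 := by
    calc C * (1 + Real.log x) ^ e ≤ C * (1 / (2 * C * Real.exp 1) * (Real.exp 1 * x)) := by gcongr
      _ = x / 2 := by field_simp
  linarith

/-- Weak form of Linnik's theorem for moduli `q ^ K` with `q` odd and fixed: every reduced residue
class contains a prime whose logarithm is at most an arbitrarily small power of the modulus. -/
theorem eventually_exists_prime_log_le {q : ℕ} (hq : Odd q) (hq1 : 1 < q) (k : ℕ) :
    ∀ᶠ K : ℕ in Filter.atTop, ∀ a : ZMod (q ^ K), IsUnit a →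
      ∃ p : ℕ, p.Prime ∧ (p : ZMod (q ^ K)) = a ∧
        Real.log p ≤ (((q ^ K : ℕ) : ℝ) ^ (2 / (k + 1) : ℝ)) ^ 2 := by
  have : NeZero q := ⟨by omega⟩
  obtain ⟨C, e, hC, h⟩ := exists_le_tsum_residueClass hq k
  obtain ⟨B, hB⟩ := exists_tsum_residueClass_le k
  have ht : Filter.Tendsto (fun K : ℕ ↦ ((q ^ K : ℕ) : ℝ)) Filter.atTop Filter.atTop :=
    tendsto_natCast_atTop_atTop.comp (tendsto_pow_atTop_atTop_of_one_lt hq1)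
  filter_upwards [ht.eventually (eventually_add_mul_log_pow_lt B hC e),
    Filter.eventually_ne_atTop 0] with K hK hK0 a ha
  by_contra! hcon
  have hQ1 : (1 : ℝ) ≤ ((q ^ K : ℕ) : ℝ) := mod_cast Nat.one_le_pow _ _ (by omega)
  have hlo := h K hK0 a ha
  generalize ((q ^ K : ℕ) : ℝ) = Q at hK hcon hQ1 hlo
  set X : ℝ := Q ^ (2 / (k + 1) : ℝ) with hX
  have hX1 : 1 ≤ X := Real.one_le_rpow hQ1 (by positivity)
  have hX0 : 0 < X := by linarith
  have hXk : X ^ (k + 1) = Q ^ 2 := by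
    rw [hX, ← Real.rpow_natCast, ← Real.rpow_mul (by linarith), ← Real.rpow_natCast]
    congr 1
    push_cast
    field_simp
  have hup := hB _ a X hX1 hcon
  specialize hlo (1 + 1 / X) ⟨by simp [hX0], by
    have := (div_le_one hX0).mpr hX1
    linarith⟩
  have hQ : 1 / (Q * (1 + 1 / X - 1) ^ (k + 1)) = Q := by
    rw [add_sub_cancel_left, div_pow, one_pow, hXk]
    field_simp
  rw [hQ] at hlo
  linarith

lemma eventually_exists_prime_sq_dvd (A : ℝ) (hA : 0 < A) :
    ∀ᶠ j : ℕ in Filter.atTop, ∃ p : ℕ, p.Prime ∧ (((3 ^ j : ℕ) : ℤ) ^ 2 ∣ (p : ℤ) + 2) ∧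
      (((5 ^ j : ℕ) : ℤ) ^ 2 ∣ (p : ℤ) - 2) ∧ Real.log p ^ A < ((3 ^ j : ℕ) : ℝ) := by
  set k : ℕ := ⌈24 * A⌉₊ with hk
  have hkA : 24 * A < k + 1 := (Nat.le_ceil _).trans_lt (lt_add_one _)
  have ht : Filter.Tendsto (fun j : ℕ ↦ 2 * j) Filter.atTop Filter.atTop :=
    Filter.tendsto_id.const_mul_atTop' two_pos
  filter_upwards [ht.eventually (eventually_exists_prime_log_le (q := 15) (by decide)
    (by norm_num) k), Filter.eventually_gt_atTop 0] with j hj hj0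
  have h35 : IsCoprime ((3 : ℤ) ^ (2 * j)) (5 ^ (2 * j)) := IsCoprime.pow (by norm_num)
  obtain ⟨u, v, huv⟩ := h35
  set z : ℤ := 2 * u * 3 ^ (2 * j) - 2 * v * 5 ^ (2 * j) with hz
  have h15 : ((15 ^ (2 * j) : ℕ) : ℤ) = 3 ^ (2 * j) * 5 ^ (2 * j) := by
    rw [← mul_pow]
    norm_num
  have hunit : IsUnit (z : ZMod (15 ^ (2 * j))) := by
    rw [ZMod.coe_int_isUnit_iff_isCoprime, h15]
    refine IsCoprime.mul_left ?_ ?_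
    · have h : IsCoprime ((3 : ℤ) ^ (2 * j)) (-2) := IsCoprime.pow_left (by norm_num)
      rw [show z = -2 + 3 ^ (2 * j) * (4 * u) by linear_combination hz - 2 * huv]
      exact h.add_mul_left_right _
    · have h : IsCoprime ((5 : ℤ) ^ (2 * j)) 2 := IsCoprime.pow_left (by norm_num)
      rw [show z = 2 + 5 ^ (2 * j) * (-4 * v) by linear_combination hz + 2 * huv]
      exact h.add_mul_left_right _
  obtain ⟨p, hp, hpz, hlog⟩ := hj z hunit
  have hdvd : (3 : ℤ) ^ (2 * j) * 5 ^ (2 * j) ∣ z - p := by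
    rw [← h15, ← ZMod.intCast_eq_intCast_iff_dvd_sub]
    exact_mod_cast hpz
  obtain ⟨w, hw⟩ := hdvd
  refine ⟨p, hp, ⟨4 * u - 5 ^ (2 * j) * w, ?_⟩, ⟨-4 * v - 3 ^ (2 * j) * w, ?_⟩, ?_⟩
  · push_cast
    rw [← pow_mul, mul_comm j 2]
    linear_combination hz - 2 * huv - hw
  · push_cast
    rw [← pow_mul, mul_comm j 2]
    linear_combination hz + 2 * huv - hw
  · have hQ : ((15 ^ (2 * j) : ℕ) : ℝ) ≤ (3 : ℝ) ^ (6 * j : ℝ) := by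
      have : (3 : ℝ) ^ (6 * j : ℝ) = 27 ^ (2 * j) := by
        rw [show (27 : ℝ) = 3 ^ 3 by norm_num, ← pow_mul, ← Real.rpow_natCast]
        push_cast
        ring_nf
      rw [this]
      push_cast
      gcongr
      norm_num
    calc Real.log p ^ A ≤ ((((3 : ℝ) ^ (6 * j : ℝ)) ^ (2 / (k + 1) : ℝ)) ^ 2) ^ A := by
          have := Real.log_natCast_nonneg p
          gcongr
          refine hlog.trans ?_
          gcongr
      _ = (3 : ℝ) ^ (24 * A / (k + 1) * j) := by
          rw [← Real.rpow_natCast, ← Real.rpow_mul (by positivity), ← Real.rpow_mul (by positivity),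
            ← Real.rpow_mul (by positivity)]
          congr 1
          push_cast
          ring
      _ < (3 : ℝ) ^ (1 * j : ℝ) := by
          have hj' : (0 : ℝ) < j := mod_cast hj0
          have : 24 * A / (k + 1) < 1 := (div_lt_one (by positivity)).mpr hkA
          exact Real.rpow_lt_rpow_of_exponent_lt (by norm_num) (by gcongr)
      _ = _ := by
          rw [one_mul, Real.rpow_natCast]
          push_cast
          rfl

/-- The weighted count
`S(x) = ∑_{3 ≤ p < x prime} log p · #{m < √(x+2) : m² ∣ p+2, m > (log p)^A}
· #{n < √(x-2) : n² ∣ p-2, n > (log p)^A}` tends to infinity as `x → ∞`. -/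
theorem weighted_sum_tendsto_atTop (A : ℝ) (hA : 0 < A) :
    Filter.Tendsto (fun x : ℝ =>
      ∑ p ∈ Finset.range ⌈x⌉₊,
        if p.Prime ∧ 3 ≤ p then
          Real.log p *
            (((Finset.range ⌈Real.sqrt (x + 2)⌉₊).filter (fun m : ℕ =>
                0 < m ∧ (m : ℝ) < Real.sqrt (x + 2) ∧ (m : ℤ) ^ 2 ∣ (p : ℤ) + 2 ∧
                  Real.log p ^ A < m)).card : ℝ) *
            (((Finset.range ⌈Real.sqrt (x - 2)⌉₊).filter (fun n : ℕ =>
                0 < n ∧ (n : ℝ) < Real.sqrt (x - 2) ∧ (n : ℤ) ^ 2 ∣ (p : ℤ) - 2 ∧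
                  Real.log p ^ A < n)).card : ℝ)
        else 0) Filter.atTop Filter.atTop := by
  rw [Filter.tendsto_atTop]
  intro b
  have ht : Filter.Tendsto (fun j : ℕ ↦ (9 : ℝ) ^ j) Filter.atTop Filter.atTop :=
    tendsto_pow_atTop_atTop_of_one_lt (by norm_num)
  obtain ⟨j, ⟨p, hp, h3, h5, hlog⟩, hj⟩ := ((eventually_exists_prime_sq_dvd A hA).and
    (ht.eventually_ge_atTop (Real.exp b + 5))).exists
  have h3le : ((3 ^ j : ℕ) : ℝ) ^ 2 ≤ p + 2 := mod_cast Int.le_of_dvd (by omega) h3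
  have hbig : Real.exp b + 3 ≤ p := by
    have : ((3 ^ j : ℕ) : ℝ) ^ 2 = 9 ^ j := by
      push_cast
      rw [← pow_mul, mul_comm, pow_mul]
      norm_num
    linarith
  have hp3 : 3 ≤ p := by
    have : (3 : ℝ) ≤ p := by linarith [Real.exp_pos b]
    exact_mod_cast this
  have h5le : ((5 ^ j : ℕ) : ℝ) ^ 2 + 2 ≤ p := by
    have := le_sub_iff_add_le.mp (Int.le_of_dvd (by omega) h5)
    exact_mod_cast this
  have hlog5 : Real.log p ^ A < ((5 ^ j : ℕ) : ℝ) := by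
    refine hlog.trans_le ?_
    push_cast
    gcongr
    norm_num
  filter_upwards [Filter.eventually_gt_atTop (p : ℝ)] with x hx
  have hsqrt3 : ((3 ^ j : ℕ) : ℝ) < Real.sqrt (x + 2) := Real.lt_sqrt_of_sq_lt (by linarith)
  have hsqrt5 : ((5 ^ j : ℕ) : ℝ) < Real.sqrt (x - 2) := Real.lt_sqrt_of_sq_lt (by linarith)
  refine le_trans ?_ (Finset.single_le_sum (fun n _ ↦ ?_)
    (Finset.mem_range.mpr (Nat.lt_ceil.mpr hx)))
  · rw [if_pos ⟨hp, hp3⟩, mul_assoc]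
    have hb : b ≤ Real.log p := (Real.le_log_iff_exp_le (by positivity [hp.pos])).mpr (by linarith)
    refine hb.trans (le_mul_of_one_le_right (Real.log_natCast_nonneg p) ?_)
    refine one_le_mul_of_one_le_of_one_le ?_ ?_ <;>
      rw [Nat.one_le_cast, Finset.one_le_card]
    · exact ⟨3 ^ j, Finset.mem_filter.mpr ⟨Finset.mem_range.mpr (Nat.lt_ceil.mpr hsqrt3),
        by positivity, hsqrt3, h3, hlog⟩⟩
    · exact ⟨5 ^ j, Finset.mem_filter.mpr ⟨Finset.mem_range.mpr (Nat.lt_ceil.mpr hsqrt5),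
        by positivity, hsqrt5, h5, hlog5⟩⟩
  · split_ifs
    · positivity [Real.log_natCast_nonneg n]
    · rfl
end

section
/- There exist infinitely many prime numbers p ≥ 5 such that p does not divide the class number of ℚ(√(−p(p+2))), p does not divide the class number of ℚ(√(−p(p−2))), and p does not divide the class number of ℚ(√(−(p+2)(p−2))). -/
/-- `p` does not divide the class number of `ℚ(√-N)`: for every number field `K` generated
over `ℚ` by an element `α` with `α² = -N`, `p` does not divide the class number of `K`. -/
def NotDvdClassNumberSqrtNeg (p N : ℕ) : Prop :=
  ∀ (K : Type) [Field K] [NumberField K] (α : K),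
    α ^ 2 = -(N : K) → Algebra.adjoin ℚ {α} = ⊤ → ¬ p ∣ NumberField.classNumber K

section LFunctionBounds

open Complex

/-- A bound for the Riemann zeta function to the right of its pole. -/
lemma tsum_one_div_rpow_le {s : ℝ} (hs : 1 < s) :
    ∑' n : ℕ, 1 / (n : ℝ) ^ s ≤ 1 + 1 / (s - 1) := by
  have h1 := ZetaAsymptotics.zeta_limit_aux1 hs
  have h2 : 0 ≤ ZetaAsymptotics.termTSum s :=
    tsum_nonneg fun n => ZetaAsymptotics.term_nonneg _ _
  have h3 : Summable fun n : ℕ => 1 / (n : ℝ) ^ s := Real.summable_one_div_nat_rpow.mpr hs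
  rw [h3.tsum_eq_zero_add]
  simp only [Nat.cast_zero, Nat.cast_add, Nat.cast_one]
  rw [Real.zero_rpow (by linarith)]
  have : 0 ≤ s * ZetaAsymptotics.termTSum s := mul_nonneg (by linarith) h2
  simp only [div_zero, zero_add]
  linarith

lemma norm_natCast_cpow_neg_sub_le {s : ℂ} (hs : 0 < s.re) {n : ℕ} (hn : 0 < n) (a : ℕ) :
    ‖((n + a : ℕ) : ℂ) ^ (-s) - (n : ℂ) ^ (-s)‖ ≤ ‖s‖ * (n : ℝ) ^ (-s.re - 1) * a := by
  have hs0 : -s ≠ 0 := neg_ne_zero.mpr fun h => by simp [h] at hs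
  have hn' : (0 : ℝ) < n := by exact_mod_cast hn
  have hder (x : ℝ) (hx : x ∈ Set.Ici (n : ℝ)) :
      HasDerivAt (fun y : ℝ => (y : ℂ) ^ (-s)) (-s * (x : ℂ) ^ (-s - 1)) x :=
    hasDerivAt_ofReal_cpow_const (hn'.trans_le hx).ne' hs0
  have := Convex.norm_image_sub_le_of_norm_deriv_le (𝕜 := ℝ)
    (f := fun y : ℝ => (y : ℂ) ^ (-s)) (s := Set.Ici (n : ℝ)) (x := n) (y := n + a)
    (C := ‖s‖ * (n : ℝ) ^ (-s.re - 1)) (fun x hx => (hder x hx).differentiableAt)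
    (fun x hx => ?_) (convex_Ici _) (by simp) (by simp)
  · simpa using this
  · rw [(hder x hx).deriv, norm_mul, norm_neg,
      norm_cpow_eq_rpow_re_of_pos (hn'.trans_le hx)]
    gcongr
    simp only [sub_re, neg_re, one_re]
    exact Real.rpow_le_rpow_of_nonpos hn' hx (by linarith)

/-- The part of the Dirichlet series of `χ` over the `m`-th period. -/
noncomputable def periodSum {q : ℕ} (χ : DirichletCharacter ℂ q) (m : ℕ) (s : ℂ) : ℂ :=
  ∑ a : Fin q, χ (a : ℕ) * ((m * q + a : ℕ) : ℂ) ^ (-s)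

lemma differentiableOn_periodSum {q : ℕ} (χ : DirichletCharacter ℂ q) (m : ℕ) :
    DifferentiableOn ℂ (periodSum χ m) {s | 0 < s.re} := by
  unfold periodSum
  refine DifferentiableOn.fun_sum fun a _ => DifferentiableOn.const_mul ?_ _
  intro s hs
  refine DifferentiableAt.differentiableWithinAt ?_
  refine DifferentiableAt.const_cpow (by fun_prop) (Or.inr ?_)
  refine neg_ne_zero.mpr fun h => ?_
  simp [h] at hs

section

variable {q : ℕ} [NeZero q] (χ : DirichletCharacter ℂ q)

lemma sum_fin_eq_zero (hχ : χ ≠ 1) : ∑ a : Fin q, χ ((a : ℕ) : ZMod q) = 0 := by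
  rw [← MulChar.sum_eq_zero_of_ne_one hχ]
  obtain ⟨k, rfl⟩ := Nat.exists_eq_succ_of_ne_zero (NeZero.ne q)
  refine Finset.sum_congr rfl fun a _ => ?_
  congr 1
  exact Fin.cast_val_eq_self a

lemma LSeries_eq_tsum_periodSum {s : ℂ} (hs : 1 < s.re) :
    LSeries (χ ·) s = ∑' m : ℕ, periodSum χ m s := by
  have hs0 : s ≠ 0 := fun h => by simp [h] at hs; linarith
  have hsum : LSeriesSummable (χ ·) s := ZMod.LSeriesSummable_of_one_lt_re _ hs
  have hterm (n : ℕ) : LSeries.term (χ ·) s n = χ n * (n : ℂ) ^ (-s) := by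
    rcases eq_or_ne n 0 with rfl | hn
    · simp [Complex.zero_cpow (neg_ne_zero.mpr hs0)]
    · rw [LSeries.term_of_ne_zero hn, cpow_neg, div_eq_mul_inv]
  unfold LSeriesSummable at hsum
  unfold LSeries
  rw [← (Nat.divModEquiv q).symm.tsum_eq]
  have h2 := ((Nat.divModEquiv q).symm.summable_iff).mpr hsum
  rw [Summable.tsum_prod (f := fun x => LSeries.term (χ ·) s ((Nat.divModEquiv q).symm x)) h2]
  refine tsum_congr fun m => ?_
  rw [tsum_fintype, periodSum]
  refine Finset.sum_congr rfl fun a _ => ?_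
  rw [hterm, Nat.divModEquiv_symm_apply]
  simp

variable {χ}

lemma norm_periodSum_le (hχ : χ ≠ 1) {s : ℂ} (hs : 0 < s.re) {m : ℕ} (hm : 0 < m) :
    ‖periodSum χ m s‖ ≤ ‖s‖ * (q : ℝ) ^ (1 - s.re) * (m : ℝ) ^ (-s.re - 1) := by
  have hq : (0 : ℝ) < q := by exact_mod_cast Nat.pos_of_ne_zero (NeZero.ne q)
  have h1 : periodSum χ m s = ∑ a : Fin q, χ (a : ℕ) *
      (((m * q + a : ℕ) : ℂ) ^ (-s) - ((m * q : ℕ) : ℂ) ^ (-s)) := by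
    simp only [mul_sub, Finset.sum_sub_distrib, ← Finset.sum_mul, sum_fin_eq_zero χ hχ]
    simp [periodSum]
  rw [h1]
  have h2 (a : Fin q) : ‖χ (a : ℕ) * (((m * q + a : ℕ) : ℂ) ^ (-s) - ((m * q : ℕ) : ℂ) ^ (-s))‖
      ≤ ‖s‖ * ((m * q : ℕ) : ℝ) ^ (-s.re - 1) * q := by
    rw [norm_mul]
    refine (mul_le_of_le_one_left (norm_nonneg _) (χ.norm_le_one _)).trans ?_
    refine (norm_natCast_cpow_neg_sub_le hs (by have := NeZero.pos q; positivity) a).trans ?_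
    gcongr
    exact a.2.le
  refine (norm_sum_le_of_le _ fun a _ => h2 a).trans_eq ?_
  simp only [Finset.sum_const, Finset.card_univ, Fintype.card_fin, nsmul_eq_mul]
  push_cast
  rw [Real.mul_rpow (by positivity) hq.le, show 1 - s.re = (-s.re - 1) + 2 by ring,
    Real.rpow_add hq]
  norm_num
  ring

lemma re_bounds_of_norm_sub_one_le {s : ℂ} {r : ℝ} (hs : ‖s - 1‖ ≤ r) :
    1 - r ≤ s.re ∧ s.re ≤ 1 + r ∧ ‖s‖ ≤ 1 + r := by
  have h1 := (abs_le.mp ((abs_re_le_norm (s - 1)).trans hs))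
  have h2 : ‖s‖ ≤ ‖s - 1‖ + 1 := by simpa using norm_add_le (s - 1) 1
  simp only [sub_re, one_re] at h1
  exact ⟨by linarith, by linarith, by linarith⟩

lemma norm_periodSum_zero_le {s : ℂ} (hs : s ≠ 0) {A : ℝ} (hA : (q : ℝ) ^ |1 - s.re| ≤ A) :
    ‖periodSum χ 0 s‖ ≤ A * (1 + Real.log q) := by
  have hA0 : 0 ≤ A := (Real.rpow_nonneg (Nat.cast_nonneg _) _).trans hA
  have h2 (a : Fin q) : ‖χ (a : ℕ) * ((0 * q + a : ℕ) : ℂ) ^ (-s)‖ ≤ A * ((a : ℕ) : ℝ)⁻¹ := by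
    rw [norm_mul]
    refine (mul_le_of_le_one_left (norm_nonneg _) (χ.norm_le_one _)).trans ?_
    rcases Nat.eq_zero_or_pos (a : ℕ) with h | h
    · simp [h, Complex.zero_cpow (neg_ne_zero.mpr hs)]
    · have ha : (1 : ℝ) ≤ (a : ℕ) := by exact_mod_cast h
      rw [zero_mul, zero_add, norm_natCast_cpow_of_pos h, neg_re,
        show -s.re = (1 - s.re) + (-1) by ring, Real.rpow_add (by linarith), Real.rpow_neg_one]
      gcongr
      refine le_trans ?_ hA
      refine (Real.rpow_le_rpow_of_exponent_le ha (le_abs_self _)).trans ?_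
      exact Real.rpow_le_rpow (by linarith) (by exact_mod_cast a.2.le) (abs_nonneg _)
  refine (norm_sum_le_of_le _ fun a _ => h2 a).trans ?_
  rw [← Finset.mul_sum]
  gcongr
  refine le_trans ?_ (harmonic_le_one_add_log q)
  rw [Fin.sum_univ_eq_sum_range (fun i : ℕ => (i : ℝ)⁻¹) q, harmonic]
  obtain ⟨k, rfl⟩ := Nat.exists_eq_succ_of_ne_zero (NeZero.ne q)
  rw [Finset.sum_range_succ']
  push_cast
  simp only [inv_zero, add_zero]
  rw [Finset.sum_range_succ]
  have : (0 : ℝ) ≤ ((k : ℝ) + 1)⁻¹ := by positivity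
  linarith

lemma LFunction_eq_tsum_periodSum (hχ : χ ≠ 1) {s : ℂ} (hs : ‖s - 1‖ < 1 / 2) :
    DirichletCharacter.LFunction χ s = ∑' m : ℕ, periodSum χ m s := by
  set U : Set ℂ := Metric.ball 1 (1 / 2) with hU
  have hmem {w : ℂ} (hw : w ∈ U) := re_bounds_of_norm_sub_one_le (s := w) (r := 1 / 2)
    (by rw [hU, mem_ball_iff_norm] at hw; exact hw.le)
  have hq : (1 : ℝ) ≤ q := by exact_mod_cast Nat.pos_of_ne_zero (NeZero.ne q)
  have hdiff : DifferentiableOn ℂ (fun w => ∑' m : ℕ, periodSum χ m w) U := by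
    refine Complex.differentiableOn_tsum_of_summable_norm
      (u := fun m : ℕ => if m = 0 then (q : ℝ) * (1 + Real.log q) else
        (3 / 2) * q * (m : ℝ) ^ (-(3 / 2) : ℝ)) ?_ (fun m => ?_) Metric.isOpen_ball ?_
    · have h3 : Summable fun m : ℕ => (3 / 2) * q * (m : ℝ) ^ (-(3 / 2) : ℝ) :=
        (Real.summable_nat_rpow.mpr (by norm_num)).mul_left _
      refine h3.congr_cofinite ?_
      rw [Nat.cofinite_eq_atTop]
      filter_upwards [Filter.eventually_ne_atTop 0] with m hm
      simp [hm]
    · exact (differentiableOn_periodSum χ m).mono fun w hw => by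
        have := hmem hw
        simp only [Set.mem_ofPred_eq]; linarith
    · intro m w hw
      obtain ⟨h1, h2, h3⟩ := hmem hw
      split_ifs with hm
      · subst hm
        refine norm_periodSum_zero_le (fun h => by simp [h] at h1; linarith) ?_
        refine (Real.rpow_le_rpow_of_exponent_le hq (?_ : _ ≤ (1 : ℝ))).trans (by simp)
        rw [abs_le]; constructor <;> linarith
      · have hm1 : (1 : ℝ) ≤ m := by exact_mod_cast Nat.pos_of_ne_zero hm
        refine (norm_periodSum_le hχ (by linarith) (Nat.pos_of_ne_zero hm)).trans ?_
        gcongr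
        · linarith
        · refine (Real.rpow_le_rpow_of_exponent_le hq (?_ : _ ≤ (1 : ℝ))).trans (by simp)
          linarith
        · linarith
  have hana := hdiff.analyticOnNhd Metric.isOpen_ball
  have hana2 : AnalyticOnNhd ℂ (DirichletCharacter.LFunction χ) U :=
    (DirichletCharacter.differentiable_LFunction hχ).differentiableOn.analyticOnNhd
      Metric.isOpen_ball
  have hz0 : (1 + 1 / 4 : ℂ) ∈ U := by
    rw [hU, mem_ball_iff_norm]; norm_num
  refine hana2.eqOn_of_preconnected_of_eventuallyEq hana
    (convex_ball _ _).isPreconnected hz0 ?_ (by rw [hU, mem_ball_iff_norm]; exact hs)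
  have h : {z : ℂ | 1 < z.re} ∈ nhds (1 + 1 / 4 : ℂ) :=
    (isOpen_lt continuous_const continuous_re).mem_nhds (by norm_num)
  filter_upwards [h] with z hz
  rw [DirichletCharacter.LFunction_eq_LSeries χ hz, LSeries_eq_tsum_periodSum χ hz]

end

/-- Near `s = 1` nontrivial Dirichlet `L`-functions are bounded by a multiple of `log q`. -/
lemma exists_norm_LFunction_le : ∃ C : ℝ, 1 ≤ C ∧ ∀ (q : ℕ) [NeZero q], 3 ≤ q →
    ∀ χ : DirichletCharacter ℂ q, χ ≠ 1 → ∀ s : ℂ, ‖s - 1‖ ≤ 1 / (3 * Real.log q) →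
      ‖DirichletCharacter.LFunction χ s‖ ≤ C * Real.log q := by
  have hsum : Summable fun m : ℕ => (m : ℝ) ^ (-(3 / 2) : ℝ) :=
    Real.summable_nat_rpow.mpr (by norm_num)
  refine ⟨6 + 6 * ∑' m : ℕ, (m : ℝ) ^ (-(3 / 2) : ℝ), ?_, ?_⟩
  · have : 0 ≤ ∑' m : ℕ, (m : ℝ) ^ (-(3 / 2) : ℝ) := tsum_nonneg fun m => by positivity
    linarith
  intro q _ hq3 χ hχ s hs
  have hq : (3 : ℝ) ≤ q := by exact_mod_cast hq3
  have hl : 1 ≤ Real.log q := by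
    rw [Real.le_log_iff_exp_le (by linarith)]
    linarith [Real.exp_one_lt_d9]
  have hr : 1 / (3 * Real.log q) ≤ 1 / 3 := by
    apply one_div_le_one_div_of_le <;> linarith
  obtain ⟨h1, h2, h3⟩ := re_bounds_of_norm_sub_one_le hs
  have hs0 : s ≠ 0 := fun h => by
    rw [h, zero_re] at h1; linarith
  have hpow : (q : ℝ) ^ |1 - s.re| ≤ 3 := by
    have h4 : |1 - s.re| ≤ 1 / (3 * Real.log q) := by rw [abs_le]; constructor <;> linarith
    refine (Real.rpow_le_rpow_of_exponent_le (by linarith) h4).trans ?_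
    rw [Real.rpow_def_of_pos (by linarith)]
    have : Real.log q * (1 / (3 * Real.log q)) = 1 / 3 := by field_simp
    rw [this]
    refine (Real.exp_le_exp.mpr (by norm_num : (1 / 3 : ℝ) ≤ 1)).trans ?_
    linarith [Real.exp_one_lt_d9]
  rw [LFunction_eq_tsum_periodSum hχ (by linarith)]
  have hb (m : ℕ) : ‖periodSum χ (m + 1) s‖ ≤ 6 * ((m + 1 : ℕ) : ℝ) ^ (-(3 / 2) : ℝ) := by
    refine (norm_periodSum_le hχ (by linarith) m.succ_pos).trans ?_
    have h5 : (q : ℝ) ^ (1 - s.re) ≤ 3 :=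
      (Real.rpow_le_rpow_of_exponent_le (by linarith) (le_abs_self _)).trans hpow
    have h6 : ‖s‖ * (q : ℝ) ^ (1 - s.re) ≤ 2 * 3 := by gcongr; linarith
    refine (mul_le_mul h6 (Real.rpow_le_rpow_of_exponent_le (y := -s.re - 1) (z := -(3 / 2))
      ?_ ?_) (by positivity) (by norm_num)).trans_eq (by norm_num)
    · simp
    · linarith
  have hsum1 : Summable fun m : ℕ => 6 * ((m + 1 : ℕ) : ℝ) ^ (-(3 / 2) : ℝ) :=
    ((summable_nat_add_iff (f := fun m : ℕ => (m : ℝ) ^ (-(3 / 2) : ℝ)) 1).mpr hsum).mul_left 6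
  have hs1 : Summable fun m => periodSum χ (m + 1) s := Summable.of_norm_bounded hsum1 hb
  have hs2 : Summable fun m => periodSum χ m s :=
    (summable_nat_add_iff (f := fun m => periodSum χ m s) 1).mp hs1
  rw [hs2.tsum_eq_zero_add]
  refine (norm_add_le _ _).trans ?_
  have h7 : ‖∑' m, periodSum χ (m + 1) s‖ ≤ 6 * ∑' m : ℕ, (m : ℝ) ^ (-(3 / 2) : ℝ) := by
    refine (tsum_of_norm_bounded hsum1.hasSum hb).trans ?_
    rw [tsum_mul_left, hsum.tsum_eq_zero_add]
    have : (0 : ℝ) ≤ ((0 : ℕ) : ℝ) ^ (-(3 / 2) : ℝ) := by positivity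
    linarith
  have h8 := norm_periodSum_zero_le (χ := χ) hs0 hpow
  have h9 : 0 ≤ ∑' m : ℕ, (m : ℝ) ^ (-(3 / 2) : ℝ) := tsum_nonneg fun m => by positivity
  have h10 := mul_nonneg h9 (sub_nonneg.mpr hl)
  generalize ∑' m : ℕ, (m : ℝ) ^ (-(3 / 2) : ℝ) = S at h7 h9 h10 ⊢
  linarith

lemma one_le_log_natCast {q : ℕ} (hq : 3 ≤ q) : 1 ≤ Real.log q := by
  have hq : (3 : ℝ) ≤ q := by exact_mod_cast hq
  rw [Real.le_log_iff_exp_le (by linarith)]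
  linarith [Real.exp_one_lt_d9]

lemma norm_LFunctionTrivChar_le {q : ℕ} [NeZero q] {x : ℝ} (hx : 0 < x) (hx1 : x ≤ 1) :
    ‖DirichletCharacter.LFunctionTrivChar q (1 + x)‖ ≤ 2 / x := by
  have hre : 1 < (1 + x : ℂ).re := by simpa
  have h1 : Summable fun n : ℕ => 1 / (n : ℝ) ^ (1 + x) :=
    Real.summable_one_div_nat_rpow.mpr (by linarith)
  rw [DirichletCharacter.LFunctionTrivChar, DirichletCharacter.LFunction_eq_LSeries 1 hre, LSeries]
  refine (tsum_of_norm_bounded h1.hasSum fun n => ?_).trans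
    ((tsum_one_div_rpow_le (by linarith : 1 < 1 + x)).trans ?_)
  · rw [LSeries.norm_term_eq]
    split_ifs with hn
    · positivity
    · simp only [add_re, one_re, ofReal_re]
      gcongr
      exact DirichletCharacter.norm_le_one _ _
  · rw [show 1 + x - 1 = x by ring, show (2 : ℝ) / x = 1 / x + 1 / x by ring]
    gcongr
    rw [le_div_iff₀ hx]; linarith

lemma norm_deriv_LFunction_le {C : ℝ} {q : ℕ} [NeZero q] (hq : 3 ≤ q)
    {χ : DirichletCharacter ℂ q} (hχ : χ ≠ 1)
    (hC : ∀ s : ℂ, ‖s - 1‖ ≤ 1 / (3 * Real.log q) →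
      ‖DirichletCharacter.LFunction χ s‖ ≤ C * Real.log q)
    {s : ℂ} (hs : ‖s - 1‖ ≤ 1 / (6 * Real.log q)) :
    ‖deriv (DirichletCharacter.LFunction χ) s‖ ≤ 6 * C * Real.log q ^ 2 := by
  have hl := one_le_log_natCast hq
  have := norm_deriv_le_of_forall_mem_sphere_norm_le (c := s) (R := 1 / (6 * Real.log q))
    (C := C * Real.log q) (f := DirichletCharacter.LFunction χ) (by positivity)
    (DirichletCharacter.differentiable_LFunction hχ).diffContOnCl (fun z hz => ?_)
  · refine this.trans_eq ?_
    field_simp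
  · refine hC z ?_
    rw [mem_sphere_iff_norm] at hz
    have h1 : ‖z - 1‖ ≤ ‖z - s‖ + ‖s - 1‖ := norm_sub_le_norm_sub_add_norm_sub _ _ _
    have h2 : 1 / (3 * Real.log q) = 1 / (6 * Real.log q) + 1 / (6 * Real.log q) := by
      field_simp; norm_num
    linarith

lemma norm_LFunction_one_add_ge {C x l : ℝ} (hC : 1 ≤ C) (hl : 1 ≤ l)
    (hxl : x = 1 / (8 * C * (24 * C) ^ 4) / l ^ 9)
    {q : ℕ} [NeZero q] (χ : DirichletCharacter ℂ q)
    (hχ2 : ‖DirichletCharacter.LFunction (χ ^ 2) (1 + x)‖ ≤ C * l) :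
    24 * C * l ^ 2 * x ≤ ‖DirichletCharacter.LFunction χ (1 + x)‖ := by
  have hx : 0 < x := by rw [hxl]; positivity
  have hx1 : x ≤ 1 := by
    rw [hxl, div_div]
    apply div_le_one_of_le₀ _ (by positivity)
    have h1 : 1 ≤ C ^ 5 := one_le_pow₀ hC
    have h2 : 1 ≤ l ^ 9 := one_le_pow₀ hl
    nlinarith [mul_le_mul h1 h2 zero_le_one (by positivity)]
  have h := DirichletCharacter.norm_LFunction_product_ge_one χ hx 0
  simp only [ofReal_zero, mul_zero, add_zero, norm_mul, norm_pow] at h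
  by_contra! hlt
  have h3 := norm_LFunctionTrivChar_le (q := q) hx hx1
  have h4 : ‖DirichletCharacter.LFunctionTrivChar q (1 + x)‖ ^ 3 *
      ‖DirichletCharacter.LFunction χ (1 + x)‖ ^ 4 *
      ‖DirichletCharacter.LFunction (χ ^ 2) (1 + x)‖ <
      (2 / x) ^ 3 * (24 * C * l ^ 2 * x) ^ 4 * (C * l) := by
    have h5 : ‖DirichletCharacter.LFunction χ (1 + x)‖ ^ 4 < (24 * C * l ^ 2 * x) ^ 4 := by
      gcongr
    have h6 : ‖DirichletCharacter.LFunctionTrivChar q (1 + x)‖ ^ 3 ≤ (2 / x) ^ 3 := by gcongr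
    calc _ ≤ (2 / x) ^ 3 * ‖DirichletCharacter.LFunction χ (1 + x)‖ ^ 4 * (C * l) := by gcongr
      _ < _ := by gcongr
  have h7 : (2 / x) ^ 3 * (24 * C * l ^ 2 * x) ^ 4 * (C * l) = 1 := by
    have : (2 / x) ^ 3 * (24 * C * l ^ 2 * x) ^ 4 * (C * l) =
        8 * C * (24 * C) ^ 4 * l ^ 9 * x := by
      field_simp
      ring
    rw [this, hxl]
    field_simp
  linarith

/-- A zero-free disc around `s = 1` for the `L`-functions of non-real characters, and a bound for
the logarithmic derivative there. -/
lemma exists_norm_logDeriv_LFunction_le : ∃ c : ℝ, 0 < c ∧ ∃ B : ℝ, 0 < B ∧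
    ∀ (q : ℕ) [NeZero q], 3 ≤ q → ∀ χ : DirichletCharacter ℂ q, χ ^ 2 ≠ 1 →
      ∀ s : ℂ, ‖s - 1‖ ≤ c / Real.log q ^ 9 → DirichletCharacter.LFunction χ s ≠ 0 ∧
        ‖deriv (DirichletCharacter.LFunction χ) s / DirichletCharacter.LFunction χ s‖ ≤
          B * Real.log q ^ 9 := by
  obtain ⟨C, hC1, hC⟩ := exists_norm_LFunction_le
  set c : ℝ := 1 / (8 * C * (24 * C) ^ 4) with hc
  have hc0 : 0 < c := by positivity
  refine ⟨c, hc0, 1 / (2 * c), by positivity, ?_⟩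
  intro q _ hq χ hχ2 s hs
  have hχ : χ ≠ 1 := fun h => hχ2 (by simp [h])
  have hl := one_le_log_natCast hq
  set l := Real.log q
  set x : ℝ := c / l ^ 9 with hx
  have hx0 : 0 < x := by positivity
  have hx6 : x ≤ 1 / (6 * l) := by
    rw [hx, hc, div_div]
    apply one_div_le_one_div_of_le (by positivity)
    have h1 : 1 ≤ C ^ 5 := one_le_pow₀ hC1
    have h2 : l ≤ l ^ 9 := le_self_pow₀ hl (by norm_num)
    nlinarith [mul_le_mul h1 h2 (by linarith) (by positivity)]
  have hx3 : x ≤ 1 / (3 * l) := hx6.trans (by gcongr; norm_num)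
  have hx1 : ‖((1 + x : ℂ)) - 1‖ = x := by simp [abs_of_pos hx0]
  have hge := norm_LFunction_one_add_ge hC1 hl hx χ (hC q hq _ hχ2 _ (by rw [hx1]; exact hx3))
  have hder {w : ℂ} (hw : w ∈ Metric.closedBall (1 : ℂ) x) :
      ‖deriv (DirichletCharacter.LFunction χ) w‖ ≤ 6 * C * l ^ 2 :=
    norm_deriv_LFunction_le hq hχ (hC q hq χ hχ)
      ((mem_closedBall_iff_norm.mp hw).trans hx6)
  have hsm : s ∈ Metric.closedBall (1 : ℂ) x := mem_closedBall_iff_norm.mpr hs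
  have hxm : (1 + x : ℂ) ∈ Metric.closedBall (1 : ℂ) x := mem_closedBall_iff_norm.mpr hx1.le
  have hmv := Convex.norm_image_sub_le_of_norm_deriv_le (𝕜 := ℂ)
    (fun w _ => (DirichletCharacter.differentiable_LFunction hχ) w) (fun w hw => hder hw)
    (convex_closedBall _ _) hsm hxm
  have hdist : ‖(1 + x : ℂ) - s‖ ≤ 2 * x := by
    have := norm_sub_le ((1 + x : ℂ) - 1) (s - 1)
    rw [hx1] at this
    have h2 : (1 + x : ℂ) - 1 - (s - 1) = (1 + x : ℂ) - s := by ring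
    rw [h2] at this
    linarith
  have hlow : 12 * C * l ^ 2 * x ≤ ‖DirichletCharacter.LFunction χ s‖ := by
    have h1 := norm_sub_norm_le (DirichletCharacter.LFunction χ (1 + x))
      (DirichletCharacter.LFunction χ s)
    have h2 : 6 * C * l ^ 2 * ‖(1 + x : ℂ) - s‖ ≤ 6 * C * l ^ 2 * (2 * x) := by gcongr
    linarith
  have hpos : 0 < 12 * C * l ^ 2 * x := by positivity
  refine ⟨norm_pos_iff.mp (hpos.trans_le hlow), ?_⟩
  rw [norm_div]
  refine (div_le_div₀ (by positivity) (hder hsm) hpos hlow).trans_eq ?_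
  rw [hx]
  field_simp
  norm_num

/-- A quadratic Dirichlet character modulo a power of an odd number `d` is induced from level
`d`. -/
lemma factorsThrough_of_sq_eq_one {d m : ℕ} [NeZero (d ^ m)] (hd : Odd d) (hm : m ≠ 0)
    {χ : DirichletCharacter ℂ (d ^ m)} (hχ : χ ^ 2 = 1) : χ.FactorsThrough d := by
  have hdvd : d ∣ d ^ m := dvd_pow_self d hm
  refine (DirichletCharacter.factorsThrough_iff_ker_unitsMap hdvd).mpr fun x hx => ?_
  have hxd : ((x : ZMod (d ^ m)).val : ZMod d) = 1 := by
    have := congrArg Units.val (MonoidHom.mem_ker.mp hx)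
    rw [ZMod.unitsMap_val] at this
    simpa [ZMod.natCast_val] using this
  have hdiv : ((d : ℕ) : ℤ) ∣ ((x : ZMod (d ^ m)).val : ℤ) - 1 := by
    rw [← ZMod.intCast_zmod_eq_zero_iff_dvd]
    push_cast
    rw [hxd, sub_self]
  have hpow := dvd_sub_pow_of_dvd_sub hdiv (m - 1)
  rw [Nat.sub_add_cancel (Nat.one_le_iff_ne_zero.mpr hm)] at hpow
  have hx1 : x ^ d ^ (m - 1) = 1 := by
    ext
    have h2 : (((d ^ m : ℕ) : ℤ)) ∣ ((x : ZMod (d ^ m)).val : ℤ) ^ d ^ (m - 1) - 1 := by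
      simpa using hpow
    rw [← ZMod.intCast_zmod_eq_zero_iff_dvd] at h2
    push_cast at h2
    rw [ZMod.natCast_zmod_val, sub_eq_zero] at h2
    simpa using h2
  have h1 : χ.toUnitHom x ^ 2 = 1 := by
    ext
    have := congrArg (fun ψ : DirichletCharacter ℂ (d ^ m) => ψ x) hχ
    simpa [MulChar.pow_apply' _ two_ne_zero] using this
  have h3 : χ.toUnitHom x ^ d ^ (m - 1) = 1 := by rw [← map_pow, hx1, map_one]
  rw [MonoidHom.mem_ker]
  have hcop : Nat.gcd 2 (d ^ (m - 1)) = 1 := (Nat.coprime_two_left.mpr (hd.pow))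
  have h4 := Nat.dvd_gcd (orderOf_dvd_of_pow_eq_one h1) (orderOf_dvd_of_pow_eq_one h3)
  rw [hcop, Nat.dvd_one, orderOf_eq_one_iff] at h4
  exact h4

lemma LFunction_changeLevel_pow {d m : ℕ} [NeZero d] [NeZero (d ^ m)] (hm : m ≠ 0)
    {χ : DirichletCharacter ℂ d} (hχ : χ ≠ 1) :
    DirichletCharacter.LFunction (DirichletCharacter.changeLevel (dvd_pow_self d hm) χ) =
      DirichletCharacter.LFunction χ := by
  ext s
  rw [DirichletCharacter.LFunction_changeLevel _ χ (.inl hχ), Nat.primeFactors_pow _ hm,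
    Finset.prod_eq_one, mul_one]
  intro p hp
  rw [χ.map_nonunit, zero_mul, sub_zero]
  rw [ZMod.isUnit_iff_coprime]
  exact fun h => (Nat.prime_of_mem_primeFactors hp).one_lt.ne'
    (Nat.Coprime.eq_one_of_dvd h (Nat.dvd_of_mem_primeFactors hp))

lemma LFunctionTrivChar₁_pow {d m : ℕ} [NeZero d] [NeZero (d ^ m)] (hm : m ≠ 0) :
    DirichletCharacter.LFunctionTrivChar₁ (d ^ m) = DirichletCharacter.LFunctionTrivChar₁ d := by
  ext s
  rcases eq_or_ne s 1 with rfl | hs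
  · simp only [DirichletCharacter.LFunctionTrivChar₁, Function.update_self,
      Nat.primeFactors_pow _ hm]
  · simp only [DirichletCharacter.LFunctionTrivChar₁, Function.update_of_ne hs,
      DirichletCharacter.LFunctionTrivChar_eq_mul_riemannZeta hs, Nat.primeFactors_pow _ hm]

/-- The logarithmic derivative of an entire function is bounded near a point of nonvanishing. -/
lemma exists_norm_logDeriv_le {f : ℂ → ℂ} (hf : Differentiable ℂ f) {z : ℂ} (hz : f z ≠ 0) :
    ∃ c, 0 < c ∧ ∃ B, 0 < B ∧ ∀ s, ‖s - z‖ ≤ c → f s ≠ 0 ∧ ‖deriv f s / f s‖ ≤ B := by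
  have h1 : ∀ᶠ s in nhds z, f s ≠ 0 := hf.continuous.continuousAt.eventually_ne hz
  have hc : ContinuousAt (fun s => ‖deriv f s / f s‖) z :=
    ((hf.contDiff.continuous_deriv le_rfl).continuousAt.div hf.continuous.continuousAt hz).norm
  have h2 := hc.eventually_le_const (lt_add_one _)
  obtain ⟨ε, hε, h⟩ := Metric.eventually_nhds_iff.mp (h1.and h2)
  refine ⟨ε / 2, by positivity, ‖deriv f z / f z‖ + 1, by positivity, fun s hs => h ?_⟩
  rw [dist_eq_norm]
  linarith

lemma exists_norm_logDeriv_LFunction_pow_le :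
    ∃ c, 0 < c ∧ c ≤ 1 ∧ ∃ B, 0 < B ∧ ∀ m : ℕ, m ≠ 0 → ∀ s : ℂ,
      ‖s - 1‖ ≤ c / Real.log ((15 ^ m : ℕ) : ℝ) ^ 9 →
      (DirichletCharacter.LFunctionTrivChar₁ (15 ^ m) s ≠ 0 ∧
        ‖deriv (DirichletCharacter.LFunctionTrivChar₁ (15 ^ m)) s /
          DirichletCharacter.LFunctionTrivChar₁ (15 ^ m) s‖
            ≤ B * Real.log ((15 ^ m : ℕ) : ℝ) ^ 9) ∧
      ∀ χ : DirichletCharacter ℂ (15 ^ m), χ ≠ 1 → DirichletCharacter.LFunction χ s ≠ 0 ∧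
        ‖deriv (DirichletCharacter.LFunction χ) s / DirichletCharacter.LFunction χ s‖
          ≤ B * Real.log ((15 ^ m : ℕ) : ℝ) ^ 9 := by
  obtain ⟨c₁, hc₁, B₁, hB₁, h₁⟩ := exists_norm_logDeriv_LFunction_le
  obtain ⟨c₂, hc₂, B₂, hB₂, h₂⟩ := exists_norm_logDeriv_le
    (DirichletCharacter.differentiable_LFunctionTrivChar₁ 15)
    (DirichletCharacter.LFunctionTrivChar₁_apply_one_ne_zero 15)
  have hex (χ : {χ : DirichletCharacter ℂ 15 // χ ≠ 1}) := exists_norm_logDeriv_le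
    (DirichletCharacter.differentiable_LFunction χ.2)
    (DirichletCharacter.LFunction_ne_zero_of_one_le_re χ.1 (.inl χ.2) (s := 1) (by simp))
  choose c₃ hc₃ B₃ hB₃ h₃ using hex
  have : Finite {χ : DirichletCharacter ℂ 15 // χ ≠ 1} := inferInstance
  obtain ⟨c₄, hc₄, hle⟩ : ∃ c₄ > 0, ∀ χ, c₄ ≤ c₃ χ := by
    rcases isEmpty_or_nonempty {χ : DirichletCharacter ℂ 15 // χ ≠ 1} with h | h
    · exact ⟨1, one_pos, fun χ => (h.false χ).elim⟩
    · obtain ⟨χ₀, hχ₀⟩ := Finite.exists_min c₃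
      exact ⟨c₃ χ₀, hc₃ χ₀, hχ₀⟩
  obtain ⟨B₄, hle'⟩ : ∃ B₄, ∀ χ, B₃ χ ≤ B₄ := by
    obtain ⟨B₄, hB₄⟩ := (Set.finite_range B₃).bddAbove
    exact ⟨B₄, fun χ => hB₄ ⟨χ, rfl⟩⟩
  refine ⟨min (min c₁ c₂) (min c₄ 1), by positivity, by simp, max (max B₁ B₂) B₄, by positivity, ?_⟩
  intro m hm s hs
  have hq : 3 ≤ 15 ^ m := le_trans (by norm_num) (Nat.le_self_pow hm 15)
  have hl := one_le_log_natCast hq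
  set l := Real.log ((15 ^ m : ℕ) : ℝ) with hldef
  have hl9 : 1 ≤ l ^ 9 := one_le_pow₀ hl
  have hBp : 0 < max (max B₁ B₂) B₄ := by positivity
  have hs0 : ‖s - 1‖ ≤ min (min c₁ c₂) (min c₄ 1) := hs.trans (div_le_self (by positivity) hl9)
  have hBm {B' : ℝ} (h : B' ≤ max (max B₁ B₂) B₄) : B' ≤ max (max B₁ B₂) B₄ * l ^ 9 :=
    h.trans (le_mul_of_one_le_right hBp.le hl9)
  refine ⟨?_, fun χ hχ => ?_⟩
  · rw [LFunctionTrivChar₁_pow hm]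
    obtain ⟨h, h'⟩ := h₂ s (hs0.trans (by simp))
    exact ⟨h, h'.trans (hBm (by simp))⟩
  · by_cases hχ2 : χ ^ 2 = 1
    · obtain ⟨hd, χ₀, hχ₀⟩ := factorsThrough_of_sq_eq_one (by decide) hm hχ2
      have hne : χ₀ ≠ 1 := by
        rintro rfl
        exact hχ (by rw [hχ₀, map_one])
      rw [hχ₀, LFunction_changeLevel_pow hm hne]
      obtain ⟨h, h'⟩ := h₃ ⟨χ₀, hne⟩ s (hs0.trans ((by simp : _ ≤ c₄).trans (hle _)))
      exact ⟨h, h'.trans (hBm ((hle' ⟨χ₀, hne⟩).trans (by simp)))⟩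
    · obtain ⟨h, h'⟩ := h₁ (15 ^ m) hq χ hχ2 s (hs.trans (by gcongr; simp))
      exact ⟨h, h'.trans (by gcongr; simp)⟩

end LFunctionBounds

section LeastPrime

open Complex ArithmeticFunction.vonMangoldt DirichletCharacter

/-- Bounds for logarithmic derivatives of all `L`-functions modulo `q` give a bound for the
regularised `L`-series of the von Mangoldt function restricted to a residue class. -/
lemma norm_LFunctionResidueClassAux_le {q : ℕ} [NeZero q] (a : ZMod q) {A : ℝ} {s : ℂ}
    (h₁ : ‖deriv (LFunctionTrivChar₁ q) s / LFunctionTrivChar₁ q s‖ ≤ A)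
    (h : ∀ χ : DirichletCharacter ℂ q, χ ≠ 1 → ‖deriv (LFunction χ) s / LFunction χ s‖ ≤ A) :
    ‖LFunctionResidueClassAux a s‖ ≤ A := by
  classical
  have hφ : (0 : ℝ) < q.totient := by exact_mod_cast Nat.totient_pos.mpr q.pos_of_neZero
  have hcard : (Fintype.card (DirichletCharacter ℂ q) : ℝ) = q.totient := by
    rw [← Nat.card_eq_fintype_card, card_eq_totient_of_hasEnoughRootsOfUnity ℂ q]
  rw [LFunctionResidueClassAux, norm_mul, norm_inv, Complex.norm_natCast, inv_mul_le_iff₀ hφ]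
  refine (norm_sub_le _ _).trans ?_
  have hsum : ‖∑ χ ∈ ({1}ᶜ : Finset (DirichletCharacter ℂ q)),
      χ a⁻¹ * deriv (LFunction χ) s / LFunction χ s‖ ≤
      (({1}ᶜ : Finset (DirichletCharacter ℂ q)).card : ℝ) * A := by
    rw [← nsmul_eq_mul]
    refine (norm_sum_le _ _).trans (Finset.sum_le_card_nsmul _ _ _ fun χ hχ => ?_)
    rw [mul_div_assoc, norm_mul]
    refine (mul_le_of_le_one_left (norm_nonneg _) (χ.norm_le_one _)).trans (h χ ?_)
    simpa using hχ
  rw [Finset.card_compl, Finset.card_singleton, Nat.cast_sub (Fintype.card_pos), hcard] at hsum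
  rw [neg_div, norm_neg]
  push_cast at hsum
  calc _ ≤ A + (q.totient - 1) * A := add_le_add h₁ (by convert! hsum)
    _ = _ := by ring

lemma differentiableAt_LFunctionResidueClassAux {q : ℕ} [NeZero q] (a : ZMod q) {s : ℂ}
    (h₁ : LFunctionTrivChar₁ q s ≠ 0)
    (h : ∀ χ : DirichletCharacter ℂ q, χ ≠ 1 → LFunction χ s ≠ 0) :
    DifferentiableAt ℂ (LFunctionResidueClassAux a) s := by
  have hd (f : ℂ → ℂ) (hf : Differentiable ℂ f) : Differentiable ℂ (deriv f) :=
    hf.contDiff.differentiable_deriv_two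
  refine DifferentiableAt.const_mul (DifferentiableAt.sub ?_ ?_) _
  · exact ((hd _ (differentiable_LFunctionTrivChar₁ q)) s).fun_neg.fun_div
      (differentiable_LFunctionTrivChar₁ q s) h₁
  · refine DifferentiableAt.fun_sum fun χ hχ => ?_
    have hχ : χ ≠ 1 := by simpa using hχ
    have := differentiable_LFunction hχ
    exact (((hd _ this) s).const_mul _).fun_div (this s) (h χ hχ)

lemma iterate_logMul_apply (f : ℕ → ℂ) (k n : ℕ) :
    LSeries.logMul^[k] f n = Complex.log n ^ k * f n := by
  induction k with
  | zero => simp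
  | succ k ih => rw [Function.iterate_succ_apply', LSeries.logMul, ih, pow_succ']; ring

lemma hasSum_iterate_logMul {f : ℕ → ℝ} {x : ℝ} (hx0 : x ≠ 0) (k : ℕ)
    (hx : LSeries.abscissaOfAbsConv (fun n => (f n : ℂ)) < x) :
    HasSum (fun n : ℕ => f n * Real.log n ^ k / (n : ℝ) ^ x)
      ((-1) ^ k * iteratedDeriv k (LSeries fun n => (f n : ℂ)) x).re := by
  have hx' : LSeries.abscissaOfAbsConv (fun n => (f n : ℂ)) < (x : ℂ).re := by simpa using hx
  rw [LSeries_iteratedDeriv k hx', ← mul_assoc, ← mul_pow]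
  have hs : LSeriesSummable (LSeries.logMul^[k] fun n => (f n : ℂ)) x :=
    LSeriesSummable_of_abscissaOfAbsConv_lt_re (by rwa [LSeries.absicssaOfAbsConv_logPowMul])
  have := Complex.hasSum_re hs.hasSum
  simp only [mul_neg, mul_one, neg_neg, one_pow, one_mul]
  convert! this using 2 with n
  rcases eq_or_ne n 0 with rfl | hn
  · simp [Real.zero_rpow hx0]
  · rw [LSeries.term_of_ne_zero hn, iterate_logMul_apply, ← Complex.natCast_log,
      ← Complex.ofReal_natCast, ← Complex.ofReal_cpow n.cast_nonneg]
    norm_cast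
    rw [mul_comm (f n)]

lemma tsum_residueClass_ge {q : ℕ} [NeZero q] {a : ZMod q} (ha : IsUnit a) {A η : ℝ} (hη : 0 < η)
    (hne : ∀ s : ℂ, ‖s - 1‖ ≤ 3 * η → LFunctionTrivChar₁ q s ≠ 0 ∧
      ∀ χ : DirichletCharacter ℂ q, χ ≠ 1 → LFunction χ s ≠ 0)
    (hA : ∀ s : ℂ, ‖s - 1‖ ≤ 3 * η → ‖LFunctionResidueClassAux a s‖ ≤ A) (k : ℕ) :
    Summable (fun n : ℕ => residueClass a n * Real.log n ^ k / (n : ℝ) ^ (1 + η)) ∧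
    k.factorial / (q.totient * η ^ (k + 1)) - k.factorial * A / (2 * η) ^ k ≤
      ∑' n : ℕ, residueClass a n * Real.log n ^ k / (n : ℝ) ^ (1 + η) := by
  have hlt : LSeries.abscissaOfAbsConv (fun n => (residueClass a n : ℂ)) < (1 + η : ℝ) :=
    (abscissaOfAbsConv_residueClass_le_one a).trans_lt (by exact_mod_cast (by linarith))
  have hS := hasSum_iterate_logMul (by positivity) k hlt
  refine ⟨hS.summable, ?_⟩
  rw [hS.tsum_eq]
  have hball : ∀ s ∈ Metric.closedBall ((1 + η : ℝ) : ℂ) (2 * η), ‖s - 1‖ ≤ 3 * η := by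
    intro s hs
    rw [mem_closedBall_iff_norm] at hs
    have : s - 1 = (s - ((1 + η : ℝ) : ℂ)) + (η : ℝ) := by push_cast; ring
    rw [this]
    refine (norm_add_le _ _).trans ?_
    rw [Complex.norm_real, Real.norm_of_nonneg hη.le]
    linarith
  have hdiff : DifferentiableOn ℂ (LFunctionResidueClassAux a)
      (Metric.closedBall ((1 + η : ℝ) : ℂ) (2 * η)) := fun s hs =>
    (differentiableAt_LFunctionResidueClassAux a (hne s (hball s hs)).1
      (hne s (hball s hs)).2).differentiableWithinAt
  have hbound := Complex.norm_iteratedDeriv_le_of_forall_mem_sphere_norm_le k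
    (by positivity : 0 < 2 * η) (hdiff.diffContOnCl_ball subset_rfl)
    (fun s hs => hA s (hball s (Metric.sphere_subset_closedBall hs)))
  have hre : 1 < (((1 + η : ℝ) : ℂ)).re := by simpa
  have hopen : IsOpen {s : ℂ | 1 < s.re} := isOpen_lt continuous_const Complex.continuous_re
  have heq : (LSeries fun n => (residueClass a n : ℂ)) =ᶠ[nhds ((1 + η : ℝ) : ℂ)]
      LFunctionResidueClassAux a + (fun s => (q.totient : ℂ)⁻¹ * (s - 1)⁻¹) := by
    filter_upwards [hopen.mem_nhds hre] with s hs
    rw [Pi.add_apply, eqOn_LFunctionResidueClassAux ha hs]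
    simp [div_eq_mul_inv]
  have hinv : iteratedDeriv k (fun s : ℂ => (q.totient : ℂ)⁻¹ * (s - 1)⁻¹) ((1 + η : ℝ) : ℂ) =
      (-1) ^ k * ((k.factorial / (q.totient * η ^ (k + 1)) : ℝ) : ℂ) := by
    rw [iteratedDeriv_const_mul_field, iteratedDeriv_comp_sub_const k Inv.inv 1,
      iteratedDeriv_eq_iterate]
    dsimp only
    rw [iter_deriv_inv]
    push_cast
    have h0 : (η : ℂ) ≠ 0 := by exact_mod_cast hη.ne'
    rw [add_sub_cancel_left, show (-1 - (k : ℤ)) = -((k + 1 : ℕ) : ℤ) by push_cast; ring,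
      zpow_neg, zpow_natCast]
    have hφ : (q.totient : ℂ) ≠ 0 := by exact_mod_cast (Nat.totient_pos.mpr q.pos_of_neZero).ne'
    field_simp
  have hana : AnalyticAt ℂ (LFunctionResidueClassAux a) ((1 + η : ℝ) : ℂ) :=
    hdiff.analyticAt (Metric.closedBall_mem_nhds _ (by positivity))
  have hinvc : ContDiffAt ℂ k (fun s : ℂ => (q.totient : ℂ)⁻¹ * (s - 1)⁻¹) ((1 + η : ℝ) : ℂ) := by
    refine contDiffAt_const.mul (ContDiffAt.inv (by fun_prop) ?_)
    push_cast
    rw [add_sub_cancel_left]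
    exact_mod_cast hη.ne'
  rw [heq.iteratedDeriv_eq k, iteratedDeriv_add hana.contDiffAt hinvc, hinv, mul_add,
    ← mul_assoc, ← mul_pow, Complex.add_re]
  simp only [mul_neg, mul_one, neg_neg, one_pow, one_mul, Complex.ofReal_re]
  have habs := Complex.abs_re_le_norm ((-1) ^ k *
    iteratedDeriv k (LFunctionResidueClassAux a) ((1 + η : ℝ) : ℂ))
  rw [norm_mul, norm_pow, norm_neg, norm_one, one_pow, one_mul] at habs
  linarith [neg_abs_le ((-1) ^ k *
    iteratedDeriv k (LFunctionResidueClassAux a) ((1 + η : ℝ) : ℂ)).re]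

lemma log_pow_le_mul_rpow {x δ : ℝ} (hx : 1 ≤ x) (hδ : 0 < δ) (j : ℕ) :
    Real.log x ^ j ≤ j.factorial * (1 / δ) ^ j * x ^ δ := by
  have h := Real.pow_div_factorial_le_exp (δ * Real.log x)
    (mul_nonneg hδ.le (Real.log_nonneg hx)) j
  rw [mul_comm δ, ← Real.rpow_def_of_pos (by linarith), mul_pow, div_le_iff₀ (by positivity)] at h
  rw [one_div, inv_pow]
  calc Real.log x ^ j = Real.log x ^ j * δ ^ j * (δ ^ j)⁻¹ := by field_simp
    _ ≤ (x ^ δ * j.factorial) * (δ ^ j)⁻¹ := by gcongr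
    _ = _ := by ring

lemma summable_indicator_isPrimePow_not_prime :
    Summable ({n : ℕ | IsPrimePow n ∧ ¬ n.Prime}.indicator fun n => 1 / (n : ℝ) ^ (7 / 8 : ℝ)) := by
  have h₂ : Summable fun n : ℕ => 1 / ((n : ℝ)) ^ (7 / 4 : ℝ) :=
    Real.summable_one_div_nat_rpow.mpr (by norm_num)
  have h₃ : Summable fun n : ℕ => 1 / ((n : ℝ)) ^ (21 / 8 : ℝ) :=
    Real.summable_one_div_nat_rpow.mpr (by norm_num)
  have h := h₂.mul_of_nonneg h₃ (fun n => by positivity) (fun n => by positivity)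
  rw [← summable_subtype_iff_indicator]
  have hex (n : {n : ℕ | IsPrimePow n ∧ ¬ n.Prime}) : ∃ x : ℕ × ℕ, n.1 = x.1 ^ 2 * x.2 ^ 3 := by
    obtain ⟨n, hn, hnp⟩ := n
    obtain ⟨p, j, hp, hj, rfl⟩ := hn
    have hp := Nat.prime_iff.mpr hp
    have hj2 : 2 ≤ j := by
      by_contra! h
      have : j = 1 := by lia
      exact hnp (by rwa [this, pow_one])
    rcases Nat.even_or_odd' j with ⟨i, rfl | rfl⟩
    · exact ⟨(p ^ i, 1), by simp; ring⟩
    · exact ⟨(p ^ (i - 1), p), by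
        rw [← pow_mul, ← pow_add]
        exact congrArg (p ^ ·) (by lia)⟩
  choose σ hσ using hex
  have hinj : Function.Injective σ := fun n n' h => Subtype.ext (by rw [hσ, hσ, h])
  refine (h.comp_injective hinj).congr fun n => ?_
  simp only [Function.comp_apply, hσ n]
  push_cast
  rw [Real.mul_rpow (by positivity) (by positivity), ← Real.rpow_natCast, ← Real.rpow_natCast,
    ← Real.rpow_mul (by positivity), ← Real.rpow_mul (by positivity), one_div_mul_one_div]
  norm_num

/-- If the residue class `a` contains no prime up to `X`, the weighted sum of the von Mangoldt
function over this class is small. -/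
lemma tsum_residueClass_le {q : ℕ} {a : ZMod q} {η X : ℝ} (hη : 0 < η) (hX : 0 < X)
    (h : ∀ p : ℕ, p.Prime → (p : ℝ) ≤ X → (p : ZMod q) ≠ a) (k : ℕ)
    (hs : Summable (fun n : ℕ => residueClass a n * Real.log n ^ k / (n : ℝ) ^ (1 + η))) :
    ∑' n : ℕ, residueClass a n * Real.log n ^ k / (n : ℝ) ^ (1 + η) ≤
      (k + 1).factorial * 8 ^ (k + 1) * ∑' n : ℕ, {n : ℕ | IsPrimePow n ∧ ¬ n.Prime}.indicator
        (fun n => 1 / (n : ℝ) ^ (7 / 8 : ℝ)) n +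
      (k + 1).factorial * (4 / η) ^ (k + 1) / X ^ (η / 2) * (1 + 4 / η) := by
  have hsum₂ : Summable fun n : ℕ => 1 / (n : ℝ) ^ (1 + η / 4) :=
    Real.summable_one_div_nat_rpow.mpr (by linarith)
  have hle : ∑' n : ℕ, 1 / (n : ℝ) ^ (1 + η / 4) ≤ 1 + 4 / η := by
    refine (tsum_one_div_rpow_le (by linarith)).trans_eq ?_
    rw [add_sub_cancel_left, one_div_div]
  have hsum₁ := summable_indicator_isPrimePow_not_prime
  calc _ ≤ ∑' n : ℕ, ((k + 1).factorial * 8 ^ (k + 1) *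
        {n : ℕ | IsPrimePow n ∧ ¬ n.Prime}.indicator (fun n => 1 / (n : ℝ) ^ (7 / 8 : ℝ)) n +
        (k + 1).factorial * (4 / η) ^ (k + 1) / X ^ (η / 2) * (1 / (n : ℝ) ^ (1 + η / 4))) := by
        refine hs.tsum_le_tsum (fun n => ?_) ((hsum₁.mul_left _).add (hsum₂.mul_left _))
        set I := {n : ℕ | IsPrimePow n ∧ ¬ n.Prime}.indicator
          (fun n => 1 / (n : ℝ) ^ (7 / 8 : ℝ)) n with hI
        have hI0 : 0 ≤ I := Set.indicator_nonneg (fun n _ => by positivity) n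
        by_cases hna : (n : ZMod q) = a ∧ IsPrimePow n
        swap
        · have : residueClass a n = 0 := by
            by_cases hna' : (n : ZMod q) = a
            · rw [residueClass, Set.indicator_of_mem (by exact hna')]
              exact ArithmeticFunction.vonMangoldt_eq_zero_iff.mpr fun h => hna ⟨hna', h⟩
            · exact Set.indicator_of_notMem (s := {n : ℕ | (n : ZMod q) = a}) hna' _
          rw [this, zero_mul, zero_div]
          positivity
        obtain ⟨hna, hpp⟩ := hna
        have hn1 : (1 : ℝ) ≤ n := by exact_mod_cast hpp.one_lt.le
        have hn0 : (0 : ℝ) < n := by linarith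
        have hlog := Real.log_nonneg hn1
        have hnum : residueClass a n * Real.log n ^ k ≤ Real.log n ^ (k + 1) := by
          rw [pow_succ']
          gcongr
          exact (residueClass_le a n).trans ArithmeticFunction.vonMangoldt_le_log
        by_cases hnp : n.Prime
        · have hXn : X < n := by
            by_contra! hle
            exact h n hnp hle hna
          refine le_add_of_nonneg_of_le (by positivity) ?_
          calc _ ≤ ((k + 1).factorial * (1 / (η / 4)) ^ (k + 1) * (n : ℝ) ^ (η / 4)) /
                (n : ℝ) ^ (1 + η) := by
                gcongr ?_ / _
                exact hnum.trans (log_pow_le_mul_rpow hn1 (by positivity) _)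
            _ = (k + 1).factorial * (4 / η) ^ (k + 1) / (n : ℝ) ^ (η / 2) *
                (1 / (n : ℝ) ^ (1 + η / 4)) := by
                have : (n : ℝ) ^ (1 + η) =
                    (n : ℝ) ^ (η / 4) * ((n : ℝ) ^ (η / 2) * (n : ℝ) ^ (1 + η / 4)) := by
                  rw [← Real.rpow_add hn0, ← Real.rpow_add hn0]
                  congr 1
                  ring
                rw [this, one_div_div]
                have := Real.rpow_pos_of_pos hn0 (η / 4)
                field_simp
            _ ≤ _ := by gcongr
        · refine le_add_of_le_of_nonneg ?_ (by positivity)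
          rw [hI, Set.indicator_of_mem (by exact ⟨hpp, hnp⟩)]
          calc _ ≤ ((k + 1).factorial * (1 / (1 / 8)) ^ (k + 1) * (n : ℝ) ^ (1 / 8 : ℝ)) /
                (n : ℝ) ^ (1 : ℝ) := by
                gcongr ?_ / (n : ℝ) ^ ?_
                · exact hnum.trans (log_pow_le_mul_rpow hn1 (by positivity) _)
                · linarith
            _ = _ := by
                have : (n : ℝ) ^ (1 : ℝ) = (n : ℝ) ^ (1 / 8 : ℝ) * (n : ℝ) ^ (7 / 8 : ℝ) := by
                  rw [← Real.rpow_add hn0]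
                  norm_num
                rw [this, one_div_one_div]
                have := Real.rpow_pos_of_pos hn0 (1 / 8)
                field_simp
    _ = _ + _ * _ := by
        rw [(hsum₁.mul_left _).tsum_add (hsum₂.mul_left _), tsum_mul_left, tsum_mul_left]
    _ ≤ _ := by gcongr

lemma exists_prime_le_of_norm_LFunctionResidueClassAux_le {q : ℕ} [NeZero q] {a : ZMod q}
    (ha : IsUnit a) {A η X : ℝ} (hη : 0 < η) (hX : 0 < X)
    (hne : ∀ s : ℂ, ‖s - 1‖ ≤ 3 * η → LFunctionTrivChar₁ q s ≠ 0 ∧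
      ∀ χ : DirichletCharacter ℂ q, χ ≠ 1 → LFunction χ s ≠ 0)
    (hA : ∀ s : ℂ, ‖s - 1‖ ≤ 3 * η → ‖LFunctionResidueClassAux a s‖ ≤ A) (k : ℕ)
    (h₁ : 4 * q.totient * (A * η) ≤ 2 ^ k)
    (h₂ : 4 * q.totient * (k + 1) * (8 * η) ^ (k + 1) *
      ∑' n : ℕ, {n : ℕ | IsPrimePow n ∧ ¬ n.Prime}.indicator
        (fun n => 1 / (n : ℝ) ^ (7 / 8 : ℝ)) n ≤ 1)
    (h₃ : 4 * q.totient * (k + 1) * 4 ^ (k + 1) * (1 + 4 / η) ≤ X ^ (η / 2)) :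
    ∃ p : ℕ, p.Prime ∧ (p : ZMod q) = a ∧ (p : ℝ) ≤ X := by
  by_contra! hcon
  have hcon' : ∀ p : ℕ, p.Prime → (p : ℝ) ≤ X → (p : ZMod q) ≠ a :=
    fun p hp hpX hpa => absurd hpX (hcon p hp hpa).not_ge
  obtain ⟨hs, hge⟩ := tsum_residueClass_ge ha hη hne hA k
  have hle := hge.trans (tsum_residueClass_le hη hX hcon' k hs)
  set P := ∑' n : ℕ, {n : ℕ | IsPrimePow n ∧ ¬ n.Prime}.indicator
        (fun n => 1 / (n : ℝ) ^ (7 / 8 : ℝ)) n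
  have hφ : (0 : ℝ) < q.totient := by exact_mod_cast Nat.totient_pos.mpr q.pos_of_neZero
  set φ := (q.totient : ℝ)
  have hk : (0 : ℝ) < k.factorial := by positivity
  have hXp : 0 < X ^ (η / 2) := by positivity
  have key : 1 ≤ φ * (A * η) / 2 ^ k + φ * (k + 1) * (8 * η) ^ (k + 1) * P +
      φ * (k + 1) * 4 ^ (k + 1) * (1 + 4 / η) / X ^ (η / 2) := by
    have := mul_le_mul_of_nonneg_left hle (by positivity : 0 ≤ φ * η ^ (k + 1) / k.factorial)
    rw [Nat.factorial_succ] at this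
    push_cast at this
    have e₁ : φ * η ^ (k + 1) / k.factorial *
        (k.factorial / (φ * η ^ (k + 1)) - k.factorial * A / (2 * η) ^ k) =
        1 - φ * (A * η) / 2 ^ k := by
      rw [mul_pow]
      field_simp
      ring
    have e₂ : φ * η ^ (k + 1) / k.factorial * ((k + 1) * k.factorial * 8 ^ (k + 1) * P +
        (k + 1) * k.factorial * (4 / η) ^ (k + 1) / X ^ (η / 2) * (1 + 4 / η)) =
        φ * (k + 1) * (8 * η) ^ (k + 1) * P +
        φ * (k + 1) * 4 ^ (k + 1) * (1 + 4 / η) / X ^ (η / 2) := by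
      rw [mul_pow, div_pow]
      field_simp
    rw [e₁, e₂] at this
    linarith
  have b₁ : φ * (A * η) / 2 ^ k ≤ 1 / 4 := by
    rw [div_le_iff₀ (by positivity)]
    linarith
  have b₃ : φ * (k + 1) * 4 ^ (k + 1) * (1 + 4 / η) / X ^ (η / 2) ≤ 1 / 4 := by
    rw [div_le_iff₀ (by positivity)]
    linarith
  linarith

lemma log_natCast_fifteen_pow_le (m : ℕ) : Real.log ((15 ^ m : ℕ) : ℝ) ≤ 3 * m := by
  push_cast
  rw [Real.log_pow, mul_comm]
  have : Real.log 15 ≤ 3 := by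
    have h16 : Real.log 16 = 4 * Real.log 2 := by
      rw [show (16 : ℝ) = 2 ^ 4 by norm_num, Real.log_pow]; norm_num
    have := Real.log_le_log (by norm_num) (by norm_num : (15 : ℝ) ≤ 16)
    linarith [Real.log_two_lt_d9]
  gcongr

lemma exists_natCast_le_two_pow (x : ℝ) : ∃ n : ℕ, x ≤ 2 ^ n := by
  obtain ⟨n, hn⟩ := pow_unbounded_of_one_lt x (one_lt_two)
  exact ⟨n, hn.le⟩

/-- Every invertible residue class modulo `15 ^ m` contains a prime `p` with `log p = O(m ^ 10)`. -/
theorem exists_prime_log_le :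
    ∃ C : ℝ, ∀ m : ℕ, m ≠ 0 → ∀ a : ZMod (15 ^ m), IsUnit a →
      ∃ p : ℕ, p.Prime ∧ (p : ZMod (15 ^ m)) = a ∧ Real.log p ≤ C * m ^ 10 := by
  obtain ⟨c₀, hc₀, hc₀1, B, hB, hL⟩ := exists_norm_logDeriv_LFunction_pow_le
  set c : ℝ := c₀ / 3 ^ 10 with hc
  have hcpos : 0 < c := by positivity
  have hc1 : c ≤ 1 / 3 ^ 10 := by rw [hc]; gcongr
  set P := ∑' n : ℕ, {n : ℕ | IsPrimePow n ∧ ¬ n.Prime}.indicator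
    (fun n => 1 / (n : ℝ) ^ (7 / 8 : ℝ)) n with hPdef
  have hP : 0 ≤ P := tsum_nonneg (Set.indicator_nonneg fun n _ => by positivity)
  obtain ⟨D, hD⟩ := exists_natCast_le_two_pow (4 * (B * 3 ^ 9 * c))
  obtain ⟨E, hE⟩ := exists_natCast_le_two_pow (4 * P)
  obtain ⟨F, hF⟩ := exists_natCast_le_two_pow (1 + 4 / c)
  set K := D + E + 4 with hK
  set G := F + 3 * K + 18 with hG
  refine ⟨2 * G * Real.log 2 / c, fun m hm a ha => ?_⟩
  have hm1 : (1 : ℝ) ≤ m := by exact_mod_cast Nat.one_le_iff_ne_zero.mpr hm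
  have hmn : 1 ≤ m := Nat.one_le_iff_ne_zero.mpr hm
  have hq : 3 ≤ 15 ^ m := le_trans (by norm_num) (Nat.le_self_pow hm 15)
  have hl1 := one_le_log_natCast hq
  have hl3 := log_natCast_fifteen_pow_le m
  set l := Real.log ((15 ^ m : ℕ) : ℝ) with hl
  set η : ℝ := c / m ^ 9 with hηdef
  have hη : 0 < η := by positivity
  have hη1 : 8 * η ≤ 1 / 4 := by
    have : η ≤ c := div_le_self hcpos.le (one_le_pow₀ hm1)
    linarith
  have h3η : 3 * η ≤ c₀ / l ^ 9 := by
    calc 3 * η = c₀ / (3 * m) ^ 9 := by rw [hηdef, hc, mul_pow]; field_simp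
      _ ≤ _ := by gcongr
  have hφ : ((15 ^ m).totient : ℝ) ≤ 2 ^ (4 * m) := by
    calc ((15 ^ m).totient : ℝ) ≤ ((15 ^ m : ℕ) : ℝ) := by exact_mod_cast Nat.totient_le _
      _ = 15 ^ m := by push_cast; rfl
      _ ≤ 16 ^ m := by gcongr; norm_num
      _ = _ := by rw [pow_mul]; norm_num
  set X := Real.exp (2 * G * Real.log 2 / c * m ^ 10) with hXdef
  have hX : X ^ (η / 2) = 2 ^ (G * m) := by
    rw [hXdef, ← Real.exp_mul, ← Real.rpow_natCast 2 (G * m), Real.rpow_def_of_pos two_pos]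
    congr 1
    rw [hηdef]
    push_cast
    field_simp
  have hk1 : ((K * m : ℕ) : ℝ) + 1 ≤ 2 ^ (K * m + 1) := by
    exact_mod_cast (Nat.lt_two_pow_self (n := K * m + 1)).le
  suffices h : ∃ p : ℕ, p.Prime ∧ (p : ZMod (15 ^ m)) = a ∧ (p : ℝ) ≤ X by
    obtain ⟨p, hp, hpa, hpX⟩ := h
    refine ⟨p, hp, hpa, ?_⟩
    rw [Real.log_le_iff_le_exp (by exact_mod_cast hp.pos)]
    exact hpX
  refine exists_prime_le_of_norm_LFunctionResidueClassAux_le ha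
    (A := B * l ^ 9) hη (X := X) (Real.exp_pos _)
    (fun s hs => ⟨(hL m hm s (hs.trans h3η)).1.1,
      fun χ hχ => ((hL m hm s (hs.trans h3η)).2 χ hχ).1⟩)
    (fun s hs => norm_LFunctionResidueClassAux_le a (hL m hm s (hs.trans h3η)).1.2
      fun χ hχ => ((hL m hm s (hs.trans h3η)).2 χ hχ).2) (K * m) ?_ ?_ ?_
  · calc 4 * ((15 ^ m).totient : ℝ) * (B * l ^ 9 * η)
        ≤ 4 * 2 ^ (4 * m) * (B * (3 * m) ^ 9 * η) := by gcongr
      _ = 4 * (B * 3 ^ 9 * c) * 2 ^ (4 * m) := by rw [hηdef]; field_simp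
      _ ≤ 2 ^ D * 2 ^ (4 * m) := by gcongr
      _ = 2 ^ (D + 4 * m) := by rw [pow_add]
      _ ≤ 2 ^ (K * m) := by
        gcongr
        · norm_num
        · rw [hK]; nlinarith
  · calc 4 * ((15 ^ m).totient : ℝ) * ((K * m : ℕ) + 1) * (8 * η) ^ (K * m + 1) * P
        ≤ 4 * 2 ^ (4 * m) * 2 ^ (K * m + 1) * (1 / 4) ^ (K * m + 1) * P := by gcongr
      _ = (4 * P) * 2 ^ (4 * m) * (1 / 2) ^ (K * m + 1) := by
        rw [show (1 / 4 : ℝ) = 1 / 2 * (1 / 2) by norm_num, mul_pow (1 / 2 : ℝ)]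
        have : (2 : ℝ) ^ (K * m + 1) * (1 / 2) ^ (K * m + 1) = 1 := by
          rw [← mul_pow]; norm_num
        linear_combination (4 * 2 ^ (4 * m) * (1 / 2 : ℝ) ^ (K * m + 1) * P) * this
      _ ≤ 2 ^ E * 2 ^ (4 * m) * (1 / 2) ^ (K * m + 1) := by gcongr
      _ = 2 ^ (E + 4 * m) / 2 ^ (K * m + 1) := by rw [one_div, inv_pow, ← pow_add, div_eq_mul_inv]
      _ ≤ 1 := by
        refine div_le_one_of_le₀ (pow_le_pow_right₀ one_le_two ?_) (by positivity)
        rw [hK]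
        nlinarith
  · rw [hX]
    have hη4 : 1 + 4 / η ≤ 2 ^ F * 2 ^ (9 * m) := by
      have hm2 : (m : ℝ) ≤ 2 ^ m := by exact_mod_cast (Nat.lt_two_pow_self (n := m)).le
      calc 1 + 4 / η = 1 + 4 / c * m ^ 9 := by rw [hηdef]; field_simp
        _ ≤ m ^ 9 + 4 / c * m ^ 9 := by gcongr; exact one_le_pow₀ hm1
        _ = (1 + 4 / c) * m ^ 9 := by ring
        _ ≤ 2 ^ F * (2 ^ m) ^ 9 := by gcongr
        _ = _ := by rw [← pow_mul, mul_comm m]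
    calc 4 * ((15 ^ m).totient : ℝ) * ((K * m : ℕ) + 1) * 4 ^ (K * m + 1) * (1 + 4 / η)
        ≤ 2 ^ 2 * 2 ^ (4 * m) * 2 ^ (K * m + 1) * (2 ^ 2) ^ (K * m + 1) *
          (2 ^ F * 2 ^ (9 * m)) := by
          gcongr <;> norm_num
      _ = 2 ^ (2 + 4 * m + (K * m + 1) + 2 * (K * m + 1) + (F + 9 * m)) := by
          rw [← pow_mul 2 2]; simp only [← pow_add]
      _ ≤ 2 ^ (G * m) := by
          gcongr
          · norm_num
          · rw [hG]; nlinarith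

end LeastPrime

section ClassNumberBound

open NumberField UniqueFactorizationMonoid

/-- A multiset of objects with sizes greater than one, no two distinct ones of which share a prime
factor in their sizes, is determined by the product of the sizes. -/
lemma Multiset.eq_of_prod_map_eq {α : Type*} {N : α → ℕ} {S : Set α}
    (hN : ∀ P ∈ S, N P ≠ 1) (hN0 : ∀ P ∈ S, N P ≠ 0)
    (hS : ∀ P ∈ S, ∀ Q ∈ S, ∀ p : ℕ, p.Prime → p ∣ N P → p ∣ N Q → P = Q)
    {s t : Multiset α} (hs : ∀ P ∈ s, P ∈ S) (ht : ∀ P ∈ t, P ∈ S)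
    (h : (s.map N).prod = (t.map N).prod) : s = t := by
  classical
  induction s using Multiset.induction_on generalizing t with
  | empty =>
    rcases t.empty_or_exists_mem with rfl | ⟨Q, hQ⟩
    · rfl
    · refine absurd (Nat.dvd_one.mp ?_) (hN Q (ht Q hQ))
      rw [Multiset.map_zero, Multiset.prod_zero] at h
      rw [h]
      exact Multiset.dvd_prod (Multiset.mem_map_of_mem N hQ)
  | cons P s ih =>
    have hP : P ∈ S := hs P (Multiset.mem_cons_self P s)
    obtain ⟨p, hp, hpP⟩ := Nat.exists_prime_and_dvd (hN P hP)
    have hpt : p ∣ (t.map N).prod := by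
      rw [← h, Multiset.map_cons, Multiset.prod_cons]
      exact hpP.mul_right _
    obtain ⟨x, hx, hpx⟩ := (Nat.prime_iff.mp hp).exists_mem_multiset_dvd hpt
    obtain ⟨Q, hQ, rfl⟩ := Multiset.mem_map.mp hx
    obtain rfl := hS P hP Q (ht Q hQ) p hp hpP hpx
    obtain ⟨u, rfl⟩ := Multiset.exists_cons_of_mem hQ
    simp only [Multiset.map_cons, Multiset.prod_cons] at h
    rw [ih (fun R hR => hs R (Multiset.mem_cons_of_mem hR))
      (fun R hR => ht R (Multiset.mem_cons_of_mem hR))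
      (Nat.eq_of_mul_eq_mul_left (Nat.pos_of_ne_zero (hN0 P hP)) h)]

section IdealCount

variable {K : Type*} [Field K] [NumberField K]

lemma Ideal.eq_minFac_and_mem_of_dvd_absNorm {P : Ideal (𝓞 K)} (hP : Prime P) {p : ℕ}
    (hp : p.Prime) (h : p ∣ absNorm P) : p = (absNorm P).minFac ∧ (p : 𝓞 K) ∈ P := by
  have : P.IsMaximal := (Ideal.isPrime_of_prime hP).isMaximal hP.ne_zero
  obtain ⟨r, n, hn, hr, hrp, hPr⟩ := Ideal.exists_prime_and_absNorm_eq_pow P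
  rw [hPr] at h ⊢
  obtain rfl := (Nat.prime_dvd_prime_iff_eq hp hrp).mp (hp.dvd_of_dvd_pow h)
  exact ⟨(hp.pow_minFac hn.ne').symm, hr⟩

/-- At most two prime ideals of a quadratic field lie above a given rational prime. -/
lemma Ideal.eq_of_dvd_absNorm_of_finrank_eq_two (hK : Module.finrank ℚ K = 2)
    {P Q R : Ideal (𝓞 K)} (hP : Prime P) (hQ : Prime Q) (hR : Prime R) {p : ℕ} (hp : p.Prime)
    (hpP : p ∣ absNorm P) (hpQ : p ∣ absNorm Q) (hpR : p ∣ absNorm R)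
    (hPR : P ≠ R) (hQR : Q ≠ R) : P = Q := by
  by_contra hPQ
  have hdvd {I : Ideal (𝓞 K)} (hI : Prime I) (h : p ∣ absNorm I) :
      I ∣ span {(p : 𝓞 K)} := by
    rw [Ideal.dvd_span_singleton]
    exact (eq_minFac_and_mem_of_dvd_absNorm hI hp h).2
  have hne {I J : Ideal (𝓞 K)} (hI : Prime I) (hJ : Prime J) (h : I ≠ J) : ¬ I ∣ J := fun hIJ =>
    h (associated_iff_eq.mp (hI.associated_of_dvd hJ hIJ))
  obtain ⟨J, hJ⟩ := hdvd hP hpP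
  obtain ⟨J', rfl⟩ := (hQ.dvd_or_dvd (hJ ▸ hdvd hQ hpQ)).resolve_left (hne hQ hP (Ne.symm hPQ))
  obtain ⟨J'', rfl⟩ := ((hR.dvd_or_dvd (hJ ▸ hdvd hR hpR)).resolve_left
    (hne hR hP hPR.symm) |> hR.dvd_or_dvd).resolve_left (hne hR hQ hQR.symm)
  have hnorm := congrArg absNorm hJ
  rw [Ideal.absNorm_span_natCast, RingOfIntegers.rank, hK, map_mul, map_mul, map_mul] at hnorm
  have : p ^ 3 ∣ p ^ 2 := by
    rw [hnorm, show p ^ 3 = p * (p * (p * 1)) by ring]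
    exact mul_dvd_mul hpP (mul_dvd_mul hpQ (mul_dvd_mul hpR (one_dvd _)))
  exact absurd ((Nat.pow_dvd_pow_iff_le_right hp.one_lt).mp this) (by norm_num)

/-- The nonzero ideals of a quadratic field embed into pairs of positive integers whose product is
the norm. -/
lemma exists_injOn_absNorm_eq_mul (hK : Module.finrank ℚ K = 2) :
    ∃ ψ : Ideal (𝓞 K) → ℕ × ℕ, Set.InjOn ψ {I | I ≠ ⊥} ∧
      ∀ I ≠ ⊥, (ψ I).1 * (ψ I).2 = Ideal.absNorm I := by
  classical
  let N : Ideal (𝓞 K) → ℕ := fun I => Ideal.absNorm I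
  have hch : ∀ p : ℕ, ∃ P₀ : Ideal (𝓞 K), (∃ P : Ideal (𝓞 K), Prime P ∧ p ∣ N P) →
      Prime P₀ ∧ p ∣ N P₀ := by
    intro p
    by_cases h : ∃ P : Ideal (𝓞 K), Prime P ∧ p ∣ N P
    · obtain ⟨P, hP⟩ := h
      exact ⟨P, fun _ => hP⟩
    · exact ⟨⊥, fun h' => absurd h' h⟩
  choose ch hch using hch
  let sel : Ideal (𝓞 K) → Prop := fun P => P = ch (N P).minFac
  let ψ : Ideal (𝓞 K) → ℕ × ℕ := fun I =>
    ((((normalizedFactors I).filter sel).map N).prod,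
      (((normalizedFactors I).filter fun P => ¬ sel P).map N).prod)
  have hprime {P : Ideal (𝓞 K)} (hP : Prime P) : N P ≠ 1 := fun h =>
    hP.not_isUnit (Ideal.isUnit_iff.mpr (Ideal.absNorm_eq_one_iff.mp h))
  have hprime0 {P : Ideal (𝓞 K)} (hP : Prime P) : N P ≠ 0 := fun h =>
    hP.ne_zero (Ideal.absNorm_eq_zero_iff.mp h)
  refine ⟨ψ, fun I hI J hJ hIJ => ?_, fun I hI => ?_⟩
  · have h₁ := Multiset.eq_of_prod_map_eq (S := {P : Ideal (𝓞 K) | Prime P ∧ sel P})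
      (fun P hP => hprime hP.1) (fun P hP => hprime0 hP.1)
      (fun P hP Q hQ p hp hpP hpQ => by
        rw [hP.2, hQ.2, ← (Ideal.eq_minFac_and_mem_of_dvd_absNorm hP.1 hp hpP).1,
          ← (Ideal.eq_minFac_and_mem_of_dvd_absNorm hQ.1 hp hpQ).1])
      (s := (normalizedFactors I).filter sel) (t := (normalizedFactors J).filter sel)
      (fun P hP => ⟨prime_of_normalized_factor P (Multiset.mem_of_mem_filter hP),
        Multiset.of_mem_filter hP⟩)
      (fun P hP => ⟨prime_of_normalized_factor P (Multiset.mem_of_mem_filter hP),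
        Multiset.of_mem_filter hP⟩) (congrArg Prod.fst hIJ)
    have h₂ := Multiset.eq_of_prod_map_eq (S := {P : Ideal (𝓞 K) | Prime P ∧ ¬ sel P})
      (fun P hP => hprime hP.1) (fun P hP => hprime0 hP.1)
      (fun P hP Q hQ p hp hpP hpQ => by
        obtain ⟨h, h'⟩ := hch p ⟨P, hP.1, hpP⟩
        refine Ideal.eq_of_dvd_absNorm_of_finrank_eq_two hK hP.1 hQ.1 h hp hpP hpQ h' ?_ ?_
        · rw [(Ideal.eq_minFac_and_mem_of_dvd_absNorm hP.1 hp hpP).1]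
          exact hP.2
        · rw [(Ideal.eq_minFac_and_mem_of_dvd_absNorm hQ.1 hp hpQ).1]
          exact hQ.2)
      (s := (normalizedFactors I).filter fun P => ¬ sel P)
      (t := (normalizedFactors J).filter fun P => ¬ sel P)
      (fun P hP => ⟨prime_of_normalized_factor P (Multiset.mem_of_mem_filter hP),
        (Multiset.mem_filter.mp hP).2⟩)
      (fun P hP => ⟨prime_of_normalized_factor P (Multiset.mem_of_mem_filter hP),
        (Multiset.mem_filter.mp hP).2⟩) (congrArg Prod.snd hIJ)
    rw [← Ideal.prod_normalizedFactors_eq_self hI, ← Ideal.prod_normalizedFactors_eq_self hJ,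
      ← Multiset.filter_add_not sel (normalizedFactors I), h₁, h₂, Multiset.filter_add_not]
  · change (((normalizedFactors I).filter sel).map N).prod * _ = _
    rw [← Multiset.prod_add, ← Multiset.map_add, Multiset.filter_add_not]
    conv_rhs => rw [← Ideal.prod_normalizedFactors_eq_self hI]
    rw [map_multiset_prod]

open scoped nonZeroDivisors in
lemma classNumber_le_sum_div (hK : Module.finrank ℚ K = 2) {n : ℕ}
    (h : ∀ C : ClassGroup (𝓞 K), ∃ I : (Ideal (𝓞 K))⁰, ClassGroup.mk0 I = C ∧
      Ideal.absNorm (I : Ideal (𝓞 K)) ≤ n) :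
    classNumber K ≤ ∑ x ∈ Finset.Icc 1 n, n / x := by
  obtain ⟨ψ, hψ, hmul⟩ := exists_injOn_absNorm_eq_mul hK
  choose I hI hIn using h
  have h0 (C) : (I C : Ideal (𝓞 K)) ≠ ⊥ := nonZeroDivisors.coe_ne_zero (I C)
  have hinj : Function.Injective fun C => ψ (I C) := fun C C' hCC' => by
    rw [← hI C, ← hI C', Subtype.ext (hψ (h0 C) (h0 C') hCC')]
  have hcard : ∑ x ∈ Finset.Icc 1 n, n / x =
      ((Finset.Icc 1 n).sigma fun x => Finset.Icc 1 (n / x)).card := by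
    simp
  rw [hcard, classNumber, ← Finset.card_univ]
  refine Finset.card_le_card_of_injOn (fun C => ⟨(ψ (I C)).1, (ψ (I C)).2⟩) ?_ ?_
  · intro C _
    have hm := hmul _ (h0 C)
    have hpos : Ideal.absNorm (I C : Ideal (𝓞 K)) ≠ 0 := fun h =>
      h0 C (Ideal.absNorm_eq_zero_iff.mp h)
    have hx : 0 < (ψ (I C)).1 := Nat.pos_of_ne_zero fun h => hpos (by rw [← hm, h, zero_mul])
    have hy : 0 < (ψ (I C)).2 := Nat.pos_of_ne_zero fun h => hpos (by rw [← hm, h, mul_zero])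
    have hle := hm.le.trans (hIn C)
    simp only [Finset.coe_sigma, Set.mem_sigma_iff, Finset.coe_Icc, Set.mem_Icc]
    exact ⟨⟨hx, (Nat.le_mul_of_pos_right _ hy).trans hle⟩, hy,
      (Nat.le_div_iff_mul_le hx).mpr (by rwa [mul_comm])⟩
  · intro C _ C' _ hCC'
    simp only [Sigma.mk.injEq, heq_eq_eq] at hCC'
    exact hinj (Prod.ext hCC'.1 hCC'.2)

end IdealCount

lemma sum_Icc_div_le (n : ℕ) :
    ((∑ x ∈ Finset.Icc 1 n, n / x : ℕ) : ℝ) ≤ n * (1 + Real.log n) := by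
  refine le_trans ?_ (mul_le_mul_of_nonneg_left (harmonic_le_one_add_log n) n.cast_nonneg)
  rw [harmonic_eq_sum_Icc]
  push_cast
  rw [Finset.mul_sum]
  refine Finset.sum_le_sum fun x _ => ?_
  rw [← div_eq_mul_inv]
  exact Nat.cast_div_le

end ClassNumberBound

section ImaginaryQuadratic

open NumberField Polynomial

/-- The minimal polynomial of a square root of a negative integer. -/
theorem minpoly_rat_of_sq_eq_neg {K : Type*} [Field K] [CharZero K] {β : K} {m : ℕ} (hm : m ≠ 0)
    (hβ : β ^ 2 = -(m : K)) : minpoly ℚ β = X ^ 2 - C (-(m : ℚ)) := by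
  have hirr : Irreducible (X ^ 2 - C (-(m : ℚ))) := by
    refine X_pow_sub_C_irreducible_of_prime Nat.prime_two fun b hb => ?_
    have : (0 : ℚ) < m := by exact_mod_cast Nat.pos_of_ne_zero hm
    nlinarith [sq_nonneg b]
  refine (minpoly.eq_of_irreducible_of_monic hirr ?_ (monic_X_pow_sub_C _ two_ne_zero)).symm
  simp [hβ]

theorem finrank_eq_two_of_sq_eq_neg {K : Type*} [Field K] [NumberField K] {β : K} {m : ℕ}
    (hm : m ≠ 0) (hβ : β ^ 2 = -(m : K)) (hadj : Algebra.adjoin ℚ {β} = ⊤) :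
    Module.finrank ℚ K = 2 := by
  have h := (Field.primitive_element_iff_minpoly_natDegree_eq ℚ β).1
    (IntermediateField.adjoin_eq_top_of_algebra _ _ hadj)
  rw [← h, minpoly_rat_of_sq_eq_neg hm hβ, natDegree_X_pow_sub_C]

/-- The discriminant of `ℚ(√-m)` is at most `4 m` in absolute value. -/
theorem natAbs_discr_le_of_sq_eq_neg {K : Type*} [Field K] [NumberField K] {β : K} {m : ℕ}
    (hm : m ≠ 0) (hβ : β ^ 2 = -(m : K)) (hadj : Algebra.adjoin ℚ {β} = ⊤) :
    (discr K).natAbs ≤ 4 * m := by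
  have hβint : IsIntegral ℤ β := by
    refine IsIntegral.of_pow two_pos ?_
    rw [hβ]
    simpa using (isIntegral_algebraMap (R := ℤ) (A := K) (x := (m : ℤ))).neg
  obtain ⟨x, rfl⟩ : ∃ x : 𝓞 K, algebraMap (𝓞 K) K x = β := ⟨⟨β, hβint⟩, rfl⟩
  have hx : x ^ 2 = -(m : 𝓞 K) := by
    apply FaithfulSMul.algebraMap_injective (𝓞 K) K
    simpa using hβ
  have hmin : minpoly ℤ x = X ^ 2 - C (-(m : ℤ)) := by
    have h := minpoly.isIntegrallyClosed_eq_field_fractions ℚ K (RingOfIntegers.isIntegral x)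
    rw [minpoly_rat_of_sq_eq_neg hm hβ] at h
    apply map_injective (algebraMap ℤ ℚ) (FaithfulSMul.algebraMap_injective ℤ ℚ)
    rw [← h]
    simp
  have hmem := aeval_derivative_mem_differentIdeal ℤ ℚ K x hadj
  have hder : aeval x (derivative (minpoly ℤ x)) = 2 * x := by
    rw [hmin, derivative_sub, derivative_X_pow, derivative_C, sub_zero]
    simp only [map_mul, aeval_C, map_pow, aeval_X]
    simp
  rw [hder] at hmem
  have hdvd := Ideal.absNorm_dvd_norm_of_mem hmem
  rw [absNorm_differentIdeal K (𝓞 K)] at hdvd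
  have hfin : Module.finrank ℤ (𝓞 K) = 2 := by
    rw [RingOfIntegers.rank, finrank_eq_two_of_sq_eq_neg hm hβ hadj]
  have hnorm : (Algebra.norm ℤ (2 * x)) ^ 2 = (4 * m : ℤ) ^ 2 := by
    have : (2 * x) ^ 2 = algebraMap ℤ (𝓞 K) (-(4 * m)) := by
      rw [mul_pow, hx, map_neg, map_mul, map_natCast, map_ofNat]
      ring
    rw [← map_pow, this, Algebra.norm_algebraMap_of_basis (RingOfIntegers.basis K),
      ← Module.finrank_eq_card_chooseBasisIndex, hfin, neg_sq]
  have habs : (Algebra.norm ℤ (2 * x)).natAbs = 4 * m := by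
    have := Int.natAbs_eq_iff_sq_eq.2 hnorm
    omega
  refine Nat.le_of_dvd (by omega) ?_
  rw [← habs]
  exact Int.natCast_dvd.1 hdvd

/-- The Minkowski bound for `ℚ(√-m)`. -/
theorem exists_mk0_eq_absNorm_le_of_sq_eq_neg {K : Type*} [Field K] [NumberField K] {β : K}
    {m : ℕ} (hm : m ≠ 0) (hβ : β ^ 2 = -(m : K)) (hadj : Algebra.adjoin ℚ {β} = ⊤)
    (c : ClassGroup (𝓞 K)) :
    ∃ I : nonZeroDivisors (Ideal (𝓞 K)), ClassGroup.mk0 I = c ∧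
      (Ideal.absNorm (I : Ideal (𝓞 K)) : ℝ) ≤ 2 * √m := by
  obtain ⟨I, hI, hle⟩ := exists_ideal_in_class_of_norm_le c
  refine ⟨I, hI, hle.trans ?_⟩
  have hfin := finrank_eq_two_of_sq_eq_neg hm hβ hadj
  have hcard := InfinitePlace.card_add_two_mul_card_eq_rank K
  have hdisc : |(discr K : ℝ)| ≤ 2 ^ 2 * m := by
    rw [← Int.cast_abs, ← Nat.cast_natAbs]
    exact_mod_cast natAbs_discr_le_of_sq_eq_neg hm hβ hadj
  have hsqrt : √|(discr K : ℝ)| ≤ 2 * √m := by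
    refine (Real.sqrt_le_sqrt hdisc).trans_eq ?_
    rw [Real.sqrt_mul (by positivity), Real.sqrt_sq (by norm_num)]
  have hpow : (4 / Real.pi) ^ InfinitePlace.nrComplexPlaces K ≤ 2 := by
    have h1 : 1 ≤ 4 / Real.pi := by
      rw [le_div_iff₀ Real.pi_pos]
      linarith [Real.pi_le_four]
    have h2 : 4 / Real.pi ≤ 2 := by
      rw [div_le_iff₀ Real.pi_pos]
      linarith [Real.pi_gt_three]
    refine (pow_le_pow_right₀ h1 (show _ ≤ 1 by omega)).trans (by simpa using h2)
  rw [hfin]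
  calc _ ≤ 2 * (((2 : ℕ).factorial : ℝ) / (2 : ℕ) ^ 2 * (2 * √m)) := by
        gcongr
    _ = 2 * √m := by
        norm_num
        ring

theorem notDvdClassNumberSqrtNeg_of_sq_dvd {p N a : ℕ} (ha : a ^ 2 ∣ N) (hN : N ≠ 0)
    (hp : p ≠ 0)
    (hNp : N ≤ 4 * p ^ 2) (hlog : 4 * (1 + Real.log (4 * p)) < a) :
    NotDvdClassNumberSqrtNeg p N := by
  intro K _ _ α hα hadj hdvd
  obtain ⟨m, rfl⟩ := ha
  have ha0 : a ≠ 0 := by rintro rfl; simp at hN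
  have hm : m ≠ 0 := by rintro rfl; simp at hN
  have haK : (a : K) ≠ 0 := by exact_mod_cast ha0
  have hβ : (α / a) ^ 2 = -(m : K) := by
    rw [div_pow, hα]
    field_simp
    push_cast
    ring
  have hadj' : Algebra.adjoin ℚ {α / (a : K)} = ⊤ := by
    rw [eq_top_iff, ← hadj]
    refine Algebra.adjoin_le (Set.singleton_subset_iff.2 ?_)
    simpa [mul_div_cancel₀ α haK] using
      mul_mem (natCast_mem (Algebra.adjoin ℚ {α / (a : K)}) a)
        (Algebra.self_mem_adjoin_singleton ℚ (α / (a : K)))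
  have ha1 : (1 : ℝ) ≤ a := by exact_mod_cast Nat.one_le_iff_ne_zero.2 ha0
  have hp1 : (1 : ℝ) ≤ p := by exact_mod_cast Nat.one_le_iff_ne_zero.2 hp
  have hsqrt : 2 * √m ≤ 4 * p / a := by
    rw [le_div_iff₀ (by positivity)]
    have h : (a * √m) ^ 2 ≤ (2 * p : ℝ) ^ 2 := by
      rw [mul_pow, Real.sq_sqrt (by positivity), mul_pow]
      exact_mod_cast hNp
    have := (pow_le_pow_iff_left₀ (by positivity) (by positivity) two_ne_zero).1 h
    linarith
  set n := ⌊2 * √m⌋₊ with hn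
  have hcls : classNumber K ≤ ∑ x ∈ Finset.Icc 1 n, n / x := by
    refine classNumber_le_sum_div (finrank_eq_two_of_sq_eq_neg hm hβ hadj') fun c => ?_
    obtain ⟨I, hI, hle⟩ := exists_mk0_eq_absNorm_le_of_sq_eq_neg hm hβ hadj' c
    exact ⟨I, hI, Nat.le_floor hle⟩
  have hnle : (n : ℝ) ≤ 4 * p / a := (Nat.floor_le (by positivity)).trans hsqrt
  have hn4 : (n : ℝ) ≤ 4 * p := hnle.trans (div_le_self (by positivity) ha1)
  have hlogn : Real.log n ≤ Real.log (4 * p) := by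
    rcases Nat.eq_zero_or_pos n with h0 | h0
    · rw [h0]
      simpa using Real.log_nonneg (by linarith)
    · exact Real.log_le_log (by exact_mod_cast h0) hn4
  have hlt : (classNumber K : ℝ) < p := by
    have hlog0 : 0 ≤ Real.log (4 * p) := Real.log_nonneg (by linarith)
    calc (classNumber K : ℝ) ≤ ((∑ x ∈ Finset.Icc 1 n, n / x : ℕ) : ℝ) := by exact_mod_cast hcls
      _ ≤ n * (1 + Real.log n) := sum_Icc_div_le n
      _ ≤ 4 * p / a * (1 + Real.log (4 * p)) := by
          have : 0 ≤ Real.log n := Real.log_natCast_nonneg n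
          gcongr
      _ = p * (4 * (1 + Real.log (4 * p)) / a) := by ring
      _ < p * 1 := by
          gcongr
          rwa [div_lt_one (by positivity)]
      _ = p := mul_one _
  have hpos : 0 < classNumber K := by
    rw [classNumber]
    exact Fintype.card_pos
  exact absurd (Nat.le_of_dvd hpos hdvd) (by exact_mod_cast hlt.not_ge)

end ImaginaryQuadratic

/-- Some residue class coprime to `15` is `-2` modulo `9 ^ k` and `2` modulo `25 ^ k`. -/
theorem exists_coprime_fifteen_dvd_add_two_dvd_sub_two {k : ℕ} (hk : k ≠ 0) :
    ∃ r : ℤ, IsCoprime r 15 ∧ (9 : ℤ) ^ k ∣ r + 2 ∧ (25 : ℤ) ^ k ∣ r - 2 := by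
  have hcop : IsCoprime ((9 : ℤ) ^ k) (25 ^ k) :=
    IsCoprime.pow (by rw [Int.isCoprime_iff_gcd_eq_one]; decide)
  obtain ⟨u, v, huv⟩ := hcop
  have h9 : (9 : ℤ) ^ k ∣ 2 * (u * 9 ^ k - v * 25 ^ k) + 2 :=
    ⟨4 * u, by linear_combination -2 * huv⟩
  have h25 : (25 : ℤ) ^ k ∣ 2 * (u * 9 ^ k - v * 25 ^ k) - 2 :=
    ⟨-4 * v, by linear_combination 2 * huv⟩
  refine ⟨_, ?_, h9, h25⟩
  have h3 := (show (3 : ℤ) ∣ 9 by norm_num).trans ((dvd_pow_self 9 hk).trans h9)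
  have h5 := (show (5 : ℤ) ∣ 25 by norm_num).trans ((dvd_pow_self 25 hk).trans h25)
  have hc3 : IsCoprime (2 * (u * 9 ^ k - v * 25 ^ k)) 3 := by
    obtain ⟨c, hc⟩ := h3
    exact ⟨1, 1 - c, by linear_combination hc⟩
  have hc5 : IsCoprime (2 * (u * 9 ^ k - v * 25 ^ k)) 5 := by
    obtain ⟨c, hc⟩ := h5
    exact ⟨-2, 1 + 2 * c, by linear_combination -2 * hc⟩
  exact hc3.mul_right hc5

/-- There are primes `p` with `p + 2` divisible by `9 ^ k`, `p - 2` divisible by `25 ^ k`, and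
`log p` polynomially bounded in `k`. -/
theorem exists_prime_dvd_add_two_dvd_sub_two :
    ∃ C : ℝ, ∀ k : ℕ, k ≠ 0 → ∃ p : ℕ, p.Prime ∧ 9 ^ k ∣ p + 2 ∧ (25 : ℤ) ^ k ∣ (p : ℤ) - 2 ∧
      Real.log p ≤ C * k ^ 10 := by
  obtain ⟨C, hC⟩ := exists_prime_log_le
  refine ⟨C * 2 ^ 10, fun k hk => ?_⟩
  obtain ⟨r, hr, h9, h25⟩ := exists_coprime_fifteen_dvd_add_two_dvd_sub_two hk
  have hunit : IsUnit ((r : ℤ) : ZMod (15 ^ (2 * k))) := by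
    rw [ZMod.coe_int_isUnit_iff_isCoprime]
    push_cast
    exact (hr.pow_right).symm
  obtain ⟨p, hp, hpr, hlog⟩ := hC (2 * k) (by omega) _ hunit
  have hdvd : (9 : ℤ) ^ k * 25 ^ k ∣ (p : ℤ) - r := by
    have h := (ZMod.intCast_eq_intCast_iff_dvd_sub r p (15 ^ (2 * k))).1 (by simpa using hpr.symm)
    rw [← mul_pow]
    rw [pow_mul] at h
    exact_mod_cast h
  refine ⟨p, hp, ?_, ?_, ?_⟩
  · have := dvd_add ((Dvd.intro _ rfl).trans hdvd) h9
    rw [← add_assoc, sub_add_cancel] at this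
    exact_mod_cast this
  · have := dvd_add ((Dvd.intro_left _ rfl).trans hdvd) h25
    rwa [sub_add_sub_cancel] at this
  · refine hlog.trans_eq ?_
    push_cast
    ring

theorem eventually_polynomial_lt_three_pow (C : ℝ) :
    ∀ᶠ k : ℕ in Filter.atTop, 4 * (1 + Real.log 4 + C * k ^ 10) < 3 ^ k := by
  have h10 := tendsto_pow_const_div_const_pow_of_one_lt 10 (show (1 : ℝ) < 3 by norm_num)
  have h0 := tendsto_pow_const_div_const_pow_of_one_lt 0 (show (1 : ℝ) < 3 by norm_num)
  have h := (h0.const_mul (4 * (1 + Real.log 4))).add (h10.const_mul (4 * C))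
  rw [mul_zero, mul_zero, add_zero] at h
  filter_upwards [h.eventually_lt_const zero_lt_one] with k hk
  have h3 : (0 : ℝ) < 3 ^ k := by positivity
  rw [mul_div_assoc', mul_div_assoc', ← add_div, div_lt_one h3] at hk
  linarith

/-- There are infinitely many primes `p ≥ 5` such that `p` divides none of the class numbers
of `ℚ(√(-p(p+2)))`, `ℚ(√(-p(p-2)))` and `ℚ(√(-(p+2)(p-2)))`. -/
theorem infinitely_many_primes_not_dividing_class_numbers :
    {p : ℕ | p.Prime ∧ 5 ≤ p ∧ NotDvdClassNumberSqrtNeg p (p * (p + 2)) ∧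
      NotDvdClassNumberSqrtNeg p (p * (p - 2)) ∧
      NotDvdClassNumberSqrtNeg p ((p + 2) * (p - 2))}.Infinite := by
  obtain ⟨C, hC⟩ := exists_prime_dvd_add_two_dvd_sub_two
  refine Set.infinite_of_forall_exists_gt fun n => ?_
  obtain ⟨k, hk, hkn⟩ :=
    ((eventually_polynomial_lt_three_pow C).and (Filter.eventually_ge_atTop (n + 7))).exists
  obtain ⟨p, hp, h9, h25, hlog⟩ := hC k (by omega)
  have hpk : k < p + 2 := (Nat.lt_pow_self (by norm_num)).trans_le (Nat.le_of_dvd (by omega) h9)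
  have h25' : 25 ^ k ∣ p - 2 := by
    zify [show 2 ≤ p by omega]
    exact h25
  have hp0 : (0 : ℝ) < p := by exact_mod_cast hp.pos
  have h3 : 4 * (1 + Real.log (4 * p)) < (3 ^ k : ℕ) := by
    rw [Real.log_mul (by norm_num) hp0.ne']
    push_cast
    linarith
  have h5 : 4 * (1 + Real.log (4 * p)) < (5 ^ k : ℕ) := by
    refine h3.trans_le ?_
    gcongr
    norm_num
  have hsq3 : (3 ^ k) ^ 2 ∣ p + 2 := by
    rwa [← pow_mul, mul_comm, pow_mul]
  have hsq5 : (5 ^ k) ^ 2 ∣ p - 2 := by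
    rwa [← pow_mul, mul_comm, pow_mul]
  have hsub : p - 2 ≤ p := Nat.sub_le _ _
  have hsub0 : p - 2 ≠ 0 := by omega
  refine ⟨p, ⟨hp, by omega, ?_, ?_, ?_⟩, by omega⟩
  · exact notDvdClassNumberSqrtNeg_of_sq_dvd (hsq3.mul_left p)
      (mul_ne_zero hp.ne_zero (by omega)) hp.ne_zero
      (by nlinarith) h3
  · exact notDvdClassNumberSqrtNeg_of_sq_dvd (hsq5.mul_left p) (mul_ne_zero hp.ne_zero hsub0)
      hp.ne_zero (by nlinarith) h5
  · exact notDvdClassNumberSqrtNeg_of_sq_dvd (hsq3.mul_right _) (mul_ne_zero (by omega) hsub0)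
      hp.ne_zero (by nlinarith) h3
end

section
/- Let ε and α be real numbers with 0 < ε < α. Then for every real c with c < (2 − ζ(2))/4 there exists x₀ such that for all x ≥ x₀, the sum Σ 1/(m²n²), taken over all pairs of odd coprime positive integers m, n satisfying x^ε < m < x^α and x^ε < n < x^α, is at least c·x^{−2ε}. -/
open scoped Classical

/-- Telescoping upper bound for the sum of inverse squares of odd integers `≥ 2J + 1`. -/
lemma sum_Ico_inv_sq_odd_le (J M : ℕ) (hJ : 1 ≤ J) (hJM : J ≤ M) :
    ∑ j ∈ Finset.Ico J M, 1 / ((2 * j + 1 : ℕ) : ℝ) ^ 2 ≤ 1 / (4 * J) - 1 / (4 * (M : ℝ)) := by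
  induction M, hJM using Nat.le_induction with
  | base => simp
  | succ M hM ih =>
    rw [Finset.sum_Ico_succ_top hM]
    have hMpos : (0 : ℝ) < M := by exact_mod_cast (by omega : 0 < M)
    have key : 1 / ((2 * M + 1 : ℕ) : ℝ) ^ 2 ≤ 1 / (4 * (M : ℝ)) - 1 / (4 * ((M + 1 : ℕ) : ℝ)) := by
      push_cast
      rw [div_sub_div _ _ (by positivity) (by positivity), div_le_div_iff₀ (by positivity)
        (by positivity)]
      nlinarith
    linarith

/-- Telescoping lower bound for the sum of inverse squares of consecutive odd integers. -/
lemma le_sum_Ico_inv_sq_odd (a b : ℕ) :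
    (1 / (2 * a + 1 : ℝ) - 1 / (2 * b + 1)) / 2 ≤
      ∑ j ∈ Finset.Ico a b, 1 / ((2 * j + 1 : ℕ) : ℝ) ^ 2 := by
  rcases le_total a b with hab | hab
  · induction b, hab using Nat.le_induction with
    | base => simp
    | succ b hb ih =>
      rw [Finset.sum_Ico_succ_top hb]
      have key : (1 / (2 * b + 1 : ℝ) - 1 / (2 * ((b + 1 : ℕ) : ℝ) + 1)) / 2 ≤
          1 / ((2 * b + 1 : ℕ) : ℝ) ^ 2 := by
        push_cast
        rw [div_sub_div _ _ (by positivity) (by positivity), div_div,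
          div_le_div_iff₀ (by positivity) (by positivity)]
        have : (0 : ℝ) ≤ b := by positivity
        nlinarith [mul_nonneg this this]
      linarith
  · rw [Finset.Ico_eq_empty_of_le hab, Finset.sum_empty]
    have : 1 / (2 * a + 1 : ℝ) ≤ 1 / (2 * b + 1) := by gcongr
    linarith

lemma sum_inv_sq_le_of_odd_of_le (S : Finset ℕ) (J : ℕ) (hJ : 1 ≤ J)
    (hodd : ∀ k ∈ S, Odd k) (hle : ∀ k ∈ S, 2 * J + 1 ≤ k) :
    ∑ k ∈ S, 1 / (k : ℝ) ^ 2 ≤ 1 / (4 * (J : ℝ)) := by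
  obtain ⟨B, hB⟩ : ∃ B, ∀ k ∈ S, k ≤ B := S.exists_le
  obtain ⟨M, hJM, hBM⟩ : ∃ M, J ≤ M ∧ B ≤ M := ⟨max J B, le_max_left _ _, le_max_right _ _⟩
  have hsub : S ⊆ (Finset.Ico J M).image (fun j => 2 * j + 1) := by
    intro k hk
    obtain ⟨j, rfl⟩ := hodd k hk
    have h1 := hle _ hk
    have h2 := hB _ hk
    exact Finset.mem_image.2 ⟨j, Finset.mem_Ico.2 ⟨by omega, by omega⟩, rfl⟩
  calc ∑ k ∈ S, 1 / (k : ℝ) ^ 2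
      ≤ ∑ k ∈ (Finset.Ico J M).image (fun j : ℕ => (2 * j + 1 : ℕ)), 1 / (k : ℝ) ^ 2 :=
        Finset.sum_le_sum_of_subset_of_nonneg hsub fun _ _ _ => by positivity
    _ = ∑ j ∈ Finset.Ico J M, 1 / ((2 * j + 1 : ℕ) : ℝ) ^ 2 :=
        Finset.sum_image fun a _ b _ h => by simpa using h
    _ ≤ 1 / (4 * J) - 1 / (4 * (M : ℝ)) := sum_Ico_inv_sq_odd_le J M hJ hJM
    _ ≤ 1 / (4 * (J : ℝ)) := sub_le_self _ (by positivity)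

lemma sum_inv_sq_le_of_odd_of_lt (S : Finset ℕ) (T : ℝ) (hT : 1 ≤ T)
    (hodd : ∀ k ∈ S, Odd k) (hlt : ∀ k ∈ S, T < k) :
    ∑ k ∈ S, 1 / (k : ℝ) ^ 2 ≤ 3 / (4 * T) := by
  set J := ⌊(T + 1) / 2⌋₊
  have hJ1 : 1 ≤ J := Nat.le_floor (by push_cast; linarith)
  have hJle : (J : ℝ) ≤ (T + 1) / 2 := Nat.floor_le (by linarith)
  have hJlt : (T + 1) / 2 < J + 1 := Nat.lt_floor_add_one _
  have hJ1' : (1 : ℝ) ≤ J := by exact_mod_cast hJ1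
  refine (sum_inv_sq_le_of_odd_of_le S J hJ1 hodd fun k hk => ?_).trans ?_
  · obtain ⟨j, rfl⟩ := hodd k hk
    have h := hlt _ hk
    push_cast at h
    have : (J : ℝ) < j + 1 := by linarith
    have : J < j + 1 := by exact_mod_cast this
    omega
  · rw [div_le_div_iff₀ (by positivity) (by positivity)]
    linarith

lemma sum_inv_sq_le_of_odd (S : Finset ℕ) (hodd : ∀ k ∈ S, Odd k) :
    ∑ k ∈ S, 1 / (k : ℝ) ^ 2 ≤ 5 / 4 := by
  have h1 : ∑ k ∈ S.erase 1, 1 / (k : ℝ) ^ 2 ≤ 1 / (4 * ((1 : ℕ) : ℝ)) :=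
    sum_inv_sq_le_of_odd_of_le _ 1 le_rfl (fun k hk => hodd k (Finset.mem_of_mem_erase hk))
      fun k hk => by
        obtain ⟨j, rfl⟩ := hodd k (Finset.mem_of_mem_erase hk)
        have := Finset.ne_of_mem_erase hk
        omega
  have h2 : ∑ k ∈ S, 1 / (k : ℝ) ^ 2 ≤ ∑ k ∈ insert 1 (S.erase 1), 1 / (k : ℝ) ^ 2 :=
    Finset.sum_le_sum_of_subset_of_nonneg (Finset.insert_erase_subset 1 S)
      fun _ _ _ => by positivity
  rw [Finset.sum_insert (Finset.notMem_erase 1 S)] at h2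
  norm_num at h1 h2 ⊢
  linarith

/-- The weight `1/m²` restricted to odd `m` with `X < m < Y`. -/
noncomputable def oddWeight (X Y : ℝ) (m : ℕ) : ℝ :=
  if Odd m ∧ X < m ∧ (m : ℝ) < Y then 1 / (m : ℝ) ^ 2 else 0

/-- The weight `oddWeight X Y` restricted to multiples of `d`. -/
noncomputable def oddWeightDvd (X Y : ℝ) (d m : ℕ) : ℝ :=
  if d ∣ m then oddWeight X Y m else 0

lemma oddWeight_nonneg (X Y : ℝ) (m : ℕ) : 0 ≤ oddWeight X Y m := by
  unfold oddWeight; split_ifs <;> positivity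

lemma oddWeightDvd_nonneg (X Y : ℝ) (d m : ℕ) : 0 ≤ oddWeightDvd X Y d m := by
  unfold oddWeightDvd; split_ifs
  exacts [oddWeight_nonneg X Y m, le_rfl]

/-- The sum over odd multiples of `d` is `1/d²` times a sum over odd cofactors. -/
lemma exists_sum_oddWeightDvd_eq (X Y : ℝ) (N d : ℕ) (hd : 0 < d) :
    ∃ S : Finset ℕ, (∀ k ∈ S, Odd k ∧ X / d < k) ∧
      ∑ m ∈ Finset.range N, oddWeightDvd X Y d m =
        1 / (d : ℝ) ^ 2 * ∑ k ∈ S, 1 / (k : ℝ) ^ 2 := by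
  set A := (Finset.range N).filter fun m => d ∣ m ∧ Odd m ∧ X < m ∧ (m : ℝ) < Y with hA
  have hdR : (0 : ℝ) < d := by exact_mod_cast hd
  refine ⟨A.image (· / d), fun k hk => ?_, ?_⟩
  · obtain ⟨m, hm, rfl⟩ := Finset.mem_image.1 hk
    obtain ⟨-, ⟨k, rfl⟩, hodd, hX, -⟩ := Finset.mem_filter.1 hm
    rw [Nat.mul_div_cancel_left k hd]
    refine ⟨(Nat.odd_mul.1 hodd).2, ?_⟩
    rw [div_lt_iff₀ hdR]
    push_cast at hX
    linarith
  · have hinj : Set.InjOn (· / d) (A : Set ℕ) := by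
      intro a ha b hb hab
      obtain ⟨-, ⟨a, rfl⟩, -⟩ := Finset.mem_filter.1 (Finset.mem_coe.1 ha)
      obtain ⟨-, ⟨b, rfl⟩, -⟩ := Finset.mem_filter.1 (Finset.mem_coe.1 hb)
      simp only [Nat.mul_div_cancel_left _ hd] at hab
      rw [hab]
    rw [Finset.sum_image hinj, Finset.mul_sum]
    have : ∑ m ∈ Finset.range N, oddWeightDvd X Y d m = ∑ m ∈ A, 1 / (m : ℝ) ^ 2 := by
      rw [hA, Finset.sum_filter]
      refine Finset.sum_congr rfl fun m _ => ?_
      unfold oddWeightDvd oddWeight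
      simp only [ite_and]
    rw [this]
    refine Finset.sum_congr rfl fun m hm => ?_
    obtain ⟨-, ⟨k, rfl⟩, -⟩ := Finset.mem_filter.1 hm
    rw [Nat.mul_div_cancel_left k hd, Nat.cast_mul, mul_pow, one_div_mul_one_div]

lemma sum_oddWeightDvd_le_of_le (X Y : ℝ) (N d : ℕ) (hd : 0 < d) (hdX : (d : ℝ) ≤ X) :
    ∑ m ∈ Finset.range N, oddWeightDvd X Y d m ≤ 3 / (4 * X) * (1 / d) := by
  obtain ⟨S, hS, h⟩ := exists_sum_oddWeightDvd_eq X Y N d hd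
  have hdR : (0 : ℝ) < d := by exact_mod_cast hd
  have hX : 0 < X := hdR.trans_le hdX
  have hle := sum_inv_sq_le_of_odd_of_lt S (X / d) ((one_le_div hdR).2 hdX)
    (fun k hk => (hS k hk).1) (fun k hk => (hS k hk).2)
  rw [h]
  calc 1 / (d : ℝ) ^ 2 * ∑ k ∈ S, 1 / (k : ℝ) ^ 2
      ≤ 1 / (d : ℝ) ^ 2 * (3 / (4 * (X / d))) := by gcongr
    _ = 3 / (4 * X) * (1 / d) := by field_simp

lemma sum_oddWeightDvd_le (X Y : ℝ) (N d : ℕ) (hd : 0 < d) :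
    ∑ m ∈ Finset.range N, oddWeightDvd X Y d m ≤ 1 / (d : ℝ) ^ 2 * (5 / 4) := by
  obtain ⟨S, hS, h⟩ := exists_sum_oddWeightDvd_eq X Y N d hd
  have hle := sum_inv_sq_le_of_odd S fun k hk => (hS k hk).1
  rw [h]
  gcongr

/-- The contribution of pairs having a common odd divisor `d ≥ 3`. -/
lemma sum_sq_sum_oddWeightDvd_le (X Y : ℝ) (N : ℕ) (hX : 1 ≤ X) :
    ∑ d ∈ (Finset.range N).filter (fun d => Odd d ∧ 3 ≤ d),
      (∑ m ∈ Finset.range N, oddWeightDvd X Y d m) ^ 2 ≤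
        (9 / 64 + 75 / 64 * (1 / X)) / X ^ 2 := by
  set D := (Finset.range N).filter (fun d => Odd d ∧ 3 ≤ d)
  have hX0 : 0 < X := by linarith
  have hmem : ∀ d ∈ D, Odd d ∧ 3 ≤ d := fun d hd => (Finset.mem_filter.1 hd).2
  have hnn : ∀ d, 0 ≤ ∑ m ∈ Finset.range N, oddWeightDvd X Y d m := fun d =>
    Finset.sum_nonneg fun m _ => oddWeightDvd_nonneg X Y d m
  rw [← Finset.sum_filter_add_sum_filter_not D (fun d : ℕ => (d : ℝ) ≤ X)]
  have hsmall : ∑ d ∈ D.filter (fun d : ℕ => (d : ℝ) ≤ X),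
      (∑ m ∈ Finset.range N, oddWeightDvd X Y d m) ^ 2 ≤ 9 / 16 / X ^ 2 * (1 / 4) := by
    have h := sum_inv_sq_le_of_odd_of_le (D.filter (fun d : ℕ => (d : ℝ) ≤ X)) 1 le_rfl
      (fun k hk => (hmem k (Finset.mem_filter.1 hk).1).1)
      (fun k hk => (hmem k (Finset.mem_filter.1 hk).1).2)
    rw [Nat.cast_one, mul_one] at h
    calc _ ≤ ∑ d ∈ D.filter (fun d : ℕ => (d : ℝ) ≤ X), 9 / 16 / X ^ 2 * (1 / (d : ℝ) ^ 2) := by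
          refine Finset.sum_le_sum fun d hd => ?_
          obtain ⟨hdD, hdX⟩ := Finset.mem_filter.1 hd
          have hd0 : 0 < d := by have := (hmem d hdD).2; omega
          calc _ ≤ (3 / (4 * X) * (1 / d)) ^ 2 :=
                pow_le_pow_left₀ (hnn d) (sum_oddWeightDvd_le_of_le X Y N d hd0 hdX) 2
            _ = _ := by ring
      _ ≤ _ := by
          rw [← Finset.mul_sum]
          gcongr
  have hlarge : ∑ d ∈ D.filter (fun d : ℕ => ¬ (d : ℝ) ≤ X),
      (∑ m ∈ Finset.range N, oddWeightDvd X Y d m) ^ 2 ≤ 25 / 16 / X ^ 2 * (3 / (4 * X)) := by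
    have h := sum_inv_sq_le_of_odd_of_lt (D.filter (fun d : ℕ => ¬ (d : ℝ) ≤ X)) X hX
      (fun k hk => (hmem k (Finset.mem_filter.1 hk).1).1)
      (fun k hk => not_le.1 (Finset.mem_filter.1 hk).2)
    calc _ ≤ ∑ d ∈ D.filter (fun d : ℕ => ¬ (d : ℝ) ≤ X),
            25 / 16 / X ^ 2 * (1 / (d : ℝ) ^ 2) := by
          refine Finset.sum_le_sum fun d hd => ?_
          obtain ⟨hdD, hdX⟩ := Finset.mem_filter.1 hd
          rw [not_le] at hdX
          have hd0 : 0 < d := by have := (hmem d hdD).2; omega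
          calc _ ≤ (1 / (d : ℝ) ^ 2 * (5 / 4)) ^ 2 :=
                pow_le_pow_left₀ (hnn d) (sum_oddWeightDvd_le X Y N d hd0) 2
            _ = 25 / 16 / (d : ℝ) ^ 2 * (1 / (d : ℝ) ^ 2) := by ring
            _ ≤ _ := by gcongr
      _ ≤ _ := by
          rw [← Finset.mul_sum]
          gcongr
  refine (add_le_add hsmall hlarge).trans (le_of_eq ?_)
  field_simp
  ring

lemma le_sum_oddWeight (X Y : ℝ) (hX : 1 ≤ X) (hY : 1 ≤ Y) :
    (1 / (X + 2) - 1 / Y) / 2 ≤ ∑ m ∈ Finset.range ⌈Y⌉₊, oddWeight X Y m := by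
  set a := ⌊(X + 1) / 2⌋₊
  set b := ⌈(Y - 1) / 2⌉₊
  have ha : (a : ℝ) ≤ (X + 1) / 2 := Nat.floor_le (by linarith)
  have ha' : (X + 1) / 2 < a + 1 := Nat.lt_floor_add_one _
  have hb : (Y - 1) / 2 ≤ b := Nat.le_ceil _
  have h1 : 1 / (X + 2) ≤ 1 / (2 * a + 1 : ℝ) := by
    apply one_div_le_one_div_of_le (by positivity); linarith
  have h2 : 1 / (2 * b + 1 : ℝ) ≤ 1 / Y := by
    apply one_div_le_one_div_of_le (by positivity); linarith
  have hcond : ∀ j ∈ Finset.Ico a b,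
      Odd (2 * j + 1) ∧ X < ((2 * j + 1 : ℕ) : ℝ) ∧ ((2 * j + 1 : ℕ) : ℝ) < Y := by
    intro j hj
    obtain ⟨hj1, hj2⟩ := Finset.mem_Ico.1 hj
    have hj1' : (a : ℝ) ≤ j := by exact_mod_cast hj1
    have hj2' : (j : ℝ) < (Y - 1) / 2 := Nat.lt_ceil.1 hj2
    push_cast
    exact ⟨odd_two_mul_add_one j, by linarith, by linarith⟩
  calc (1 / (X + 2) - 1 / Y) / 2 ≤ (1 / (2 * a + 1 : ℝ) - 1 / (2 * b + 1)) / 2 := by linarith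
    _ ≤ ∑ j ∈ Finset.Ico a b, 1 / ((2 * j + 1 : ℕ) : ℝ) ^ 2 := le_sum_Ico_inv_sq_odd a b
    _ = ∑ j ∈ Finset.Ico a b, oddWeight X Y (2 * j + 1) :=
        Finset.sum_congr rfl fun j hj => by unfold oddWeight; rw [if_pos (hcond j hj)]
    _ = ∑ m ∈ (Finset.Ico a b).image (fun j => 2 * j + 1), oddWeight X Y m :=
        (Finset.sum_image fun a _ b _ h => by simpa using h).symm
    _ ≤ _ := by
        refine Finset.sum_le_sum_of_subset_of_nonneg (fun m hm => ?_)
          fun _ _ _ => oddWeight_nonneg X Y _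
        obtain ⟨j, hj, rfl⟩ := Finset.mem_image.1 hm
        exact Finset.mem_range.2 (Nat.lt_ceil.2 (hcond j hj).2.2)

/-- Union bound over the odd common divisors `d ≥ 3` of a pair that is not coprime. -/
lemma oddWeight_mul_sub_sum_le (X Y : ℝ) (N m n : ℕ) (hm : m ∈ Finset.range N) :
    oddWeight X Y m * oddWeight X Y n -
      ∑ d ∈ (Finset.range N).filter (fun d => Odd d ∧ 3 ≤ d),
        oddWeightDvd X Y d m * oddWeightDvd X Y d n ≤
      if 0 < m ∧ 0 < n ∧ Odd m ∧ Odd n ∧ Nat.Coprime m n ∧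
          X < m ∧ (m : ℝ) < Y ∧ X < n ∧ (n : ℝ) < Y
        then 1 / ((m : ℝ) ^ 2 * (n : ℝ) ^ 2) else 0 := by
  have hnn : ∀ d, 0 ≤ oddWeightDvd X Y d m * oddWeightDvd X Y d n := fun d =>
    mul_nonneg (oddWeightDvd_nonneg X Y d m) (oddWeightDvd_nonneg X Y d n)
  have hsum : 0 ≤ ∑ d ∈ (Finset.range N).filter (fun d => Odd d ∧ 3 ≤ d),
      oddWeightDvd X Y d m * oddWeightDvd X Y d n := Finset.sum_nonneg fun d _ => hnn d
  have hrhs : (0 : ℝ) ≤ if 0 < m ∧ 0 < n ∧ Odd m ∧ Odd n ∧ Nat.Coprime m n ∧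
      X < m ∧ (m : ℝ) < Y ∧ X < n ∧ (n : ℝ) < Y
        then 1 / ((m : ℝ) ^ 2 * (n : ℝ) ^ 2) else 0 := by split_ifs <;> positivity
  by_cases hPm : Odd m ∧ X < m ∧ (m : ℝ) < Y
  swap
  · have : oddWeight X Y m = 0 := if_neg hPm
    rw [this, zero_mul]; linarith
  by_cases hPn : Odd n ∧ X < n ∧ (n : ℝ) < Y
  swap
  · have : oddWeight X Y n = 0 := if_neg hPn
    rw [this, mul_zero]; linarith
  by_cases hco : Nat.Coprime m n
  · rw [if_pos ⟨hPm.1.pos, hPn.1.pos, hPm.1, hPn.1, hco, hPm.2.1, hPm.2.2, hPn.2.1, hPn.2.2⟩]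
    have h1 : oddWeight X Y m = 1 / (m : ℝ) ^ 2 := if_pos hPm
    have h2 : oddWeight X Y n = 1 / (n : ℝ) ^ 2 := if_pos hPn
    rw [← one_div_mul_one_div, ← h1, ← h2]
    linarith
  · have hg1 : Odd (Nat.gcd m n) := hPm.1.of_dvd_nat (Nat.gcd_dvd_left m n)
    have hmem : Nat.gcd m n ∈ (Finset.range N).filter (fun d => Odd d ∧ 3 ≤ d) := by
      refine Finset.mem_filter.2 ⟨Finset.mem_range.2 ?_, hg1, ?_⟩
      · exact (Nat.gcd_le_left n hPm.1.pos).trans_lt (Finset.mem_range.1 hm)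
      · have : Nat.gcd m n ≠ 1 := hco
        obtain ⟨k, hk⟩ := hg1
        omega
    have hle := Finset.single_le_sum (fun d _ => hnn d) hmem
    have h1 : oddWeightDvd X Y (Nat.gcd m n) m = oddWeight X Y m := if_pos (Nat.gcd_dvd_left m n)
    have h2 : oddWeightDvd X Y (Nat.gcd m n) n = oddWeight X Y n := if_pos (Nat.gcd_dvd_right m n)
    rw [h1, h2] at hle
    linarith

/-- An explicit lower bound for the sum over coprime odd pairs in `(X, Y)`. -/
lemma le_sum_coprime_odd_pairs (X Y : ℝ) (hX : 1 ≤ X) (hY : 1 ≤ Y)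
    (hXY : 0 ≤ 1 / (X + 2) - 1 / Y) :
    ((1 / (X + 2) - 1 / Y) / 2) ^ 2 - (9 / 64 + 75 / 64 * (1 / X)) / X ^ 2 ≤
      ∑ m ∈ Finset.range ⌈Y⌉₊, ∑ n ∈ Finset.range ⌈Y⌉₊,
        if 0 < m ∧ 0 < n ∧ Odd m ∧ Odd n ∧ Nat.Coprime m n ∧
            X < m ∧ (m : ℝ) < Y ∧ X < n ∧ (n : ℝ) < Y
          then 1 / ((m : ℝ) ^ 2 * (n : ℝ) ^ 2) else 0 := by
  set N := ⌈Y⌉₊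
  have h1 := sum_sq_sum_oddWeightDvd_le X Y N hX
  have h2 : ((1 / (X + 2) - 1 / Y) / 2) ^ 2 ≤ (∑ m ∈ Finset.range N, oddWeight X Y m) ^ 2 :=
    pow_le_pow_left₀ (by linarith) (le_sum_oddWeight X Y hX hY) 2
  calc _ ≤ (∑ m ∈ Finset.range N, oddWeight X Y m) ^ 2 -
        ∑ d ∈ (Finset.range N).filter (fun d => Odd d ∧ 3 ≤ d),
          (∑ m ∈ Finset.range N, oddWeightDvd X Y d m) ^ 2 := by linarith
    _ = ∑ m ∈ Finset.range N, ∑ n ∈ Finset.range N, (oddWeight X Y m * oddWeight X Y n -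
        ∑ d ∈ (Finset.range N).filter (fun d => Odd d ∧ 3 ≤ d),
          oddWeightDvd X Y d m * oddWeightDvd X Y d n) := by
        simp only [Finset.sum_sub_distrib]
        rw [sq, Finset.sum_mul_sum]
        congr 1
        simp_rw [sq, Finset.sum_mul_sum]
        rw [Finset.sum_comm]
        exact Finset.sum_congr rfl fun m _ => Finset.sum_comm
    _ ≤ _ := Finset.sum_le_sum fun m hm => Finset.sum_le_sum fun n _ =>
        oddWeight_mul_sub_sum_le X Y N m n hm

/-- For `0 < ε < α`, the sum `∑ 1/(m²n²)` over pairs of odd coprime positive integers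
`m, n` with `x^ε < m, n < x^α` is eventually at least `c·x^(-2ε)` for any
`c < (2 - ζ(2))/4`, where `ζ(2) = π²/6`. -/
theorem main_term_lower_bound_GRH_version (ε α : ℝ) (hε : 0 < ε) (hεα : ε < α)
    (c : ℝ) (hc : c < (2 - Real.pi ^ 2 / 6) / 4) :
    ∃ x₀ : ℝ, ∀ x : ℝ, x₀ ≤ x →
      c * x ^ (-(2 * ε)) ≤
        ∑ m ∈ Finset.range ⌈x ^ α⌉₊, ∑ n ∈ Finset.range ⌈x ^ α⌉₊,
          if 0 < m ∧ 0 < n ∧ Odd m ∧ Odd n ∧ Nat.Coprime m n ∧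
              x ^ ε < m ∧ (m : ℝ) < x ^ α ∧ x ^ ε < n ∧ (n : ℝ) < x ^ α
            then 1 / ((m : ℝ) ^ 2 * (n : ℝ) ^ 2) else 0 := by
  have hc' : c < 7 / 64 := by nlinarith [Real.pi_gt_d2]
  have hu : Filter.Tendsto (fun x : ℝ => x ^ (-ε)) Filter.atTop (nhds 0) :=
    tendsto_rpow_neg_atTop hε
  have hv : Filter.Tendsto (fun x : ℝ => x ^ (-(α - ε))) Filter.atTop (nhds 0) :=
    tendsto_rpow_neg_atTop (by linarith)
  have hs : Filter.Tendsto (fun x : ℝ => 1 - 2 * x ^ (-ε) - x ^ (-(α - ε)))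
      Filter.atTop (nhds 1) := by
    simpa using (tendsto_const_nhds.sub (hu.const_mul 2)).sub hv
  have hh : Filter.Tendsto (fun x : ℝ => ((1 - 2 * x ^ (-ε) - x ^ (-(α - ε))) / 2) ^ 2 -
      (9 / 64 + 75 / 64 * x ^ (-ε))) Filter.atTop (nhds (7 / 64)) := by
    convert ((hs.div_const 2).pow 2).sub ((hu.const_mul (75 / 64)).const_add (9 / 64)) using 2
    norm_num
  obtain ⟨x₀, hx₀⟩ := Filter.eventually_atTop.1
    ((Filter.eventually_ge_atTop (1 : ℝ)).and
      ((hs.eventually (lt_mem_nhds one_pos)).and (hh.eventually (lt_mem_nhds hc'))))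
  refine ⟨x₀, fun x hx => ?_⟩
  obtain ⟨hx1, hs0, hlt⟩ := hx₀ x hx
  have hx0 : 0 < x := by linarith
  have hX : 1 ≤ x ^ ε := Real.one_le_rpow hx1 hε.le
  have hY : 1 ≤ x ^ α := Real.one_le_rpow hx1 (by linarith)
  have hX2 : x ^ (-(2 * ε)) = 1 / (x ^ ε) ^ 2 := by
    rw [Real.rpow_neg hx0.le, mul_comm, Real.rpow_mul hx0.le, one_div]
    norm_num
  have hu' : x ^ (-ε) = 1 / x ^ ε := by rw [Real.rpow_neg hx0.le, one_div]
  have hv' : x ^ (-(α - ε)) = x ^ ε / x ^ α := by rw [neg_sub, Real.rpow_sub hx0]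
  rw [hu', hv'] at hs0 hlt
  rw [hX2]
  generalize x ^ ε = X at *
  generalize x ^ α = Y at *
  have hX0 : 0 < X := by linarith
  have hY0 : 0 < Y := by linarith
  have hle : (1 - 2 * (1 / X) - X / Y) / X ≤ 1 / (X + 2) - 1 / Y := by
    have h1 : (1 - 2 * (1 / X) - X / Y) / X = (X - 2) / X ^ 2 - 1 / Y := by field_simp
    have h2 : (X - 2) / X ^ 2 ≤ 1 / (X + 2) := by
      rw [div_le_div_iff₀ (by positivity) (by positivity)]
      nlinarith
    linarith
  have hpos : 0 ≤ (1 - 2 * (1 / X) - X / Y) / X := by positivity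
  refine le_trans ?_ (le_sum_coprime_odd_pairs X Y hX hY (hpos.trans hle))
  have hsq : ((1 - 2 * (1 / X) - X / Y) / X / 2) ^ 2 ≤ ((1 / (X + 2) - 1 / Y) / 2) ^ 2 := by
    gcongr
  calc c * (1 / X ^ 2) ≤ (((1 - 2 * (1 / X) - X / Y) / 2) ^ 2 -
        (9 / 64 + 75 / 64 * (1 / X))) * (1 / X ^ 2) := by gcongr
    _ = ((1 - 2 * (1 / X) - X / Y) / X / 2) ^ 2 - (9 / 64 + 75 / 64 * (1 / X)) / X ^ 2 := by ring
    _ ≤ _ := by linarith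
end
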